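/- Let (G_n, c_n) be a high degree almost regular sequence (with parameter γ_n) of connected electric networks on simple graphs G_n. Then the local (Benjamini–Schramm) limit of the weighted spanning tree WST(c_n) is the Poisson(1) Galton–Watson tree conditioned to survive forever: for X_n uniform on V(G_n), every radius r ≥ 0 and every finite rooted tree (H,v), P(B_{WST(c_n)}(X_n, r) ≅ (H,v)) converges to the probability that the r-ball of the conditioned Poisson(1) Galton–Watson tree is rooted-isomorphic to (H,v). -/

import Mathlib

open MeasureTheory Filter Finset

noncomputable section

set_option linter.unusedSectionVars false

namespace WSTPaper

variable {V : Type} [Fintype V] [DecidableEq V]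

/-- The conductance `C_v = Σ_{u ~ v} c(u,v)` of a vertex in the electric network `(G, c)`. -/
def vertCond (G : SimpleGraph V) [DecidableRel G.Adj] (c : Sym2 V → ℝ) (v : V) : ℝ :=
  ∑ u ∈ G.neighborFinset v, c s(u, v)

open scoped Classical in
/-- The edge sets of spanning trees of `G`. -/
def spanningTrees (G : SimpleGraph V) : Finset (Finset (Sym2 V)) :=
  Finset.univ.filter
    (fun T => ↑T ⊆ G.edgeSet ∧ (SimpleGraph.fromEdgeSet (↑T : Set (Sym2 V))).IsTree)

/-- Weight of a spanning tree: product of its edge conductances. -/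
def treeWeight (c : Sym2 V → ℝ) (T : Finset (Sym2 V)) : ℝ := ∏ e ∈ T, c e

/-- Partition function of the weighted spanning tree measure. -/
def partZ (G : SimpleGraph V) (c : Sym2 V → ℝ) : ℝ := ∑ T ∈ spanningTrees G, treeWeight c T

/-- The ball of radius `r` around `x` in `G` (w.r.t. the graph distance), as a set of vertices. -/
def ballSet (G : SimpleGraph V) (x : V) (r : ℕ) : Set V :=
  {y | G.Reachable x y ∧ G.dist x y ≤ r}

lemma mem_ballSet_self (G : SimpleGraph V) (x : V) (r : ℕ) : x ∈ ballSet G x r :=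
  ⟨SimpleGraph.Reachable.refl x, by simp [SimpleGraph.dist_self]⟩

/-- The `r`-ball of `G` around `x` (as an induced rooted subgraph) is rooted-isomorphic to the
rooted graph `(H, w)`. -/
def BallIso (G : SimpleGraph V) (x : V) (r : ℕ) {W : Type} (H : SimpleGraph W) (w : W) : Prop :=
  ∃ φ : SimpleGraph.induce (ballSet G x r) G ≃g H, φ ⟨x, mem_ballSet_self G x r⟩ = w

open scoped Classical in
/-- `P(B_{WST(c)}(X, r) ≅ (H, w))`, where `X` is a uniform random vertex of `G` and `WST(c)`
is the weighted spanning tree of the network `(G, c)`. -/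
def wstBallProb (G : SimpleGraph V) (c : Sym2 V → ℝ) (r : ℕ)
    {W : Type} (H : SimpleGraph W) (w : W) : ℝ :=
  (Fintype.card V : ℝ)⁻¹ *
    ∑ x : V, (∑ T ∈ spanningTrees G,
      if BallIso (SimpleGraph.fromEdgeSet (↑T : Set (Sym2 V))) x r H w then treeWeight c T else 0)
      / partZ G c

open scoped Classical in
/-- The probability that the `r`-ball around the root of the Poisson(1) Galton–Watson tree
conditioned to survive forever is rooted-isomorphic to `(H, w)`.  It is the classical explicit
formula `(k - t)·e^{-t}/|Stab|`, where `k` is the number of vertices of `H`, `t` the number of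
vertices at distance `< r` from the root, and `Stab` the root-preserving automorphism group;
the probability is `0` unless `H` is a tree that coincides with its own `r`-ball around `w`. -/
def pgwBallProb (r : ℕ) {m : ℕ} (H : SimpleGraph (Fin m)) (w : Fin m) : ℝ :=
  if H.IsTree ∧ ∀ x : Fin m, H.dist w x ≤ r then
    ((m : ℝ) - ((Finset.univ.filter fun x : Fin m => H.dist w x < r).card : ℝ)) *
      Real.exp (-(((Finset.univ.filter fun x : Fin m => H.dist w x < r).card : ℝ))) /
      (Nat.card {φ : H ≃g H // φ w = w} : ℝ)
  else 0

/-! ### Parent functions and the matrix-tree theorem -/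

/-- Parent functions rooted at `a`: every orbit reaches the fixed point `a`. -/
def IsPar (a : V) (f : V → V) : Prop := f a = a ∧ ∀ v, ∃ n : ℕ, f^[n] v = a

open scoped Classical in
/-- The parent functions rooted at `a`. -/
def parFun (a : V) : Finset (V → V) := Finset.univ.filter (IsPar a)

/-- The edges joining the non-root vertices to their parents. -/
def parEdges (a : V) (f : V → V) : Finset (Sym2 V) :=
  (Finset.univ.erase a).image fun v => s(v, f v)

/-- The graph Laplacian of directed weights `w`, with row `a` replaced by an identity row. -/
def rootedLap (a : V) (w : V → V → ℝ) : Matrix V V ℝ := fun x y =>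
  if x = a then (if x = y then 1 else 0) else (if x = y then ∑ u, w x u else 0) - w x y

/-- The Laplacian of `w` with the rows and columns of `A` replaced by those of the identity. -/
def lapOff (A : Finset V) (w : V → V → ℝ) : Matrix V V ℝ := fun x y =>
  if x ∈ A ∨ y ∈ A then (if x = y then 1 else 0) else (if x = y then ∑ u, w x u else 0) - w x y

lemma IsPar.exists_depth {a : V} {f : V → V} (h : IsPar a f) :
    ∃ d : V → ℕ, ∀ v, v ≠ a → d (f v) < d v := by
  classical
  refine ⟨fun v => Nat.find (h.2 v), fun v hv => ?_⟩
  have h1 := Nat.find_spec (h.2 v)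
  have h0 : Nat.find (h.2 v) ≠ 0 := by
    intro h0
    rw [h0] at h1
    exact hv h1
  obtain ⟨k, hk⟩ := Nat.exists_eq_succ_of_ne_zero h0
  rw [hk, Function.iterate_succ_apply] at h1
  have : Nat.find (h.2 (f v)) ≤ k := Nat.find_min' _ h1
  show Nat.find (h.2 (f v)) < Nat.find (h.2 v)
  omega

lemma IsPar.of_depth {a : V} {f : V → V} (ha : f a = a) (d : V → ℕ)
    (hd : ∀ v, v ≠ a → d (f v) < d v) : IsPar a f := by
  refine ⟨ha, fun v => ?_⟩
  induction hn : d v using Nat.strong_induction_on generalizing v with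
  | _ n ih =>
    by_cases hv : v = a
    · exact ⟨0, hv⟩
    · obtain ⟨k, hk⟩ := ih _ (hn ▸ hd v hv) (f v) rfl
      exact ⟨k + 1, by rwa [Function.iterate_succ_apply]⟩

lemma det_one_add_of_depth (N : Matrix V V ℝ) (d : V → ℕ)
    (h : ∀ x y, N x y ≠ 0 → d y < d x) : (1 + N).det = 1 := by
  have hb : (1 + N).BlockTriangular (fun x => OrderDual.toDual (d x)) := by
    intro i j hij
    have hij' : d i < d j := hij
    have hne : i ≠ j := by rintro rfl; exact lt_irrefl _ hij'
    have : N i j = 0 := by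
      by_contra h0
      exact absurd (h _ _ h0) (by omega)
    simp [Matrix.one_apply_ne hne, this]
  rw [hb.det]
  refine Finset.prod_eq_one fun k _ => ?_
  have : (1 + N).toSquareBlock (fun x => OrderDual.toDual (d x)) k = 1 := by
    ext i j
    have hi : N i.1 j.1 = 0 := by
      by_contra h0
      have := h _ _ h0
      have h1 := i.2
      have h2 := j.2
      have h3 : d i.1 = d j.1 := by
        have := h1.trans h2.symm
        exact OrderDual.toDual.injective this
      omega
    simp only [Matrix.toSquareBlock_def, Matrix.of_apply, Matrix.add_apply, hi, add_zero,
      Matrix.one_apply, Subtype.ext_iff]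
  rw [this, Matrix.det_one]

/-- The rows of the expansion of `rootedLap`. -/
def parRow (a v u : V) : V → ℝ :=
  if v = a then Pi.single a 1 else Pi.single v 1 - Pi.single u 1

lemma det_parRow_of_isPar {a : V} {f : V → V} (h : IsPar a f) :
    (Matrix.of fun v => parRow a v (f v)).det = 1 := by
  obtain ⟨d, hd⟩ := h.exists_depth
  have : (Matrix.of fun v => parRow a v (f v)) =
      1 + Matrix.of fun v u => if v = a then (0:ℝ) else if u = f v then -1 else 0 := by
    ext v u
    by_cases hv : v = a
    · subst hv
      simp [parRow, Matrix.one_apply, Pi.single_apply, eq_comm]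
    · simp only [parRow, hv, if_false, Matrix.of_apply, Matrix.add_apply, Matrix.one_apply,
        Pi.sub_apply, Pi.single_apply, eq_comm (a := u) (b := v)]
      split_ifs <;> ring
  rw [this]
  refine det_one_add_of_depth _ d fun x y hxy => ?_
  by_cases hx : x = a
  · simp [hx] at hxy
  · by_cases hy : y = f x
    · subst hy; exact hd x hx
    · simp [hx, hy] at hxy

lemma det_parRow_of_not_isPar {a : V} {f : V → V} (ha : f a = a) (h : ¬ IsPar a f) :
    (Matrix.of fun v => parRow a v (f v)).det = 0 := by
  classical
  rw [IsPar, not_and] at h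
  have h' := h ha
  push Not at h'
  obtain ⟨v₀, hv₀⟩ := h'
  rw [← Matrix.exists_mulVec_eq_zero_iff]
  let B : V → ℝ := fun v => if ∃ n : ℕ, f^[n] v = a then 0 else 1
  refine ⟨B, ?_, ?_⟩
  · intro h0
    have := congrFun h0 v₀
    simp only [B, Pi.zero_apply, ite_eq_left_iff, one_ne_zero, imp_false, not_not] at this
    obtain ⟨n, hn⟩ := this
    exact hv₀ n hn
  · have hB : ∀ v, B (f v) = B v := by
      intro v
      have : (∃ n : ℕ, f^[n] (f v) = a) ↔ ∃ n : ℕ, f^[n] v = a := by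
        constructor
        · rintro ⟨n, hn⟩; exact ⟨n + 1, by rwa [Function.iterate_succ_apply]⟩
        · rintro ⟨n, hn⟩
          refine ⟨n, ?_⟩
          rw [← Function.iterate_succ_apply, Function.iterate_succ_apply', hn, ha]
      simp only [B, this]
    have hBa : B a = 0 := by
      simp only [B]
      rw [if_pos ⟨0, rfl⟩]
    ext v
    simp only [Matrix.mulVec, dotProduct, Matrix.of_apply, Pi.zero_apply]
    by_cases hv : v = a
    · subst hv
      simp [parRow, Pi.single_apply, hBa]
    · simp [parRow, hv, Pi.single_apply, sub_mul, Finset.sum_sub_distrib, hB]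

/-- The directed matrix-tree theorem. -/
theorem sum_parFun_prod (a : V) (w : V → V → ℝ) :
    ∑ f ∈ parFun a, ∏ v ∈ Finset.univ.erase a, w v (f v) = (rootedLap a w).det := by
  classical
  let w' : V → V → ℝ := fun v u => if v = a then (if u = a then 1 else 0) else w v u
  have hrow : rootedLap a w = fun v => ∑ u, w' v u • parRow a v u := by
    ext v y
    simp only [Finset.sum_apply, Pi.smul_apply, smul_eq_mul, w']
    by_cases hv : v = a
    · subst hv
      simp [rootedLap, parRow, Pi.single_apply, eq_comm]
    · simp [rootedLap, parRow, hv, Pi.single_apply, mul_sub, Finset.sum_sub_distrib, eq_comm]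
  have hdet : (rootedLap a w).det =
      ∑ f : V → V, (∏ v, w' v (f v)) * (Matrix.of fun v => parRow a v (f v)).det := by
    have := (Matrix.detRowAlternating (R := ℝ) (n := V)).toMultilinearMap.map_sum
      (fun v u => w' v u • parRow a v u)
    rw [hrow]
    refine Eq.trans this ?_
    refine Finset.sum_congr rfl fun f _ => ?_
    exact (Matrix.detRowAlternating (R := ℝ) (n := V)).toMultilinearMap.map_smul_univ
      (fun v => w' v (f v)) (fun v => parRow a v (f v))
  rw [hdet, parFun, Finset.sum_filter]
  refine Finset.sum_congr rfl fun f _ => ?_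
  rw [← Finset.mul_prod_erase _ _ (Finset.mem_univ a)]
  have hp : ∏ v ∈ Finset.univ.erase a, w' v (f v) = ∏ v ∈ Finset.univ.erase a, w v (f v) := by
    refine Finset.prod_congr rfl fun v hv => ?_
    simp [w', (Finset.mem_erase.1 hv).1]
  rw [hp]
  by_cases ha : f a = a
  · by_cases hf : IsPar a f
    · simp [hf, w', ha, det_parRow_of_isPar hf]
    · simp [hf, det_parRow_of_not_isPar ha hf]
  · have hf : ¬ IsPar a f := fun h => ha h.1
    simp [hf, w', ha]

/-- Prescribing the parents of the vertices of `A` turns the rooted Laplacian into `lapOff A`. -/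
lemma det_rootedLap_prescribed {A : Finset V} {a : V} (ha : a ∈ A) (q : V → V) (d : V → ℕ)
    (hq : ∀ v ∈ A, v ≠ a → q v ∈ A ∧ d (q v) < d v) (w : V → V → ℝ) :
    (rootedLap a fun x u => if x ∈ A then (if u = q x then 1 else 0) else w x u).det
      = (lapOff A w).det := by
  let Q : Matrix V V ℝ := 1 + Matrix.of fun x y => if x ∈ A ∧ x ≠ a ∧ y = q x then -1 else 0
  let X : Matrix V V ℝ := 1 + Matrix.of fun x y => if x ∉ A ∧ y ∈ A then - w x y else 0
  have hQ : Q.det = 1 := by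
    refine det_one_add_of_depth _ d fun x y hxy => ?_
    by_cases h : x ∈ A ∧ x ≠ a ∧ y = q x
    · rw [h.2.2]; exact (hq x h.1 h.2.1).2
    · simp [h] at hxy
  have hX : X.det = 1 := by
    refine det_one_add_of_depth _ (fun v => if v ∈ A then 0 else 1) fun x y hxy => ?_
    by_cases h : x ∉ A ∧ y ∈ A
    · simp [h]
    · simp [h] at hxy
  have hXL : X * lapOff A w = Matrix.of fun x y => if x ∈ A then (if x = y then 1 else 0) else
      (if x = y then ∑ u, w x u else 0) - w x y := by
    ext x y
    rw [show X = 1 + Matrix.of _ from rfl, Matrix.add_mul, Matrix.one_mul, Matrix.add_apply,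
      Matrix.mul_apply]
    simp only [Matrix.of_apply]
    by_cases hx : x ∈ A
    · simp [hx, lapOff]
    · by_cases hy : y ∈ A
      · have hxy : x ≠ y := by rintro rfl; exact hx hy
        simp [hx, hy, lapOff, hxy]
      · have : ∀ u, (if x ∉ A ∧ u ∈ A then - w x u else 0) * lapOff A w u y = 0 := by
          intro u
          by_cases hu : u ∈ A
          · have huy : u ≠ y := by rintro rfl; exact hy hu
            simp [lapOff, hu, huy]
          · simp [hu]
        rw [Finset.sum_eq_zero fun u _ => this u]
        simp [lapOff, hx, hy]
  have hfin : (rootedLap a fun x u => if x ∈ A then (if u = q x then 1 else 0) else w x u)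
      = Q * (X * lapOff A w) := by
    rw [hXL]
    ext x y
    rw [show Q = 1 + Matrix.of _ from rfl, Matrix.add_mul, Matrix.one_mul, Matrix.add_apply,
      Matrix.mul_apply]
    simp only [Matrix.of_apply]
    by_cases hx : x ∈ A
    · by_cases hxa : x = a
      · simp [hxa, rootedLap, ha]
      · have hqx := (hq x hx hxa).1
        have key : ∀ F : V → ℝ, ∑ j, (if x ∈ A ∧ x ≠ a ∧ j = q x then (-1 : ℝ) else 0) * F j
            = - F (q x) := by
          intro F
          simp [hx, hxa]
        rw [key]
        simp [hx, hxa, rootedLap, hqx, sub_eq_add_neg, eq_comm (a := y)]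
    · have hxa : x ≠ a := by rintro rfl; exact hx ha
      simp [hx, hxa, rootedLap]
  rw [hfin, Matrix.det_mul, Matrix.det_mul, hQ, hX, one_mul, one_mul]

/-! ### Spanning trees as parent functions -/

lemma IsPar.apply_ne {a : V} {f : V → V} (h : IsPar a f) {v : V} (hv : v ≠ a) : f v ≠ v := by
  obtain ⟨d, hd⟩ := h.exists_depth
  intro h0
  have := hd v hv
  rw [h0] at this
  exact lt_irrefl _ this

lemma IsPar.no_two_cycle {a : V} {f : V → V} (h : IsPar a f) {u v : V} (hv : v ≠ a) (hu : u ≠ a)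
    (h1 : f v = u) (h2 : f u = v) : False := by
  obtain ⟨d, hd⟩ := h.exists_depth
  have h3 := hd v hv
  have h4 := hd u hu
  rw [h1] at h3
  rw [h2] at h4
  omega

lemma parEdges_adj {a : V} {f : V → V} (h : IsPar a f) (x y : V) :
    (SimpleGraph.fromEdgeSet (↑(parEdges a f) : Set (Sym2 V))).Adj x y ↔
      (x ≠ a ∧ f x = y) ∨ (y ≠ a ∧ f y = x) := by
  simp only [SimpleGraph.fromEdgeSet_adj, parEdges, Finset.coe_image, Set.mem_image,
    Finset.mem_coe, Finset.mem_erase, Finset.mem_univ, and_true, Sym2.eq_iff]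
  constructor
  · rintro ⟨⟨v, hv, ⟨rfl, h2⟩ | ⟨rfl, h2⟩⟩, -⟩
    · exact Or.inl ⟨hv, h2⟩
    · exact Or.inr ⟨hv, h2⟩
  · rintro (⟨hx, rfl⟩ | ⟨hy, rfl⟩)
    · exact ⟨⟨x, hx, Or.inl ⟨rfl, rfl⟩⟩, (h.apply_ne hx).symm⟩
    · exact ⟨⟨y, hy, Or.inr ⟨rfl, rfl⟩⟩, h.apply_ne hy⟩

lemma parEdges_injOn {a : V} {f : V → V} (h : IsPar a f) :
    Set.InjOn (fun v => s(v, f v)) (Finset.univ.erase a : Finset V) := by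
  intro v hv u hu huv
  simp only [Finset.coe_erase, Finset.coe_univ, Set.mem_sdiff, Set.mem_univ, true_and,
    Set.mem_singleton_iff] at hv hu
  rcases Sym2.eq_iff.1 huv with ⟨h1, -⟩ | ⟨h1, h2⟩
  · exact h1
  · exact (h.no_two_cycle hv hu h2 h1.symm).elim

lemma card_parEdges {a : V} {f : V → V} (h : IsPar a f) :
    (parEdges a f).card + 1 = Fintype.card V := by
  rw [parEdges, Finset.card_image_of_injOn (parEdges_injOn h),
    Finset.card_erase_of_mem (Finset.mem_univ a), Finset.card_univ]
  exact Nat.sub_add_cancel (Fintype.card_pos_iff.2 ⟨a⟩)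

lemma connected_of_parent {a : V} {f : V → V} (h : IsPar a f) (G : SimpleGraph V)
    (hG : ∀ v, v ≠ a → G.Adj v (f v)) : G.Connected := by
  obtain ⟨d, hd⟩ := h.exists_depth
  have hr : ∀ n v, d v = n → G.Reachable v a := by
    intro n
    induction n using Nat.strong_induction_on with
    | _ n ih =>
      intro v hv
      by_cases hva : v = a
      · rw [hva]
      · exact (hG v hva).reachable.trans (ih _ (hv ▸ hd v hva) (f v) rfl)
  have : Nonempty V := ⟨a⟩
  exact ⟨fun u v => (hr _ u rfl).trans (hr _ v rfl).symm⟩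

lemma parEdges_edgeSet {a : V} {f : V → V} (h : IsPar a f) :
    (SimpleGraph.fromEdgeSet (↑(parEdges a f) : Set (Sym2 V))).edgeSet = ↑(parEdges a f) := by
  rw [SimpleGraph.edgeSet_fromEdgeSet]
  ext e
  simp only [Set.mem_sdiff, Finset.mem_coe]
  refine ⟨fun h => h.1, fun he => ⟨he, ?_⟩⟩
  simp only [parEdges, Finset.mem_image, Finset.mem_erase, Finset.mem_univ, and_true] at he
  obtain ⟨v, hv, rfl⟩ := he
  simpa [eq_comm] using h.apply_ne hv

lemma isTree_parEdges {a : V} {f : V → V} (h : IsPar a f) :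
    (SimpleGraph.fromEdgeSet (↑(parEdges a f) : Set (Sym2 V))).IsTree := by
  rw [SimpleGraph.isTree_iff_connected_and_card]
  refine ⟨connected_of_parent h _ fun v hv => (parEdges_adj h _ _).2 (Or.inl ⟨hv, rfl⟩), ?_⟩
  rw [parEdges_edgeSet h]
  simp [card_parEdges h]

lemma isPar_ext {a : V} {f g : V → V} (hf : IsPar a f) (hg : IsPar a g)
    (h : parEdges a f = parEdges a g) : f = g := by
  have hadj : ∀ x y, ((x ≠ a ∧ f x = y) ∨ (y ≠ a ∧ f y = x)) ↔
      ((x ≠ a ∧ g x = y) ∨ (y ≠ a ∧ g y = x)) := by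
    intro x y
    rw [← parEdges_adj hf, ← parEdges_adj hg, h]
  have hstep : ∀ v, f v ≠ g v → f (f v) ≠ g (f v) := by
    intro v hv
    have hva : v ≠ a := by
      rintro rfl
      exact hv (hf.1.trans hg.1.symm)
    rcases (hadj v (f v)).1 (Or.inl ⟨hva, rfl⟩) with ⟨-, h1⟩ | ⟨h1, h2⟩
    · exact (hv h1.symm).elim
    · rw [h2]
      intro h3
      exact hf.no_two_cycle hva h1 rfl h3
  funext v
  by_contra hv
  have hn : ∀ n, f (f^[n] v) ≠ g (f^[n] v) := by
    intro n
    induction n with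
    | zero => exact hv
    | succ n ih => rw [Function.iterate_succ_apply']; exact hstep _ ih
  obtain ⟨n, hn'⟩ := hf.2 v
  have := hn n
  rw [hn', hf.1, hg.1] at this
  exact this rfl

/-- Every tree is given by a parent function. -/
lemma exists_isPar_of_isTree {G : SimpleGraph V} (hG : G.IsTree) (a : V) :
    ∃ f, IsPar a f ∧ (∀ v, v ≠ a → G.dist a (f v) < G.dist a v) ∧
      ∀ x y, G.Adj x y ↔ (x ≠ a ∧ f x = y) ∨ (y ≠ a ∧ f y = x) := by
  classical
  have hex : ∀ v, ∃ u, v ≠ a → G.Adj v u ∧ G.dist a u < G.dist a v := by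
    intro v
    by_cases hv : v = a
    · exact ⟨v, fun h => (h hv).elim⟩
    · obtain ⟨p, hp⟩ := hG.connected.exists_walk_length_eq_dist v a
      cases p with
      | nil => exact (hv rfl).elim
      | @cons _ u _ huv q =>
        refine ⟨u, fun _ => ⟨huv, ?_⟩⟩
        rw [SimpleGraph.dist_comm, SimpleGraph.dist_comm (u := a) (v := v), ← hp]
        exact lt_of_le_of_lt (SimpleGraph.dist_le q) (by simp)
  choose f₀ hf₀ using hex
  let f : V → V := fun v => if v = a then a else f₀ v
  have hf : ∀ v, v ≠ a → G.Adj v (f v) ∧ G.dist a (f v) < G.dist a v := by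
    intro v hv
    simpa [f, hv] using hf₀ v hv
  have hpar : IsPar a f :=
    IsPar.of_depth (by simp [f]) (fun v => G.dist a v) fun v hv => (hf v hv).2
  refine ⟨f, hpar, fun v hv => (hf v hv).2, ?_⟩
  have hsub : (parEdges a f : Finset (Sym2 V)) ⊆ G.edgeFinset := by
    intro e he
    simp only [parEdges, Finset.mem_image, Finset.mem_erase, Finset.mem_univ, and_true] at he
    obtain ⟨v, hv, rfl⟩ := he
    simpa using (hf v hv).1
  have heq : parEdges a f = G.edgeFinset := by
    refine Finset.eq_of_subset_of_card_le hsub ?_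
    have h1 := hG.card_edgeFinset
    have h2 := card_parEdges hpar
    omega
  intro x y
  rw [← parEdges_adj hpar, heq]
  simp

/-- The directed kernel of a network. -/
def kern (G : SimpleGraph V) [DecidableRel G.Adj] (c : Sym2 V → ℝ) (x y : V) : ℝ :=
  if G.Adj x y then c s(x, y) else 0

lemma sum_spanningTrees (G : SimpleGraph V) [DecidableRel G.Adj] (c : Sym2 V → ℝ) (a : V)
    (F : Finset (Sym2 V) → ℝ) :
    ∑ T ∈ spanningTrees G, treeWeight c T * F T =
      ∑ f ∈ parFun a, (∏ v ∈ Finset.univ.erase a, kern G c v (f v)) * F (parEdges a f) := by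
  classical
  have h1 : ∑ f ∈ parFun a, (∏ v ∈ Finset.univ.erase a, kern G c v (f v)) * F (parEdges a f)
      = ∑ f ∈ (parFun a).filter (fun f => ∀ v, v ≠ a → G.Adj v (f v)),
        treeWeight c (parEdges a f) * F (parEdges a f) := by
    rw [Finset.sum_filter]
    refine Finset.sum_congr rfl fun f hf => ?_
    have hf' : IsPar a f := by simpa [parFun] using hf
    split_ifs with h
    · rw [treeWeight, parEdges, Finset.prod_image (parEdges_injOn hf')]
      congr 1
      refine Finset.prod_congr rfl fun v hv => ?_
      rw [kern, if_pos (h v (Finset.mem_erase.1 hv).1)]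
    · push Not at h
      obtain ⟨v, hv, hva⟩ := h
      rw [Finset.prod_eq_zero (Finset.mem_erase.2 ⟨hv, Finset.mem_univ v⟩), zero_mul]
      rw [kern, if_neg hva]
  rw [h1]
  symm
  refine Finset.sum_nbij (fun f => parEdges a f) ?_ ?_ ?_ (fun _ _ => rfl)
  · intro f hf
    simp only [Finset.mem_filter, parFun, Finset.mem_univ, true_and] at hf
    simp only [spanningTrees, Finset.mem_filter, Finset.mem_univ, true_and]
    refine ⟨?_, isTree_parEdges hf.1⟩
    intro e he
    simp only [parEdges, Finset.mem_coe, Finset.mem_image, Finset.mem_erase, Finset.mem_univ,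
      and_true] at he
    obtain ⟨v, hv, rfl⟩ := he
    exact hf.2 v hv
  · intro f hf g hg hfg
    simp only [Finset.coe_filter, parFun, Finset.mem_filter, Finset.mem_univ, true_and,
      Set.mem_ofPred_eq] at hf hg
    exact isPar_ext hf.1 hg.1 hfg
  · intro T hT
    simp only [spanningTrees, Finset.coe_filter, Finset.mem_univ, true_and,
      Set.mem_ofPred_eq] at hT
    obtain ⟨f, hf, -, hadj⟩ := exists_isPar_of_isTree hT.2 a
    have hTf : parEdges a f = T := by
      have h2 : (SimpleGraph.fromEdgeSet (↑(parEdges a f) : Set (Sym2 V))) =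
          SimpleGraph.fromEdgeSet (↑T : Set (Sym2 V)) := by
        ext x y
        rw [parEdges_adj hf, hadj]
      have h3 := congrArg SimpleGraph.edgeSet h2
      rw [parEdges_edgeSet hf, SimpleGraph.edgeSet_fromEdgeSet] at h3
      have h4 : (↑T : Set (Sym2 V)) \ {e | e.IsDiag} = ↑T := by
        ext e
        simp only [Set.mem_sdiff, Set.mem_ofPred_eq, and_iff_left_iff_imp]
        exact fun he => G.not_isDiag_of_mem_edgeSet (hT.1 he)
      exact Finset.coe_injective (h3.trans h4)
    refine ⟨f, ?_, hTf⟩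
    simp only [Finset.coe_filter, parFun, Finset.mem_filter, Finset.mem_univ, true_and,
      Set.mem_ofPred_eq]
    refine ⟨hf, fun v hv => (SimpleGraph.mem_edgeSet G).1 (hT.1 ?_)⟩
    rw [← hTf]
    simp only [parEdges, Finset.coe_image, Set.mem_image, Finset.coe_erase, Finset.coe_univ]
    exact ⟨v, ⟨trivial, hv⟩, rfl⟩

/-! ### Determinantal formulas for spanning tree events -/

open scoped Classical in
lemma sum_parFun_prescribed {A : Finset V} {a : V} (ha : a ∈ A) (q : V → V) (d : V → ℕ)
    (hq : ∀ v ∈ A, v ≠ a → q v ∈ A ∧ d (q v) < d v) (w : V → V → ℝ) :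
    ∑ f ∈ parFun a, (if ∀ v ∈ A, v ≠ a → f v = q v then ∏ v ∈ Aᶜ, w v (f v) else 0)
      = (lapOff A w).det := by
  rw [← det_rootedLap_prescribed ha q d hq, ← sum_parFun_prod]
  refine Finset.sum_congr rfl fun f _ => ?_
  have hsub : Aᶜ ⊆ Finset.univ.erase a := by
    intro v hv
    simp only [Finset.mem_compl] at hv
    simp only [Finset.mem_erase, Finset.mem_univ, and_true]
    rintro rfl
    exact hv ha
  split_ifs with h
  · refine Finset.prod_subset_one_on_sdiff hsub ?_ ?_
    · intro v hv
      simp only [Finset.mem_sdiff, Finset.mem_erase, Finset.mem_univ, and_true,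
        Finset.mem_compl, not_not] at hv
      simp [hv.2, h v hv.2 hv.1]
    · intro v hv
      simp only [Finset.mem_compl] at hv
      simp [hv]
  · push Not at h
    obtain ⟨v, hvA, hva, hne⟩ := h
    symm
    refine Finset.prod_eq_zero (i := v) (by simp [hva]) ?_
    simp [hvA, hne]

theorem partZ_eq_det (G : SimpleGraph V) [DecidableRel G.Adj] (c : Sym2 V → ℝ) (a : V) :
    partZ G c = (lapOff {a} (kern G c)).det := by
  have h := sum_spanningTrees G c a (fun _ => 1)
  simp only [mul_one] at h
  rw [partZ, h, ← sum_parFun_prescribed (A := {a}) (a := a) (by simp) id (fun _ => 0) (by simp)]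
  refine Finset.sum_congr rfl fun f _ => ?_
  rw [if_pos (by simp)]
  refine Finset.prod_congr ?_ fun _ _ => rfl
  ext v
  simp

open scoped Classical in
theorem sum_trees_edge (G : SimpleGraph V) [DecidableRel G.Adj] (c : Sym2 V → ℝ) {x y : V}
    (hxy : x ≠ y) :
    ∑ T ∈ spanningTrees G, treeWeight c T * (if s(x, y) ∈ T then 1 else 0)
      = kern G c x y * (lapOff {x, y} (kern G c)).det := by
  rw [sum_spanningTrees G c y (fun T => if s(x, y) ∈ T then 1 else 0),
    ← sum_parFun_prescribed (A := {x, y}) (a := y) (by simp) (fun _ => y)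
      (fun v => if v = y then 0 else 1) (by simp [hxy]), Finset.mul_sum]
  refine Finset.sum_congr rfl fun f hf => ?_
  have hf' : IsPar y f := by simpa [parFun] using hf
  have h1 : s(x, y) ∈ parEdges y f ↔ f x = y := by
    simp only [parEdges, Finset.mem_image, Finset.mem_erase, Finset.mem_univ, and_true,
      Sym2.eq_iff]
    constructor
    · rintro ⟨v, hv, ⟨rfl, h2⟩ | ⟨h1, h2⟩⟩
      · exact h2
      · exact (hv h1).elim
    · intro h
      exact ⟨x, hxy, Or.inl ⟨rfl, h⟩⟩
  have h2 : (∀ v ∈ ({x, y} : Finset V), v ≠ y → f v = y) ↔ f x = y := by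
    simp [hxy]
  simp only [h1, h2]
  split_ifs with h
  · have : Finset.univ.erase y = insert x ({x, y}ᶜ : Finset V) := by
      ext v
      simp only [Finset.mem_erase, Finset.mem_univ, and_true, Finset.mem_insert,
        Finset.mem_compl, Finset.mem_singleton]
      by_cases hvx : v = x
      · simp [hvx, hxy]
      · simp [hvx]
    rw [mul_one, this, Finset.prod_insert (by simp), h]
  · simp

open scoped Classical in
lemma sum_adj_of_isTree {Γ : SimpleGraph V} (h : Γ.IsTree) :
    ∑ x : V, ∑ y : V, (if Γ.Adj x y then (1 : ℝ) else 0) = 2 * ((Fintype.card V : ℝ) - 1) := by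
  have h4 : ∀ x, ∑ y : V, (if Γ.Adj x y then (1 : ℝ) else 0) = (Γ.degree x : ℝ) := by
    intro x
    rw [Finset.sum_boole, ← SimpleGraph.card_neighborFinset_eq_degree]
    have : (Finset.univ.filter fun y => Γ.Adj x y) = Γ.neighborFinset x := by
      ext y
      simp
    rw [this]
  simp only [h4]
  rw [← Nat.cast_sum, Γ.sum_degrees_eq_twice_card_edges]
  have h5 := h.card_edgeFinset
  rw [← h5]
  push_cast
  ring

open scoped Classical in
theorem sum_kern_det (G : SimpleGraph V) [DecidableRel G.Adj] (c : Sym2 V → ℝ) :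
    ∑ x, ∑ y, kern G c x y * (lapOff {x, y} (kern G c)).det
      = 2 * ((Fintype.card V : ℝ) - 1) * partZ G c := by
  have h1 : ∀ x y, kern G c x y * (lapOff {x, y} (kern G c)).det =
      ∑ T ∈ spanningTrees G, treeWeight c T * (if s(x, y) ∈ T then 1 else 0) := by
    intro x y
    by_cases hxy : x = y
    · subst hxy
      rw [kern, if_neg (G.loopless.irrefl x), zero_mul]
      symm
      refine Finset.sum_eq_zero fun T hT => ?_
      rw [if_neg, mul_zero]
      intro h
      simp only [spanningTrees, Finset.mem_filter, Finset.mem_univ, true_and] at hT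
      exact G.loopless.irrefl x ((SimpleGraph.mem_edgeSet G).1 (hT.1 h))
    · rw [sum_trees_edge G c hxy]
  simp only [h1]
  have h2 : ∑ x : V, ∑ y : V, ∑ T ∈ spanningTrees G,
      treeWeight c T * (if s(x, y) ∈ T then (1 : ℝ) else 0)
      = ∑ T ∈ spanningTrees G, treeWeight c T *
        ∑ x : V, ∑ y : V, (if s(x, y) ∈ T then (1 : ℝ) else 0) := by
    simp only [Finset.mul_sum]
    rw [Finset.sum_congr rfl fun x _ => Finset.sum_comm, Finset.sum_comm]
  rw [h2, partZ, Finset.mul_sum]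
  refine Finset.sum_congr rfl fun T hT => ?_
  simp only [spanningTrees, Finset.mem_filter, Finset.mem_univ, true_and] at hT
  rw [mul_comm]
  congr 1
  set GT := SimpleGraph.fromEdgeSet (↑T : Set (Sym2 V)) with hGT
  have h3 : ∀ x y, s(x, y) ∈ T ↔ GT.Adj x y := by
    intro x y
    rw [hGT, SimpleGraph.fromEdgeSet_adj]
    refine ⟨fun h => ⟨h, ?_⟩, fun h => h.1⟩
    rintro rfl
    exact G.loopless.irrefl x ((SimpleGraph.mem_edgeSet G).1 (hT.1 h))
  simp only [h3]
  rw [← sum_adj_of_isTree hT.2]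
  refine Finset.sum_congr rfl fun x _ => Finset.sum_congr rfl fun y _ => ?_
  congr

/-- `φ` embeds `H` into `Γ`, the vertices of `S` having no neighbours outside the image. -/
def IsEmb {m : ℕ} (H : SimpleGraph (Fin m)) (S : Finset (Fin m)) (φ : Fin m → V)
    (Γ : SimpleGraph V) : Prop :=
  Function.Injective φ ∧ (∀ i j, H.Adj i j → Γ.Adj (φ i) (φ j)) ∧
    ∀ i ∈ S, ∀ y, Γ.Adj (φ i) y → ∃ j, H.Adj i j ∧ y = φ j

lemma isEmb_parEdges_iff {m : ℕ} {H : SimpleGraph (Fin m)} {w : Fin m} {p : Fin m → Fin m}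
    (hp : IsPar w p) (hH : ∀ x y, H.Adj x y ↔ (x ≠ w ∧ p x = y) ∨ (y ≠ w ∧ p y = x))
    (S : Finset (Fin m)) {φ : Fin m → V} (hφ : Function.Injective φ) {f : V → V}
    (hf : IsPar (φ w) f) :
    IsEmb H S φ (SimpleGraph.fromEdgeSet (↑(parEdges (φ w) f) : Set (Sym2 V))) ↔
      (∀ j, j ≠ w → f (φ j) = φ (p j)) ∧ ∀ v, (∀ j, v ≠ φ j) → ∀ i ∈ S, f v ≠ φ i := by
  constructor
  · rintro ⟨-, h2, h3⟩
    constructor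
    · obtain ⟨d, hd⟩ := hp.exists_depth
      have key : ∀ n j, d j = n → j ≠ w → f (φ j) = φ (p j) := by
        intro n
        induction n using Nat.strong_induction_on with
        | _ n ih =>
          intro j hj hjw
          have hadj := h2 j (p j) ((hH _ _).2 (Or.inl ⟨hjw, rfl⟩))
          rcases (parEdges_adj hf _ _).1 hadj with ⟨-, h⟩ | ⟨hne, h⟩
          · exact h
          · have hpw : p j ≠ w := fun h0 => hne (by rw [h0])
            have h5 := ih _ (hj ▸ hd j hjw) (p j) rfl hpw
            rw [h5] at h
            exact (hp.no_two_cycle hjw hpw rfl (hφ h)).elim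
      exact fun j => key _ j rfl
    · intro v hv i hi hvi
      obtain ⟨j, -, hj⟩ := h3 i hi v ((parEdges_adj hf _ _).2 (Or.inr ⟨hv w, hvi⟩))
      exact hv j hj
  · rintro ⟨h1, h2⟩
    refine ⟨hφ, ?_, ?_⟩
    · intro i j hij
      rw [parEdges_adj hf]
      rcases (hH _ _).1 hij with ⟨hi, rfl⟩ | ⟨hj, rfl⟩
      · exact Or.inl ⟨fun h => hi (hφ h), h1 i hi⟩
      · exact Or.inr ⟨fun h => hj (hφ h), h1 j hj⟩
    · intro i hi y hy
      rcases (parEdges_adj hf _ _).1 hy with ⟨hne, h⟩ | ⟨hne, h⟩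
      · have hiw : i ≠ w := fun h0 => hne (by rw [h0])
        exact ⟨p i, (hH _ _).2 (Or.inl ⟨hiw, rfl⟩), by rw [← h, h1 i hiw]⟩
      · by_cases hy' : ∃ j, y = φ j
        · obtain ⟨j, rfl⟩ := hy'
          have hjw : j ≠ w := fun h0 => hne (by rw [h0])
          refine ⟨j, (hH _ _).2 (Or.inr ⟨hjw, ?_⟩), rfl⟩
          rw [h1 j hjw] at h
          exact hφ h
        · push Not at hy'
          exact (h2 y hy' i hi h).elim

/-- The Dirichlet Laplacian off `A` with the killing of the escape edges into `B ⊆ A`. -/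
def escLap (A B : Finset V) (k : V → V → ℝ) : Matrix V V ℝ :=
  lapOff A k - Matrix.diagonal fun x => if x ∈ A then 0 else ∑ u ∈ B, k x u

lemma lapOff_restrict {A B : Finset V} (hBA : B ⊆ A) (k : V → V → ℝ) :
    lapOff A (fun x u => if u ∈ B then 0 else k x u) = escLap A B k := by
  ext x y
  simp only [lapOff, escLap, Matrix.sub_apply, Matrix.diagonal_apply]
  by_cases hx : x ∈ A
  · simp [hx]
  · by_cases hy : y ∈ A
    · have hxy : x ≠ y := by rintro rfl; exact hx hy
      simp [hy, hxy]
    · have hyB : y ∉ B := fun h => hy (hBA h)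
      simp only [hx, hy, hyB, or_self, if_false]
      by_cases hxy : x = y
      · simp only [hxy, if_true]
        have : ∑ u, k y u = ∑ u, (if u ∈ B then 0 else k y u) + ∑ u ∈ B, k y u := by
          rw [← Finset.sum_filter_add_sum_filter_not Finset.univ (· ∈ B) (k y), add_comm]
          congr 1
          · rw [Finset.sum_filter]
            refine Finset.sum_congr rfl fun u _ => ?_
            by_cases h : u ∈ B <;> simp [h]
          · simp
        rw [this]
        ring
      · simp [hxy]

open scoped Classical in
theorem sum_trees_emb (G : SimpleGraph V) [DecidableRel G.Adj] (c : Sym2 V → ℝ) {m : ℕ}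
    {H : SimpleGraph (Fin m)} {w : Fin m} {p : Fin m → Fin m}
    (hp : IsPar w p) (hH : ∀ x y, H.Adj x y ↔ (x ≠ w ∧ p x = y) ∨ (y ≠ w ∧ p y = x))
    (S : Finset (Fin m)) {φ : Fin m → V} (hφ : Function.Injective φ) :
    ∑ T ∈ spanningTrees G, treeWeight c T *
        (if IsEmb H S φ (SimpleGraph.fromEdgeSet (↑T : Set (Sym2 V))) then 1 else 0)
      = (∏ j ∈ Finset.univ.erase w, kern G c (φ j) (φ (p j))) *
        (escLap (Finset.univ.image φ) (S.image φ) (kern G c)).det := by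
  obtain ⟨d, hd⟩ := hp.exists_depth
  rw [sum_spanningTrees G c (φ w)
      (fun T => if IsEmb H S φ (SimpleGraph.fromEdgeSet (↑T : Set (Sym2 V))) then 1 else 0),
    ← lapOff_restrict (Finset.image_subset_image (Finset.subset_univ S)),
    ← sum_parFun_prescribed (a := φ w) (by simp) (Function.extend φ (φ ∘ p) id)
      (Function.extend φ d 0), Finset.mul_sum]
  · refine Finset.sum_congr rfl fun f hf => ?_
    have hf' : IsPar (φ w) f := by simpa [parFun] using hf
    rw [isEmb_parEdges_iff hp hH S hφ hf']
    have h1 : (∀ v ∈ Finset.univ.image φ, v ≠ φ w → f v = Function.extend φ (φ ∘ p) id v) ↔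
        ∀ j, j ≠ w → f (φ j) = φ (p j) := by
      simp [hφ.extend_apply, hφ.eq_iff]
    simp only [h1]
    by_cases h : ∀ j, j ≠ w → f (φ j) = φ (p j)
    · have hsplit : ∏ v ∈ Finset.univ.erase (φ w), kern G c v (f v)
          = (∏ j ∈ Finset.univ.erase w, kern G c (φ j) (φ (p j))) *
            ∏ v ∈ (Finset.univ.image φ)ᶜ, kern G c v (f v) := by
        have : Finset.univ.erase (φ w) =
            ((Finset.univ.erase w).image φ) ∪ (Finset.univ.image φ)ᶜ := by
          ext v
          simp only [Finset.mem_erase, Finset.mem_univ, and_true, Finset.mem_union,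
            Finset.mem_image, Finset.mem_compl, true_and, not_exists]
          constructor
          · intro hv
            by_cases hv' : ∃ j, φ j = v
            · obtain ⟨j, rfl⟩ := hv'
              exact Or.inl ⟨j, fun h => hv (by rw [h]), rfl⟩
            · push Not at hv'
              exact Or.inr hv'
          · rintro (⟨j, hj, rfl⟩ | hv)
            · exact fun h => hj (hφ h)
            · exact fun h => hv w h.symm
        rw [this, Finset.prod_union, Finset.prod_image (fun _ _ _ _ h => hφ h)]
        · congr 1
          refine Finset.prod_congr rfl fun j hj => ?_
          rw [h j (Finset.mem_erase.1 hj).1]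
        · rw [Finset.disjoint_left]
          intro v hv hv'
          simp only [Finset.mem_image, Finset.mem_compl, Finset.mem_univ, true_and] at hv hv'
          obtain ⟨j, -, hj⟩ := hv
          exact hv' ⟨j, hj⟩
      rw [hsplit, if_pos h, mul_assoc]
      congr 1
      by_cases h2 : ∀ v, (∀ j, v ≠ φ j) → ∀ i ∈ S, f v ≠ φ i
      · rw [if_pos ⟨h, h2⟩, mul_one]
        refine Finset.prod_congr rfl fun v hv => ?_
        rw [if_neg]
        simp only [Finset.mem_image, not_exists, not_and, Finset.mem_compl, Finset.mem_univ,
          true_and] at hv ⊢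
        exact fun i hi h3 => h2 v (fun j h4 => hv j h4.symm) i hi h3.symm
      · rw [if_neg (fun h3 => h2 h3.2), mul_zero]
        push Not at h2
        obtain ⟨v, hv, i, hi, hvi⟩ := h2
        symm
        refine Finset.prod_eq_zero (i := v) ?_ ?_
        · simp only [Finset.mem_image, not_exists, Finset.mem_compl, Finset.mem_univ, true_and]
          exact fun j h => hv j h.symm
        · rw [if_pos]
          rw [hvi]
          exact Finset.mem_image_of_mem _ hi
    · rw [if_neg h, if_neg (fun h3 => h h3.1)]
      simp
  · intro v hv hvw
    simp only [Finset.mem_image, Finset.mem_univ, true_and] at hv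
    obtain ⟨j, rfl⟩ := hv
    have hjw : j ≠ w := fun h => hvw (by rw [h])
    simp only [hφ.extend_apply, Function.comp_apply]
    exact ⟨by simp, hd j hjw⟩

/-! ### Balls of trees as embeddings -/

lemma exists_walk_induce_ball {Γ : SimpleGraph V} (hΓ : Γ.IsTree) (x : V) (r : ℕ) (y : V)
    (hy : y ∈ ballSet Γ x r) :
    ∃ p : (SimpleGraph.induce (ballSet Γ x r) Γ).Walk ⟨x, mem_ballSet_self Γ x r⟩ ⟨y, hy⟩,
      p.length ≤ Γ.dist x y := by
  obtain ⟨f, hf, hd, hadj⟩ := exists_isPar_of_isTree hΓ x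
  induction hn : Γ.dist x y using Nat.strong_induction_on generalizing y with
  | _ n ih =>
    by_cases hyx : y = x
    · subst hyx
      exact ⟨SimpleGraph.Walk.nil, by simp⟩
    · have h1 := hd y hyx
      have hfy : f y ∈ ballSet Γ x r := ⟨hΓ.connected x (f y), h1.le.trans hy.2⟩
      obtain ⟨p, hp⟩ := ih _ (hn ▸ h1) (f y) hfy rfl
      have hyf : (SimpleGraph.induce (ballSet Γ x r) Γ).Adj ⟨f y, hfy⟩ ⟨y, hy⟩ := by
        simp only [SimpleGraph.comap_adj, Function.Embedding.subtype_apply]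
        exact (hadj _ _).2 (Or.inr ⟨hyx, rfl⟩)
      refine ⟨p.concat hyf, ?_⟩
      rw [SimpleGraph.Walk.length_concat]
      omega

lemma isTree_of_ballIso {Γ : SimpleGraph V} (hΓ : Γ.IsTree) {x : V} {r m : ℕ}
    {H : SimpleGraph (Fin m)} {w : Fin m} (h : BallIso Γ x r H w) :
    H.IsTree ∧ ∀ i, H.dist w i ≤ r := by
  obtain ⟨ψ, hψ⟩ := h
  have hw : ∀ i, ∃ p : H.Walk w i, p.length ≤ r := by
    intro i
    obtain ⟨p, hp⟩ := exists_walk_induce_ball hΓ x r (ψ.symm i).1 (ψ.symm i).2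
    have h1 : ψ ⟨(ψ.symm i).1, (ψ.symm i).2⟩ = i := by simp
    refine ⟨(p.map ψ.toHom).copy hψ h1, ?_⟩
    rw [SimpleGraph.Walk.length_copy, SimpleGraph.Walk.length_map]
    exact hp.trans (ψ.symm i).2.2
  refine ⟨⟨?_, ?_⟩, fun i => ?_⟩
  · have : Nonempty (Fin m) := ⟨w⟩
    refine ⟨fun i j => ?_⟩
    obtain ⟨p, -⟩ := hw i
    obtain ⟨q, -⟩ := hw j
    exact ⟨p.reverse.append q⟩
  · rw [← ψ.isAcyclic_iff]
    exact hΓ.isAcyclic.induce _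
  · obtain ⟨p, hp⟩ := hw i
    exact (SimpleGraph.dist_le p).trans hp

lemma dist_map_le {m : ℕ} {H : SimpleGraph (Fin m)} (hH : H.Connected) {Γ : SimpleGraph V}
    {φ : Fin m → V} (hφ : ∀ i j, H.Adj i j → Γ.Adj (φ i) (φ j)) (i j : Fin m) :
    Γ.dist (φ i) (φ j) ≤ H.dist i j := by
  obtain ⟨p, hp⟩ := hH.exists_walk_length_eq_dist i j
  have := SimpleGraph.dist_le (p.map (⟨φ, fun h => hφ _ _ h⟩ : H →g Γ))
  rw [SimpleGraph.Walk.length_map, hp] at this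
  exact this

/-- The vertices of `H` at distance less than `r` from `w`. -/
def innerSet {m : ℕ} (H : SimpleGraph (Fin m)) (w : Fin m) (r : ℕ) : Finset (Fin m) :=
  Finset.univ.filter fun x => H.dist w x < r

lemma isEmb_of_iso {Γ : SimpleGraph V} (hΓ : Γ.IsTree) {x : V} {r m : ℕ}
    {H : SimpleGraph (Fin m)} {w : Fin m} (hH : H.Connected)
    (e : H ≃g SimpleGraph.induce (ballSet Γ x r) Γ) (hw : (e w).1 = x) :
    IsEmb H (innerSet H w r) (fun j => (e j).1) Γ := by
  have hadj : ∀ i j, H.Adj i j → Γ.Adj (e i).1 (e j).1 := by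
    intro i j hij
    have := e.map_adj_iff.2 hij
    simpa using this
  refine ⟨fun i j hij => e.injective (Subtype.ext hij), hadj, ?_⟩
  intro i hi y hy
  simp only [innerSet, Finset.mem_filter, Finset.mem_univ, true_and] at hi
  have h1 := dist_map_le hH hadj w i
  rw [hw] at h1
  have h2 : Γ.dist x y ≤ Γ.dist x (e i).1 + 1 := by
    have := hΓ.connected.dist_triangle (u := x) (v := (e i).1) (w := y)
    rwa [SimpleGraph.dist_eq_one_iff_adj.2 hy] at this
  have hyb : y ∈ ballSet Γ x r := ⟨hΓ.connected x y, by omega⟩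
  refine ⟨e.symm ⟨y, hyb⟩, ?_, by simp⟩
  rw [← e.map_adj_iff]
  simpa using hy

lemma exists_iso_of_isEmb {Γ : SimpleGraph V} (hΓ : Γ.IsTree) {x : V} {r m : ℕ}
    {H : SimpleGraph (Fin m)} {w : Fin m} (hH : H.IsTree) (hr : ∀ i, H.dist w i ≤ r)
    {φ : Fin m → V} (hφ : IsEmb H (innerSet H w r) φ Γ) (hw : φ w = x) :
    ∃ e : H ≃g SimpleGraph.induce (ballSet Γ x r) Γ, ∀ j, (e j).1 = φ j := by
  subst hw
  obtain ⟨f, hf, hd, hadj⟩ := exists_isPar_of_isTree hΓ (φ w)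
  obtain ⟨p, hp, -, hpadj⟩ := exists_isPar_of_isTree hH w
  have hΓf : Γ = SimpleGraph.fromEdgeSet (↑(parEdges (φ w) f) : Set (Sym2 V)) := by
    ext u v
    rw [hadj, parEdges_adj hf]
  have hkey := ((isEmb_parEdges_iff hp hpadj (innerSet H w r) hφ.1 hf).1 (hΓf ▸ hφ)).1
  have hiff : ∀ i j, Γ.Adj (φ i) (φ j) ↔ H.Adj i j := by
    refine fun i j => ⟨fun h => ?_, hφ.2.1 i j⟩
    rw [hpadj]
    rcases (hadj _ _).1 h with ⟨h1, h2⟩ | ⟨h1, h2⟩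
    · have hi : i ≠ w := fun h => h1 (by rw [h])
      exact Or.inl ⟨hi, hφ.1 ((hkey i hi).symm.trans h2)⟩
    · have hj : j ≠ w := fun h => h1 (by rw [h])
      exact Or.inr ⟨hj, hφ.1 ((hkey j hj).symm.trans h2)⟩
  have hmem : ∀ j, φ j ∈ ballSet Γ (φ w) r := fun j =>
    ⟨hΓ.connected _ _, (dist_map_le hH.connected hφ.2.1 w j).trans (hr j)⟩
  have hsurj : ∀ n y, Γ.dist (φ w) y = n → n ≤ r → ∃ j, φ j = y ∧ H.dist w j ≤ n := by
    intro n
    induction n using Nat.strong_induction_on with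
    | _ n ih =>
      intro y hy hn
      by_cases hyw : y = φ w
      · exact ⟨w, hyw.symm, by simp⟩
      · have h1 := hd y hyw
        obtain ⟨j', hj', hdj'⟩ := ih _ (hy ▸ h1) (f y) rfl (by omega)
        have hS : j' ∈ innerSet H w r := by
          simp only [innerSet, Finset.mem_filter, Finset.mem_univ, true_and]
          omega
        obtain ⟨j, hj, hyj⟩ := hφ.2.2 j' hS y (by
          rw [hj']; exact (hadj _ _).2 (Or.inr ⟨hyw, rfl⟩))
        refine ⟨j, hyj.symm, ?_⟩
        have := hH.connected.dist_triangle (u := w) (v := j') (w := j)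
        rw [SimpleGraph.dist_eq_one_iff_adj.2 hj] at this
        omega
  let F : Fin m → ballSet Γ (φ w) r := fun j => ⟨φ j, hmem j⟩
  have hF : Function.Bijective F := by
    refine ⟨fun i j hij => hφ.1 (congrArg Subtype.val hij), fun y => ?_⟩
    obtain ⟨j, hj, -⟩ := hsurj _ y.1 rfl y.2.2
    exact ⟨j, Subtype.ext hj⟩
  refine ⟨⟨Equiv.ofBijective F hF, ?_⟩, fun j => rfl⟩
  intro i j
  simpa [F] using hiff i j

open scoped Classical in
theorem card_isEmb {Γ : SimpleGraph V} (hΓ : Γ.IsTree) (x : V) {r m : ℕ}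
    {H : SimpleGraph (Fin m)} {w : Fin m} (hH : H.IsTree) (hr : ∀ i, H.dist w i ≤ r) :
    (Finset.univ.filter fun φ : Fin m → V =>
        IsEmb H (innerSet H w r) φ Γ ∧ φ w = x).card =
      if BallIso Γ x r H w then Nat.card {σ : H ≃g H // σ w = w} else 0 := by
  split_ifs with h
  · obtain ⟨ψ, hψ⟩ := h
    have hψ' : (ψ.symm w).1 = x := by
      rw [← hψ]; simp
    rw [← Fintype.card_subtype, ← Nat.card_eq_fintype_card]
    symm
    refine Nat.card_eq_of_bijective (fun σ => ⟨fun j => (ψ.symm (σ.1 j)).1, ?_, ?_⟩) ⟨?_, ?_⟩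
    · exact isEmb_of_iso hΓ hH.connected (σ.1.trans ψ.symm) (by simpa [σ.2] using hψ')
    · simpa [σ.2] using hψ'
    · intro σ τ hστ
      refine Subtype.ext (RelIso.ext fun j => ?_)
      have := congrFun (congrArg Subtype.val hστ) j
      exact ψ.symm.injective (Subtype.ext this)
    · rintro ⟨φ, hφ, hw⟩
      obtain ⟨e, he⟩ := exists_iso_of_isEmb hΓ hH hr hφ hw
      refine ⟨⟨e.trans ψ, ?_⟩, ?_⟩
      · have : e w = ⟨x, mem_ballSet_self Γ x r⟩ := Subtype.ext ((he w).trans hw)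
        simp only [RelIso.trans_apply, this, hψ]
      · refine Subtype.ext (funext fun j => ?_)
        simp [he]
  · rw [Finset.card_eq_zero, Finset.filter_eq_empty_iff]
    rintro φ - ⟨hφ, hw⟩
    obtain ⟨e, he⟩ := exists_iso_of_isEmb hΓ hH hr hφ hw
    refine h ⟨e.symm, ?_⟩
    rw [← e.symm_apply_apply w]
    congr 1
    exact Subtype.ext (((he w).trans hw).symm)

open scoped Classical in
/-- The total weight of the spanning trees into which `φ` embeds `H`. -/
def embWeight (G : SimpleGraph V) (c : Sym2 V → ℝ) {m : ℕ} (H : SimpleGraph (Fin m))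
    (S : Finset (Fin m)) (φ : Fin m → V) : ℝ :=
  ∑ T ∈ spanningTrees G, treeWeight c T *
    (if IsEmb H S φ (SimpleGraph.fromEdgeSet (↑T : Set (Sym2 V))) then 1 else 0)

theorem wstBallProb_eq (G : SimpleGraph V) (c : Sym2 V → ℝ) {r m : ℕ}
    {H : SimpleGraph (Fin m)} {w : Fin m} (hH : H.IsTree) (hr : ∀ i, H.dist w i ≤ r) :
    wstBallProb G c r H w = (Fintype.card V : ℝ)⁻¹ *
      (Nat.card {σ : H ≃g H // σ w = w} : ℝ)⁻¹ *
      ((∑ φ : Fin m → V, embWeight G c H (innerSet H w r) φ) / partZ G c) := by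
  classical
  have hN : (Nat.card {σ : H ≃g H // σ w = w} : ℝ) ≠ 0 := by
    have : Finite (H ≃g H) :=
      Finite.of_injective (fun e => (e : Fin m → Fin m)) DFunLike.coe_injective
    have : Nonempty {σ : H ≃g H // σ w = w} := ⟨⟨RelIso.refl _, rfl⟩⟩
    exact_mod_cast Nat.card_pos.ne'
  set N : ℝ := (Nat.card {σ : H ≃g H // σ w = w} : ℝ) with hNdef
  have h1 : ∀ x : V, ∑ T ∈ spanningTrees G,
      (if BallIso (SimpleGraph.fromEdgeSet (↑T : Set (Sym2 V))) x r H w then treeWeight c T else 0)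
      = N⁻¹ * ∑ φ : Fin m → V, if φ w = x then embWeight G c H (innerSet H w r) φ else 0 := by
    intro x
    have h2 : ∑ φ : Fin m → V, (if φ w = x then embWeight G c H (innerSet H w r) φ else 0)
        = ∑ T ∈ spanningTrees G, treeWeight c T * ∑ φ : Fin m → V,
          if (IsEmb H (innerSet H w r) φ (SimpleGraph.fromEdgeSet (↑T : Set (Sym2 V))) ∧ φ w = x)
            then (1 : ℝ) else 0 := by
      simp only [Finset.mul_sum]
      rw [Finset.sum_comm]
      refine Finset.sum_congr rfl fun φ _ => ?_
      by_cases h : φ w = x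
      · simp [h, embWeight]
      · simp [h]
    rw [h2, Finset.mul_sum]
    refine Finset.sum_congr rfl fun T hT => ?_
    simp only [spanningTrees, Finset.mem_filter, Finset.mem_univ, true_and] at hT
    rw [Finset.sum_boole, card_isEmb hT.2 x hH hr]
    split_ifs
    · rw [← hNdef]
      field_simp
    · simp
  rw [wstBallProb, mul_assoc]
  congr 1
  rw [← Finset.sum_div, ← mul_div_assoc]
  congr 1
  simp only [h1]
  rw [← Finset.mul_sum]
  congr 1
  rw [Finset.sum_comm]
  refine Finset.sum_congr rfl fun φ _ => ?_
  simp

theorem wstBallProb_eq_zero (G : SimpleGraph V) (c : Sym2 V → ℝ) {r m : ℕ}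
    {H : SimpleGraph (Fin m)} {w : Fin m} (h : ¬ (H.IsTree ∧ ∀ i, H.dist w i ≤ r)) :
    wstBallProb G c r H w = 0 := by
  rw [wstBallProb]
  refine mul_eq_zero_of_right _ (Finset.sum_eq_zero fun x _ => ?_)
  rw [Finset.sum_eq_zero, zero_div]
  intro T hT
  simp only [spanningTrees, Finset.mem_filter, Finset.mem_univ, true_and] at hT
  rw [if_neg]
  exact fun hb => h (isTree_of_ballIso hT.2 hb)

/-! ### Sums over maps of products along a rooted tree -/

lemma sum_agree_insert {ι : Type} [Fintype ι] [DecidableEq ι] {s : Finset ι} {j : ι} (hj : j ∉ s)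
    (φ₀ : ι → V) (g : (ι → V) → ℝ) :
    ∑ φ ∈ Finset.univ.filter (fun φ : ι → V => ∀ i, i ∉ insert j s → φ i = φ₀ i), g φ =
      ∑ φ ∈ Finset.univ.filter (fun φ : ι → V => ∀ i, i ∉ s → φ i = φ₀ i),
        ∑ v, g (Function.update φ j v) := by
  rw [← Finset.sum_product']
  refine Finset.sum_bij' (fun φ _ => (Function.update φ j (φ₀ j), φ j))
    (fun x _ => Function.update x.1 j x.2) ?_ ?_ ?_ ?_ ?_
  · intro φ hφ
    simp only [Finset.mem_filter, Finset.mem_univ, true_and, Finset.mem_insert, not_or] at hφ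
    simp only [Finset.mem_product, Finset.mem_filter, Finset.mem_univ, true_and, and_true]
    intro i hi
    by_cases hij : i = j
    · subst hij; simp
    · rw [Function.update_of_ne hij]; exact hφ i ⟨hij, hi⟩
  · rintro ⟨φ, v⟩ hφ
    simp only [Finset.mem_product, Finset.mem_filter, Finset.mem_univ, true_and, and_true] at hφ
    simp only [Finset.mem_filter, Finset.mem_univ, true_and, Finset.mem_insert, not_or]
    rintro i ⟨hij, hi⟩
    rw [Function.update_of_ne hij]; exact hφ i hi
  · intro φ _
    simp
  · rintro ⟨φ, v⟩ hφ
    simp only [Finset.mem_product, Finset.mem_filter, Finset.mem_univ, true_and, and_true] at hφ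
    simp [← hφ j hj]
  · intro φ _
    simp

lemma treeSum_agree {ι : Type} [Fintype ι] [DecidableEq ι] (p : ι → ι) (d : ι → ℕ)
    (K : ι → V → V → ℝ) (ρ : ι → ℝ) (hK : ∀ j u, ∑ v, K j u v = ρ j) (φ₀ : ι → V) (s : Finset ι)
    (hs : ∀ j ∈ s, d (p j) < d j) :
    ∑ φ ∈ Finset.univ.filter (fun φ : ι → V => ∀ i, i ∉ s → φ i = φ₀ i),
      ∏ j ∈ s, K j (φ (p j)) (φ j) = ∏ j ∈ s, ρ j := by
  induction s using Finset.induction_on_max_value d with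
  | empty =>
    have : (Finset.univ.filter fun φ : ι → V => ∀ i, i ∉ (∅ : Finset ι) → φ i = φ₀ i) = {φ₀} := by
      ext φ
      simp [funext_iff]
    rw [this]
    simp
  | insert j s hj hmax ih =>
    rw [sum_agree_insert hj, Finset.prod_insert hj,
      ← ih (fun i hi => hs i (Finset.mem_insert_of_mem hi)), Finset.mul_sum]
    refine Finset.sum_congr rfl fun φ _ => ?_
    have hpj : p j ≠ j := fun h => by
      have := hs j (Finset.mem_insert_self _ _)
      rw [h] at this
      exact lt_irrefl _ this
    rw [← hK j (φ (p j)), Finset.sum_mul]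
    refine Finset.sum_congr rfl fun v _ => ?_
    rw [Finset.prod_insert hj, Function.update_self, Function.update_of_ne hpj]
    congr 1
    refine Finset.prod_congr rfl fun i hi => ?_
    have h1 : i ≠ j := fun h => hj (h ▸ hi)
    have h2 : p i ≠ j := fun h => by
      have h3 := hs i (Finset.mem_insert_of_mem hi)
      have h4 := hmax i hi
      rw [h] at h3
      omega
    rw [Function.update_of_ne h1, Function.update_of_ne h2]

/-- Exact evaluation of a rooted tree sum with constant row sums. -/
theorem treeSum_eq {ι : Type} [Fintype ι] [DecidableEq ι] {i : ι} {p : ι → ι} (hp : IsPar i p)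
    (K : ι → V → V → ℝ) (ρ : ι → ℝ) (hK : ∀ j u, ∑ v, K j u v = ρ j) (z : V) :
    ∑ φ ∈ Finset.univ.filter (fun φ : ι → V => φ i = z),
      ∏ j ∈ Finset.univ.erase i, K j (φ (p j)) (φ j) = ∏ j ∈ Finset.univ.erase i, ρ j := by
  obtain ⟨d, hd⟩ := hp.exists_depth
  have := treeSum_agree p d K ρ hK (fun _ => z) (Finset.univ.erase i)
    (fun j hj => hd j (Finset.mem_erase.1 hj).1)
  simpa using this

lemma treeSum_le {ι : Type} [Fintype ι] [DecidableEq ι] {i : ι} {p : ι → ι} (hp : IsPar i p)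
    (K : ι → V → V → ℝ) (hK0 : ∀ j u v, 0 ≤ K j u v) (ρ : ι → ℝ)
    (hK : ∀ j u, ∑ v, K j u v ≤ ρ j) (z : V) :
    ∑ φ ∈ Finset.univ.filter (fun φ : ι → V => φ i = z),
      ∏ j ∈ Finset.univ.erase i, K j (φ (p j)) (φ j) ≤ ∏ j ∈ Finset.univ.erase i, ρ j := by
  let K' : ι → V → V → ℝ := fun j u v => K j u v + if v = u then ρ j - ∑ v, K j u v else 0
  rw [← treeSum_eq hp K' ρ (fun j u => by simp [K', Finset.sum_add_distrib]) z]
  refine Finset.sum_le_sum fun φ _ => Finset.prod_le_prod (fun j _ => hK0 _ _ _) fun j _ => ?_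
  simp only [K']
  split_ifs
  · linarith [hK j (φ (p j))]
  · linarith

/-! ### Counting embeddings in a fixed tree -/

lemma parent_mem_innerSet {r m : ℕ} {H : SimpleGraph (Fin m)} {w : Fin m} (hH : H.IsTree)
    (hr : ∀ i, H.dist w i ≤ r) {i : Fin m} (hi : i ∈ innerSet H w r) {p : Fin m → Fin m}
    (hp : IsPar i p) (hadj : ∀ x y, H.Adj x y ↔ (x ≠ i ∧ p x = y) ∨ (y ≠ i ∧ p y = x))
    {j : Fin m} (hj : j ≠ i) : p j ∈ innerSet H w r := by
  obtain ⟨q, hq, hd, hqadj⟩ := exists_isPar_of_isTree hH w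
  by_contra hl
  have hli : p j ≠ i := fun h => hl (h ▸ hi)
  simp only [innerSet, Finset.mem_filter, Finset.mem_univ, true_and, not_lt] at hi hl
  have hnb : ∀ x, H.Adj (p j) x → x = q (p j) := by
    intro x hx
    rcases (hqadj _ _).1 hx with ⟨-, h⟩ | ⟨hxw, h⟩
    · exact h.symm
    · have h1 := hd x hxw
      rw [h] at h1
      have := hr x
      omega
  have h1 := hnb j ((hadj _ _).2 (Or.inr ⟨hj, rfl⟩))
  have h2 := hnb (p (p j)) ((hadj _ _).2 (Or.inl ⟨hli, rfl⟩))
  exact hp.no_two_cycle hj hli rfl (h2.trans h1.symm)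

open scoped Classical in
lemma IsEmb.card_nbr_le {m : ℕ} {H : SimpleGraph (Fin m)} {S : Finset (Fin m)} {φ : Fin m → V}
    {Γ : SimpleGraph V} (h : IsEmb H S φ Γ) {i : Fin m} (hi : i ∈ S) :
    (Finset.univ.filter fun y => Γ.Adj (φ i) y).card ≤ m := by
  calc (Finset.univ.filter fun y => Γ.Adj (φ i) y).card ≤ (Finset.univ.image φ).card := by
        refine Finset.card_le_card fun y hy => ?_
        obtain ⟨j, -, rfl⟩ := h.2.2 i hi y (by simpa using hy)
        exact Finset.mem_image_of_mem _ (Finset.mem_univ j)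
    _ ≤ m := Finset.card_image_le.trans (by simp)

open scoped Classical in
lemma card_isEmb_at_le {r m : ℕ} {H : SimpleGraph (Fin m)} {w : Fin m} (hH : H.IsTree)
    (hr : ∀ i, H.dist w i ≤ r) {i : Fin m} (hi : i ∈ innerSet H w r) (Γ : SimpleGraph V) (z : V) :
    (Finset.univ.filter fun φ : Fin m → V => IsEmb H (innerSet H w r) φ Γ ∧ φ i = z).card
      ≤ m ^ m := by
  obtain ⟨p, hp, -, hadj⟩ := exists_isPar_of_isTree hH i
  have hm : 1 ≤ m := Nat.one_le_of_lt i.2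
  let K : Fin m → V → V → ℝ := fun _ u v =>
    if Γ.Adj u v ∧ (Finset.univ.filter fun y => Γ.Adj u y).card ≤ m then 1 else 0
  have h1 := treeSum_le hp K (fun j u v => by simp only [K]; split_ifs <;> norm_num)
    (fun _ => (m : ℝ)) (fun j u => by
      simp only [K]
      by_cases h : (Finset.univ.filter fun y => Γ.Adj u y).card ≤ m
      · simp [h]
      · simp [h]) z
  have h2 : ((Finset.univ.filter fun φ : Fin m → V =>
      IsEmb H (innerSet H w r) φ Γ ∧ φ i = z).card : ℝ) ≤
      ∑ φ ∈ Finset.univ.filter (fun φ : Fin m → V => φ i = z),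
      ∏ j ∈ Finset.univ.erase i, K j (φ (p j)) (φ j) := by
    have hle : ∀ φ ∈ Finset.univ.filter (fun φ : Fin m → V =>
        IsEmb H (innerSet H w r) φ Γ ∧ φ i = z),
        (1 : ℝ) ≤ ∏ j ∈ Finset.univ.erase i, K j (φ (p j)) (φ j) := by
      intro φ hφ
      simp only [Finset.mem_filter, Finset.mem_univ, true_and] at hφ
      rw [Finset.prod_eq_one]
      intro j hj
      have hji := (Finset.mem_erase.1 hj).1
      refine if_pos ⟨hφ.1.2.1 _ _ ((hadj _ _).2 (Or.inr ⟨hji, rfl⟩)), ?_⟩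
      exact hφ.1.card_nbr_le (parent_mem_innerSet hH hr hi hp hadj hji)
    calc _ = ∑ φ ∈ Finset.univ.filter (fun φ : Fin m → V =>
          IsEmb H (innerSet H w r) φ Γ ∧ φ i = z), (1 : ℝ) := by simp
      _ ≤ _ := Finset.sum_le_sum hle
      _ ≤ _ := by
        refine Finset.sum_le_sum_of_subset_of_nonneg ?_ ?_
        · intro φ hφ
          simp only [Finset.mem_filter, Finset.mem_univ, true_and] at hφ ⊢
          exact hφ.2
        · intro φ _ _
          refine Finset.prod_nonneg fun j _ => ?_
          simp only [K]; split_ifs <;> norm_num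
  have h3 : ∏ j ∈ Finset.univ.erase i, (m : ℝ) ≤ (m : ℝ) ^ m := by
    rw [Finset.prod_const]
    refine pow_le_pow_right₀ (by exact_mod_cast hm) ?_
    exact (Finset.card_le_univ _).trans (by simp)
  exact_mod_cast h2.trans (h1.trans h3)

open scoped Classical in
/-- Few embeddings of `H` in a tree use a vertex of `B` or an edge of `E`. -/
theorem card_isEmb_bad_le {r m : ℕ} {H : SimpleGraph (Fin m)} {w : Fin m} (hH : H.IsTree)
    (hr : ∀ i, H.dist w i ≤ r) {q : Fin m → Fin m} (hq : IsPar w q)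
    (hadj : ∀ x y, H.Adj x y ↔ (x ≠ w ∧ q x = y) ∨ (y ≠ w ∧ q y = x))
    (Γ : SimpleGraph V) (B : Finset V) (E : V → V → Prop) :
    (Finset.univ.filter fun φ : Fin m → V => IsEmb H (innerSet H w r) φ Γ ∧
        ((∃ s ∈ innerSet H w r, φ s ∈ B) ∨ ∃ j, j ≠ w ∧ E (φ (q j)) (φ j))).card
      ≤ m ^ (m + 1) * (B.card +
        (Finset.univ.filter fun x : V × V => Γ.Adj x.1 x.2 ∧ E x.1 x.2).card) := by
  have hsub : (Finset.univ.filter fun φ : Fin m → V => IsEmb H (innerSet H w r) φ Γ ∧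
        ((∃ s ∈ innerSet H w r, φ s ∈ B) ∨ ∃ j, j ≠ w ∧ E (φ (q j)) (φ j))) ⊆
      ((innerSet H w r ×ˢ B).biUnion fun x => Finset.univ.filter fun φ : Fin m → V =>
        IsEmb H (innerSet H w r) φ Γ ∧ φ x.1 = x.2) ∪
      (((Finset.univ.erase w) ×ˢ
        (Finset.univ.filter fun x : V × V => Γ.Adj x.1 x.2 ∧ E x.1 x.2)).biUnion
        fun x => Finset.univ.filter fun φ : Fin m → V =>
        IsEmb H (innerSet H w r) φ Γ ∧ φ (q x.1) = x.2.1) := by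
    intro φ hφ
    simp only [Finset.mem_filter, Finset.mem_univ, true_and] at hφ
    obtain ⟨hφ, ⟨s, hs, hsB⟩ | ⟨j, hj, hE⟩⟩ := hφ
    · refine Finset.mem_union_left _ (Finset.mem_biUnion.2 ⟨(s, φ s), ?_, ?_⟩)
      · exact Finset.mem_product.2 ⟨hs, hsB⟩
      · simp [hφ]
    · refine Finset.mem_union_right _ (Finset.mem_biUnion.2 ⟨(j, (φ (q j), φ j)), ?_, ?_⟩)
      · refine Finset.mem_product.2 ⟨by simpa using hj, ?_⟩
        simp only [Finset.mem_filter, Finset.mem_univ, true_and]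
        exact ⟨hφ.2.1 _ _ ((hadj _ _).2 (Or.inr ⟨hj, rfl⟩)), hE⟩
      · simp [hφ]
  have hw : ∀ j, j ≠ w → w ∈ innerSet H w r := by
    intro j hj
    simp only [innerSet, Finset.mem_filter, Finset.mem_univ, true_and, SimpleGraph.dist_self]
    have h1 : H.dist w j ≠ 0 := by
      rw [Ne, hH.connected.dist_eq_zero_iff]
      exact fun h => hj h.symm
    have := hr j
    omega
  refine (Finset.card_le_card hsub).trans ((Finset.card_union_le _ _).trans ?_)
  rw [mul_add]
  refine add_le_add ?_ ?_
  · refine (Finset.card_biUnion_le_card_mul _ _ (m ^ m) fun x hx => ?_).trans ?_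
    · exact card_isEmb_at_le hH hr (Finset.mem_product.1 hx).1 Γ _
    · rw [Finset.card_product, pow_succ']
      have : (innerSet H w r).card ≤ m := (Finset.card_le_univ _).trans (by simp)
      calc _ ≤ (m * B.card) * m ^ m := by gcongr
        _ = _ := by ring
  · refine (Finset.card_biUnion_le_card_mul _ _ (m ^ m) fun x hx => ?_).trans ?_
    · have hx1 := (Finset.mem_erase.1 (Finset.mem_product.1 hx).1).1
      exact card_isEmb_at_le hH hr (parent_mem_innerSet hH hr (hw _ hx1) hq hadj hx1) Γ _
    · rw [Finset.card_product, pow_succ']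
      have : ((Finset.univ : Finset (Fin m)).erase w).card ≤ m :=
        (Finset.card_le_univ _).trans (by simp)
      calc _ ≤ (m * _) * m ^ m := Nat.mul_le_mul_right _ (Nat.mul_le_mul_right _ this)
        _ = _ := by ring

/-! ### Dirichlet energy and Green functions -/

section Green

/-- Symmetric nonnegative irreducible conductances. -/
structure IsNet (k : V → V → ℝ) : Prop where
  symm : ∀ x y, k x y = k y x
  nonneg : ∀ x y, 0 ≤ k x y
  diag : ∀ x, k x x = 0
  irr : ∀ f : V → ℝ, (∀ x y, k x y ≠ 0 → f x = f y) → ∀ x y, f x = f y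

lemma isNet_kern {G : SimpleGraph V} [DecidableRel G.Adj] {c : Sym2 V → ℝ} (hG : G.Connected)
    (hc : ∀ e ∈ G.edgeSet, 0 < c e) : IsNet (kern G c) where
  symm x y := by
    simp only [kern, G.adj_comm x y, Sym2.eq_swap]
  nonneg x y := by
    simp only [kern]
    split_ifs with h
    · exact (hc _ h).le
    · exact le_rfl
  diag x := by simp [kern]
  irr f hf := by
    have h1 : ∀ x y, G.Adj x y → f x = f y := by
      intro x y h
      refine hf x y ?_
      rw [kern, if_pos h]
      exact (hc _ h).ne'
    intro x y
    obtain ⟨p⟩ := hG x y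
    induction p with
    | nil => rfl
    | cons h _ ih => exact (h1 _ _ h).trans ih

/-- The Dirichlet energy form. -/
def en (k : V → V → ℝ) : (V → ℝ) →ₗ[ℝ] (V → ℝ) →ₗ[ℝ] ℝ :=
  LinearMap.mk₂ ℝ (fun f g => (1 / 2) * ∑ x, ∑ y, k x y * ((f x - f y) * (g x - g y)))
    (fun f f' g => by
      rw [← mul_add, ← Finset.sum_add_distrib]
      simp_rw [← Finset.sum_add_distrib, Pi.add_apply]
      congr 1
      refine Finset.sum_congr rfl fun x _ => Finset.sum_congr rfl fun y _ => ?_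
      ring)
    (fun a f g => by
      simp only [Pi.smul_apply, smul_eq_mul, Finset.mul_sum]
      refine Finset.sum_congr rfl fun x _ => Finset.sum_congr rfl fun y _ => ?_
      ring)
    (fun f g g' => by
      rw [← mul_add, ← Finset.sum_add_distrib]
      simp_rw [← Finset.sum_add_distrib, Pi.add_apply]
      congr 1
      refine Finset.sum_congr rfl fun x _ => Finset.sum_congr rfl fun y _ => ?_
      ring)
    (fun a f g => by
      simp only [Pi.smul_apply, smul_eq_mul, Finset.mul_sum]
      refine Finset.sum_congr rfl fun x _ => Finset.sum_congr rfl fun y _ => ?_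
      ring)

lemma en_apply (k : V → V → ℝ) (f g : V → ℝ) :
    en k f g = (1 / 2) * ∑ x, ∑ y, k x y * ((f x - f y) * (g x - g y)) := rfl

lemma en_comm (k : V → V → ℝ) (f g : V → ℝ) : en k f g = en k g f := by
  simp only [en_apply]
  congr 1
  refine Finset.sum_congr rfl fun x _ => Finset.sum_congr rfl fun y _ => ?_
  ring

variable {k : V → V → ℝ}

lemma IsNet.en_nonneg (hk : IsNet k) (f : V → ℝ) : 0 ≤ en k f f := by
  rw [en_apply]
  refine mul_nonneg (by norm_num) (Finset.sum_nonneg fun x _ => Finset.sum_nonneg fun y _ => ?_)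
  exact mul_nonneg (hk.nonneg x y) (mul_self_nonneg _)

lemma IsNet.en_sq_le (hk : IsNet k) (f g : V → ℝ) : en k f g ^ 2 ≤ en k f f * en k g g := by
  have h : ∀ t : ℝ, 0 ≤ en k f f * (t * t) + (2 * en k f g) * t + en k g g := by
    intro t
    have := hk.en_nonneg (t • f + g)
    simp only [map_add, map_smul, LinearMap.add_apply, LinearMap.smul_apply, smul_eq_mul,
      en_comm k g f] at this
    linarith
  have := discrim_le_zero h
  rw [discrim] at this
  nlinarith

lemma IsNet.const_of_en_eq_zero (hk : IsNet k) {f : V → ℝ} (h : en k f f = 0) (x y : V) :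
    f x = f y := by
  refine hk.irr f (fun x y hxy => ?_) x y
  rw [en_apply, mul_eq_zero, or_iff_right (by norm_num)] at h
  have hnn : ∀ x y, 0 ≤ k x y * ((f x - f y) * (f x - f y)) := fun x y =>
    mul_nonneg (hk.nonneg x y) (mul_self_nonneg _)
  rw [Finset.sum_eq_zero_iff_of_nonneg (fun x _ => Finset.sum_nonneg fun y _ => hnn x y)] at h
  have h1 := h x (Finset.mem_univ x)
  rw [Finset.sum_eq_zero_iff_of_nonneg (fun y _ => hnn x y)] at h1
  have h2 := h1 y (Finset.mem_univ y)
  rw [mul_eq_zero, or_iff_right hxy, mul_self_eq_zero] at h2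
  linarith

lemma IsNet.en_eq_sum (hk : IsNet k) (f g : V → ℝ) :
    en k f g = ∑ x, f x * ∑ y, k x y * (g x - g y) := by
  have h1 : ∑ x, ∑ y, k x y * ((f x - f y) * (g x - g y)) =
      ∑ x, ∑ y, k x y * (f x * (g x - g y)) + ∑ x, ∑ y, k x y * (f y * (g y - g x)) := by
    rw [← Finset.sum_add_distrib]
    refine Finset.sum_congr rfl fun x _ => ?_
    rw [← Finset.sum_add_distrib]
    refine Finset.sum_congr rfl fun y _ => ?_
    ring
  have h2 : ∑ x, ∑ y, k x y * (f y * (g y - g x)) = ∑ x, ∑ y, k x y * (f x * (g x - g y)) := by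
    rw [Finset.sum_comm]
    refine Finset.sum_congr rfl fun x _ => Finset.sum_congr rfl fun y _ => ?_
    rw [hk.symm]
  have h3 : ∑ x, f x * ∑ y, k x y * (g x - g y) = ∑ x, ∑ y, k x y * (f x * (g x - g y)) := by
    refine Finset.sum_congr rfl fun x _ => ?_
    rw [Finset.mul_sum]
    refine Finset.sum_congr rfl fun y _ => ?_
    ring
  rw [en_apply, h1, h2, h3]
  ring

lemma en_sub_const (f g : V → ℝ) (a : ℝ) : en k f (fun x => g x - a) = en k f g := by
  simp only [en_apply]
  congr 1
  refine Finset.sum_congr rfl fun x _ => Finset.sum_congr rfl fun y _ => ?_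
  ring

lemma lapOff_mulVec_of_mem {A : Finset V} {x : V} (hx : x ∈ A) (f : V → ℝ) :
    (lapOff A k).mulVec f x = f x := by
  simp [Matrix.mulVec, dotProduct, lapOff, hx]

lemma lapOff_mulVec_of_notMem {A : Finset V} {x : V} (hx : x ∉ A) {f : V → ℝ}
    (hf : ∀ y ∈ A, f y = 0) :
    (lapOff A k).mulVec f x = ∑ y, k x y * (f x - f y) := by
  have h1 : ∀ y, lapOff A k x y * f y =
      (if x = y then (∑ u, k x u) * f x else 0) - k x y * f y := by
    intro y
    by_cases hy : y ∈ A
    · have hxy : x ≠ y := by rintro rfl; exact hx hy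
      simp [lapOff, hx, hy, hxy, hf y hy]
    · by_cases hxy : x = y
      · subst hxy
        simp [lapOff, hx, sub_mul]
      · simp [lapOff, hx, hy, hxy]
  simp only [Matrix.mulVec, dotProduct, h1, Finset.sum_sub_distrib, mul_sub]
  simp [Finset.sum_mul]

lemma IsNet.en_eq_mulVec (hk : IsNet k) {A : Finset V} {f g : V → ℝ} (hf : ∀ y ∈ A, f y = 0)
    (hg : ∀ y ∈ A, g y = 0) : en k f g = ∑ x, f x * (lapOff A k).mulVec g x := by
  rw [hk.en_eq_sum]
  refine Finset.sum_congr rfl fun x _ => ?_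
  by_cases hx : x ∈ A
  · simp [hf x hx]
  · rw [lapOff_mulVec_of_notMem hx hg]

lemma IsNet.det_lapOff_ne_zero (hk : IsNet k) {A : Finset V} (hA : A.Nonempty) :
    (lapOff A k).det ≠ 0 := by
  intro h
  rw [← Matrix.exists_mulVec_eq_zero_iff] at h
  obtain ⟨f, hf0, hf⟩ := h
  have hA0 : ∀ y ∈ A, f y = 0 := fun y hy => by
    rw [← lapOff_mulVec_of_mem (k := k) hy f, hf]; rfl
  have h1 : en k f f = 0 := by
    rw [hk.en_eq_mulVec hA0 hA0, hf]
    simp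
  obtain ⟨a, ha⟩ := hA
  refine hf0 (funext fun x => ?_)
  rw [hk.const_of_en_eq_zero h1 x a, hA0 a ha]
  rfl

/-- The Green function with pole `v`, killed on `A`. -/
def green (k : V → V → ℝ) (A : Finset V) (v u : V) : ℝ := (lapOff A k)⁻¹ u v

lemma IsNet.mulVec_green (hk : IsNet k) {A : Finset V} (hA : A.Nonempty) (v : V) :
    (lapOff A k).mulVec (green k A v) = Pi.single v 1 := by
  have h : lapOff A k * (lapOff A k)⁻¹ = 1 :=
    Matrix.mul_nonsing_inv _ (isUnit_iff_ne_zero.2 (hk.det_lapOff_ne_zero hA))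
  ext u
  have := congrFun (congrFun h u) v
  rw [Matrix.mul_apply] at this
  simp only [Matrix.mulVec, dotProduct, green, this, Matrix.one_apply, Pi.single_apply]

lemma IsNet.green_eq_zero (hk : IsNet k) {A : Finset V} {u v : V} (hu : u ∈ A) (hv : v ∉ A) :
    green k A v u = 0 := by
  rw [← lapOff_mulVec_of_mem (k := k) hu (green k A v), hk.mulVec_green ⟨u, hu⟩]
  exact Pi.single_eq_of_ne (by rintro rfl; exact hv hu) _

lemma IsNet.en_green (hk : IsNet k) {A : Finset V} (hA : A.Nonempty) {v : V} (hv : v ∉ A)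
    {f : V → ℝ} (hf : ∀ y ∈ A, f y = 0) : en k (green k A v) f = f v := by
  rw [en_comm, hk.en_eq_mulVec hf (fun y hy => hk.green_eq_zero hy hv), hk.mulVec_green hA]
  simp [Pi.single_apply]

lemma IsNet.en_green_green (hk : IsNet k) {A : Finset V} (hA : A.Nonempty) {u v : V}
    (hu : u ∉ A) (hv : v ∉ A) : en k (green k A v) (green k A u) = green k A u v :=
  hk.en_green hA hv fun _ hy => hk.green_eq_zero hy hu

lemma IsNet.green_comm (hk : IsNet k) {A : Finset V} (hA : A.Nonempty) {u v : V}
    (hu : u ∉ A) (hv : v ∉ A) : green k A u v = green k A v u := by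
  rw [← hk.en_green_green hA hu hv, en_comm, hk.en_green_green hA hv hu]

lemma IsNet.green_self_nonneg (hk : IsNet k) {A : Finset V} (hA : A.Nonempty) {v : V}
    (hv : v ∉ A) : 0 ≤ green k A v v := by
  rw [← hk.en_green_green hA hv hv]
  exact hk.en_nonneg _

/-- The Green function is the representative of least energy. -/
lemma IsNet.green_self_le (hk : IsNet k) {A : Finset V} (hA : A.Nonempty) {v : V}
    (hv : v ∉ A) {h : V → ℝ} (hh : ∀ f : V → ℝ, (∀ y ∈ A, f y = 0) → en k h f = f v) :
    green k A v v ≤ en k h h := by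
  have h1 := hk.en_nonneg (h - green k A v)
  have h2 := hh (green k A v) fun y hy => hk.green_eq_zero hy hv
  have h3 := hk.en_green_green hA hv hv
  simp only [map_sub, LinearMap.sub_apply, en_comm k (green k A v) h] at h1
  linarith

lemma det_lapOff_insert_eq {A : Finset V} {v : V} (hv : v ∉ A) (w : V → V → ℝ) :
    ((lapOff A w).updateRow v (Pi.single v 1)).det = (lapOff (insert v A) w).det := by
  let X : Matrix V V ℝ := 1 + Matrix.of fun x y => if x ∉ insert v A ∧ y = v then - w x y else 0
  have hX : X.det = 1 := by
    refine det_one_add_of_depth _ (fun u => if u = v then 0 else 1) fun x y hxy => ?_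
    by_cases h : x ∉ insert v A ∧ y = v
    · have : x ≠ v := by rintro rfl; exact h.1 (Finset.mem_insert_self _ _)
      simp [h, this]
    · exact absurd (if_neg h) hxy
  have hXL : (lapOff A w).updateRow v (Pi.single v 1) = X * lapOff (insert v A) w := by
    ext x y
    rw [show X = 1 + Matrix.of _ from rfl, Matrix.add_mul, Matrix.one_mul, Matrix.add_apply,
      Matrix.mul_apply]
    simp only [Matrix.of_apply]
    have key : ∀ F : V → ℝ, ∑ j, (if x ∉ insert v A ∧ j = v then - w x j else 0) * F j
        = if x ∉ insert v A then - w x v * F v else 0 := by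
      intro F
      by_cases hx : x ∉ insert v A
      · simp [hx]
      · rw [if_neg hx]
        refine Finset.sum_eq_zero fun j _ => ?_
        rw [if_neg fun h => hx h.1, zero_mul]
    rw [key]
    by_cases hxv : x = v
    · subst hxv
      simp [lapOff, Pi.single_apply, eq_comm]
    · rw [Matrix.updateRow_ne hxv]
      by_cases hx : x ∈ A
      · simp [lapOff, hx]
      · have hx' : x ∉ insert v A := by simp [hxv, hx]
        by_cases hyv : y = v
        · subst hyv
          simp [lapOff, hx, hxv, hv]
        · by_cases hy : y ∈ A
          · have : v ≠ y := fun h => hyv h.symm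
            simp [lapOff, hx, hy, hxv, hyv, this]
          · have : v ≠ y := fun h => hyv h.symm
            simp [lapOff, hx, hy, hxv, hyv, this]
  rw [hXL, Matrix.det_mul, hX, one_mul]

lemma IsNet.det_lapOff_insert (hk : IsNet k) {A : Finset V} (hA : A.Nonempty) {v : V}
    (hv : v ∉ A) : (lapOff (insert v A) k).det = (lapOff A k).det * green k A v v := by
  rw [← det_lapOff_insert_eq hv, ← Matrix.adjugate_apply, green, Matrix.inv_def,
    Matrix.smul_apply, smul_eq_mul, Ring.inverse_eq_inv', ← mul_assoc,
    mul_inv_cancel₀ (hk.det_lapOff_ne_zero hA), one_mul]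

end Green

/-! ### Effective resistances -/

section Resistance

variable {k : V → V → ℝ}

/-- Total conductance of a vertex. -/
def tot (k : V → V → ℝ) (x : V) : ℝ := ∑ u, k x u

/-- The potential of the unit flow from `x` to the ground `o`. -/
def pot (k : V → V → ℝ) (o x : V) : V → ℝ := if x = o then 0 else green k {o} x

lemma IsNet.en_pot (hk : IsNet k) (o x : V) (f : V → ℝ) : en k (pot k o x) f = f x - f o := by
  by_cases h : x = o
  · subst h
    simp [pot]
  · rw [pot, if_neg h, ← en_sub_const _ f (f o),
      hk.en_green (Finset.singleton_nonempty o) (by simpa using h)]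
    intro y hy
    rw [Finset.mem_singleton.1 hy, sub_self]

lemma IsNet.en_pot_sub (hk : IsNet k) (o x y : V) (f : V → ℝ) :
    en k (pot k o x - pot k o y) f = f x - f y := by
  rw [map_sub, LinearMap.sub_apply, hk.en_pot, hk.en_pot]
  ring

/-- The effective resistance. -/
def res (k : V → V → ℝ) (o x y : V) : ℝ :=
  en k (pot k o x - pot k o y) (pot k o x - pot k o y)

lemma IsNet.res_nonneg (hk : IsNet k) (o x y : V) : 0 ≤ res k o x y := hk.en_nonneg _

lemma res_self (o x : V) : res k o x x = 0 := by simp [res]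

lemma res_comm (o x y : V) : res k o x y = res k o y x := by
  rw [res, res, ← neg_sub (pot k o y) (pot k o x), map_neg, map_neg, LinearMap.neg_apply, neg_neg]

lemma IsNet.res_eq_green (hk : IsNet k) (o : V) {x y : V} (hxy : x ≠ y) :
    res k o x y = green k {y} x x := by
  have hx : x ∉ ({y} : Finset V) := by simpa using hxy
  have h0 : green k {y} x y = 0 := hk.green_eq_zero (Finset.mem_singleton_self y) hx
  have h1 := hk.en_pot_sub o x y (green k {y} x)
  have h2 : en k (green k {y} x) (pot k o x - pot k o y) =
      (pot k o x - pot k o y) x - (pot k o x - pot k o y) y := by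
    rw [← en_sub_const _ _ ((pot k o x - pot k o y) y),
      hk.en_green (Finset.singleton_nonempty y) hx]
    intro z hz
    rw [Finset.mem_singleton.1 hz, sub_self]
  rw [res, hk.en_pot_sub, ← h2, en_comm, h1, h0, sub_zero]

lemma IsNet.green_le_res (hk : IsNet k) (o : V) {A : Finset V} {v s : V} (hv : v ∉ A)
    (hs : s ∈ A) : green k A v v ≤ res k o v s := by
  refine hk.green_self_le ⟨s, hs⟩ hv fun f hf => ?_
  rw [hk.en_pot_sub, hf s hs, sub_zero]

lemma IsNet.res_mul_det (hk : IsNet k) (o : V) {x y : V} (hxy : x ≠ y) :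
    (lapOff {x, y} k).det = (lapOff {y} k).det * res k o x y := by
  rw [hk.res_eq_green o hxy, ← hk.det_lapOff_insert (Finset.singleton_nonempty y)]
  simpa using hxy

lemma partZ_pos {G : SimpleGraph V} [DecidableRel G.Adj] {c : Sym2 V → ℝ} (hG : G.Connected)
    (hc : ∀ e ∈ G.edgeSet, 0 < c e) : 0 < partZ G c := by
  obtain ⟨a⟩ := hG.nonempty
  refine lt_of_le_of_ne (Finset.sum_nonneg fun T hT => ?_) ?_
  · refine Finset.prod_nonneg fun e he => (hc e ?_).le
    simp only [spanningTrees, Finset.mem_filter] at hT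
    exact hT.2.1 he
  · rw [partZ_eq_det G c a]
    exact ((isNet_kern hG hc).det_lapOff_ne_zero (Finset.singleton_nonempty a)).symm

lemma sum_kern_res {G : SimpleGraph V} [DecidableRel G.Adj] {c : Sym2 V → ℝ} (hG : G.Connected)
    (hc : ∀ e ∈ G.edgeSet, 0 < c e) (o : V) :
    ∑ x, ∑ y, kern G c x y * res (kern G c) o x y = 2 * ((Fintype.card V : ℝ) - 1) := by
  have hk := isNet_kern hG hc
  have hZ := partZ_pos hG hc
  have h : ∀ x y, kern G c x y * (lapOff {x, y} (kern G c)).det =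
      kern G c x y * res (kern G c) o x y * partZ G c := by
    intro x y
    by_cases hxy : x = y
    · subst hxy
      simp [hk.diag]
    · rw [hk.res_mul_det o hxy, partZ_eq_det G c y]
      ring
  have := sum_kern_det G c
  simp only [h, ← Finset.sum_mul] at this
  exact mul_right_cancel₀ hZ.ne' this

lemma IsNet.en_single (hk : IsNet k) (x : V) (a : ℝ) (f : V → ℝ) :
    en k (Pi.single x a) f = a * ∑ y, k x y * (f x - f y) := by
  rw [hk.en_eq_sum, Finset.sum_eq_single x]
  · simp
  · intro y _ hy
    simp [hy]
  · simp

lemma IsNet.en_single_self (hk : IsNet k) (x : V) (a : ℝ) :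
    en k (Pi.single x a) (Pi.single x a) = a ^ 2 * tot k x := by
  rw [hk.en_single, tot, sq, mul_assoc, Finset.mul_sum univ (fun u => k x u) a]
  congr 1
  refine Finset.sum_congr rfl fun y _ => ?_
  by_cases h : y = x
  · subst h
    simp [hk.diag]
  · simp [h, mul_comm]

lemma IsNet.en_single_single (hk : IsNet k) {x y : V} (hxy : x ≠ y) (a b : ℝ) :
    en k (Pi.single x a) (Pi.single y b) = - (a * b * k x y) := by
  rw [hk.en_single, Finset.sum_eq_single y]
  · simp [hxy]
    ring
  · intro z _ hz
    simp [hz, hxy]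
  · simp

/-- The deviation of the potential of the unit flow from its ideal shape. -/
def dev (k : V → V → ℝ) (o x y : V) : V → ℝ :=
  (pot k o x - Pi.single x (tot k x)⁻¹) - (pot k o y - Pi.single y (tot k y)⁻¹)

/-- Energy of the deviation. -/
def devE (k : V → V → ℝ) (o x y : V) : ℝ := en k (dev k o x y) (dev k o x y)

lemma IsNet.devE_nonneg (hk : IsNet k) (o x y : V) : 0 ≤ devE k o x y := hk.en_nonneg _

lemma devE_self (o x : V) : devE k o x x = 0 := by simp [devE, dev]

lemma devE_comm (o x y : V) : devE k o x y = devE k o y x := by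
  have : dev k o y x = - dev k o x y := by rw [dev, dev, neg_sub]
  rw [devE, devE, this, map_neg, map_neg, LinearMap.neg_apply, neg_neg]

lemma IsNet.devE_triangle (hk : IsNet k) (o x y z : V) :
    devE k o x z ≤ 2 * devE k o x y + 2 * devE k o y z := by
  have h : dev k o x z = dev k o x y + dev k o y z := by
    rw [dev, dev, dev]
    abel
  have h1 := hk.en_nonneg (dev k o x y - dev k o y z)
  rw [devE, h]
  simp only [map_sub, map_add, LinearMap.sub_apply, LinearMap.add_apply] at h1 ⊢
  simp only [devE]
  linarith

lemma IsNet.devE_eq (hk : IsNet k) (o : V) {x y : V} (hxy : x ≠ y) (hx : tot k x ≠ 0)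
    (hy : tot k y ≠ 0) : devE k o x y = res k o x y - (tot k x)⁻¹ - (tot k y)⁻¹ +
      2 * (k x y * ((tot k x)⁻¹ * (tot k y)⁻¹)) := by
  have h : dev k o x y = (pot k o x - pot k o y) -
      (Pi.single x (tot k x)⁻¹ - Pi.single y (tot k y)⁻¹) := by
    rw [dev]
    abel
  set P := pot k o x - pot k o y with hP
  set S : V → ℝ := Pi.single x (tot k x)⁻¹ - Pi.single y (tot k y)⁻¹ with hS
  have h1 : en k P S = (tot k x)⁻¹ + (tot k y)⁻¹ := by
    rw [hP, hk.en_pot_sub, hS]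
    simp [hxy, hxy.symm]
  have h2 : en k S S = (tot k x)⁻¹ + (tot k y)⁻¹ +
      2 * (k x y * ((tot k x)⁻¹ * (tot k y)⁻¹)) := by
    rw [hS]
    simp only [map_sub, LinearMap.sub_apply]
    rw [hk.en_single_self, hk.en_single_self, hk.en_single_single hxy,
      hk.en_single_single hxy.symm, hk.symm y x]
    field_simp
    ring
  rw [devE, h]
  simp only [map_sub, LinearMap.sub_apply] at h2 h1 ⊢
  have h3 : en k S P = en k P S := en_comm k S P
  rw [res, ← hP]
  linarith

/-- Quantitative regularity at the scale where typical vertices have total conductance `1`. -/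
structure IsReg (k : V → V → ℝ) (η : ℝ) : Prop where
  edge : ∀ x y, k x y ≤ η
  typ : ((univ.filter fun x => ¬ |tot k x - 1| ≤ η).card : ℝ) ≤ η * Fintype.card V
  sum : ∑ x, tot k x ≤ (1 + η) * Fintype.card V

lemma IsNet.le_tot (hk : IsNet k) (x y : V) : k x y ≤ tot k x :=
  Finset.single_le_sum (f := fun y => k x y) (fun y _ => hk.nonneg x y) (Finset.mem_univ y)

lemma IsNet.tot_nonneg (hk : IsNet k) (x : V) : 0 ≤ tot k x :=
  Finset.sum_nonneg fun y _ => hk.nonneg x y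

lemma IsNet.tot_pos (hk : IsNet k) (hV : 2 ≤ Fintype.card V) (x : V) : 0 < tot k x := by
  refine lt_of_le_of_ne (hk.tot_nonneg x) fun h => ?_
  have h0 : ∀ y, k x y = 0 := fun y =>
    le_antisymm ((hk.le_tot x y).trans h.symm.le) (hk.nonneg x y)
  obtain ⟨y, hy⟩ := Fintype.exists_ne_of_one_lt_card hV x
  have := hk.irr (Pi.single x 1) (fun u v huv => ?_) x y
  · simp [hy] at this
  · have hu : u ≠ x := by rintro rfl; exact huv (h0 v)
    have hv : v ≠ x := by rintro rfl; exact huv (by rw [hk.symm, h0])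
    simp [hu, hv]

lemma IsNet.sum_sq_le (hk : IsNet k) (hV : 2 ≤ Fintype.card V) {η : ℝ} (hη : η ≤ 1 / 2)
    (hr : IsReg k η) :
    ∑ x, ∑ y, k x y * (k x y * ((tot k x)⁻¹ * (tot k y)⁻¹)) ≤ 3 * η * Fintype.card V := by
  have hp := hk.tot_pos hV
  have hrow : ∀ x, ∑ y, k x y * (tot k x)⁻¹ = 1 := fun x => by
    rw [← Finset.sum_mul]
    exact mul_inv_cancel₀ (hp x).ne'
  have h : ∀ x y, k x y * (k x y * ((tot k x)⁻¹ * (tot k y)⁻¹)) ≤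
      2 * η * (k x y * (tot k x)⁻¹) +
        if |tot k y - 1| ≤ η then 0 else k y x * (tot k y)⁻¹ := by
    intro x y
    have hkx := hk.nonneg x y
    have hη0 : 0 ≤ η := hkx.trans (hr.edge x y)
    have hix := inv_pos.2 (hp x)
    have hiy := inv_pos.2 (hp y)
    split_ifs with hy
    · have h1 : (tot k y)⁻¹ ≤ 2 := by
        rw [inv_le_comm₀ (hp y) (by norm_num)]
        linarith [(abs_le.1 hy).1]
      have h2 : k x y * (tot k y)⁻¹ ≤ η * 2 :=
        mul_le_mul (hr.edge x y) h1 hiy.le hη0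
      calc _ = k x y * (tot k x)⁻¹ * (k x y * (tot k y)⁻¹) := by ring
        _ ≤ k x y * (tot k x)⁻¹ * (η * 2) := by gcongr
        _ = _ := by ring
    · have h1 : k x y * (tot k x)⁻¹ ≤ 1 := by
        rw [← div_eq_mul_inv]
        exact div_le_one_of_le₀ (hk.le_tot x y) (hp x).le
      have h2 : 0 ≤ k x y * (tot k y)⁻¹ := by positivity
      calc _ = k x y * (tot k x)⁻¹ * (k x y * (tot k y)⁻¹) := by ring
        _ ≤ 1 * (k x y * (tot k y)⁻¹) := by gcongr
        _ ≤ _ := by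
          rw [hk.symm y x]
          have : 0 ≤ 2 * η * (k x y * (tot k x)⁻¹) := by positivity
          linarith
  refine (Finset.sum_le_sum fun x _ => Finset.sum_le_sum fun y _ => h x y).trans ?_
  simp only [Finset.sum_add_distrib, ← Finset.mul_sum, hrow]
  rw [Finset.sum_comm (f := fun x y => if |tot k y - 1| ≤ η then 0 else k y x * (tot k y)⁻¹)]
  have h2 : ∀ y, ∑ x, (if |tot k y - 1| ≤ η then 0 else k y x * (tot k y)⁻¹) =
      if ¬ |tot k y - 1| ≤ η then 1 else 0 := by
    intro y
    by_cases hy : |tot k y - 1| ≤ η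
    · simp [hy]
    · simp only [hy, if_false, not_false_eq_true, if_true, hrow]
  simp only [h2, Finset.sum_boole]
  have := hr.typ
  simp only [Finset.sum_const, Finset.card_univ, nsmul_eq_mul, mul_one]
  linarith

lemma sum_kern_devE {G : SimpleGraph V} [DecidableRel G.Adj] {c : Sym2 V → ℝ} (hG : G.Connected)
    (hc : ∀ e ∈ G.edgeSet, 0 < c e) (hV : 2 ≤ Fintype.card V) {η : ℝ} (hη : η ≤ 1 / 2)
    (hr : IsReg (kern G c) η) (o : V) :
    ∑ x, ∑ y, kern G c x y * devE (kern G c) o x y ≤ 6 * η * Fintype.card V := by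
  have hk := isNet_kern hG hc
  set k := kern G c with hkdef
  have hp := hk.tot_pos hV
  have hrow : ∀ x, ∑ y, k x y * (tot k x)⁻¹ = 1 := fun x => by
    rw [← Finset.sum_mul]
    exact mul_inv_cancel₀ (hp x).ne'
  have h : ∀ x y, k x y * devE k o x y = k x y * res k o x y - k x y * (tot k x)⁻¹ -
      k y x * (tot k y)⁻¹ + 2 * (k x y * (k x y * ((tot k x)⁻¹ * (tot k y)⁻¹))) := by
    intro x y
    by_cases hxy : x = y
    · subst hxy
      simp [hk.diag]
    · rw [hk.devE_eq o hxy (hp x).ne' (hp y).ne', hk.symm y x]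
      ring
  simp only [h, Finset.sum_add_distrib, Finset.sum_sub_distrib, hrow, ← Finset.mul_sum]
  rw [Finset.sum_comm (f := fun x y => k y x * (tot k y)⁻¹)]
  simp only [hrow]
  have h1 := sum_kern_res hG hc o
  have h2 := hk.sum_sq_le hV hη hr
  rw [← hkdef] at h1
  simp only [Finset.sum_const, Finset.card_univ, nsmul_eq_mul, mul_one]
  linarith

end Resistance

/-! ### Good edges and good vertices -/

section Good

variable {k : V → V → ℝ} {o : V} {θ : ℝ}

/-- Both endpoints are typical and the flow through the pair has almost ideal shape. -/
def GoodE (k : V → V → ℝ) (o : V) (θ : ℝ) (x y : V) : Prop :=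
  |tot k x - 1| ≤ θ ∧ |tot k y - 1| ≤ θ ∧ devE k o x y ≤ θ

instance (k : V → V → ℝ) (o : V) (θ : ℝ) (x y : V) : Decidable (GoodE k o θ x y) :=
  Classical.dec _

lemma GoodE.symm {x y : V} (h : GoodE k o θ x y) : GoodE k o θ y x :=
  ⟨h.2.1, h.1, by rw [devE_comm]; exact h.2.2⟩

/-- A typical vertex with few bad pairs around it. -/
def GoodV (k : V → V → ℝ) (o : V) (θ : ℝ) (s : V) : Prop :=
  |tot k s - 1| ≤ θ ∧ ∑ v, (if GoodE k o θ s v then 0 else k s v * res k o s v) ≤ θ ∧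
    ∑ v, (if GoodE k o θ s v then 0 else k s v) ≤ θ

instance (k : V → V → ℝ) (o : V) (θ : ℝ) (x : V) : Decidable (GoodV k o θ x) :=
  Classical.dec _

/-- The network has few bad pairs and few bad vertices. -/
structure IsGoodNet (k : V → V → ℝ) (o : V) (θ : ℝ) : Prop extends IsNet k where
  pos : ∀ x, 0 < tot k x
  edge : ∀ x y, k x y ≤ θ
  sum_le : ∑ x, (if |tot k x - 1| ≤ θ then 0 else tot k x) ≤ θ * Fintype.card V
  sum_ge : (1 - θ) * Fintype.card V ≤ ∑ x, tot k x
  bad_cond : ∑ x, ∑ y, (if GoodE k o θ x y then 0 else k x y) ≤ θ * Fintype.card V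
  bad_res : ∑ x, ∑ y, (if GoodE k o θ x y then 0 else k x y * res k o x y) ≤ θ * Fintype.card V
  bad_card : ((univ.filter fun x => ¬ GoodV k o θ x).card : ℝ) ≤ θ * Fintype.card V

lemma IsReg.sum_atypical_le {η : ℝ} (hη0 : 0 ≤ η) (hη : η ≤ 1 / 2) (hr : IsReg k η) :
    ∑ x, (if |tot k x - 1| ≤ η then 0 else tot k x) ≤ 3 * η * Fintype.card V := by
  have h : ∀ x, (if |tot k x - 1| ≤ η then 0 else tot k x) ≤
      tot k x - (1 - η) + (1 - η) * if ¬ |tot k x - 1| ≤ η then 1 else 0 := by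
    intro x
    by_cases hx : |tot k x - 1| ≤ η
    · simp only [hx, if_true, not_true_eq_false, if_false]
      linarith [(abs_le.1 hx).1]
    · simp [hx]
  refine (Finset.sum_le_sum fun x _ => h x).trans ?_
  simp only [Finset.sum_add_distrib, Finset.sum_sub_distrib, ← Finset.mul_sum, Finset.sum_boole,
    Finset.sum_const, Finset.card_univ, nsmul_eq_mul]
  have h1 := hr.typ
  have h2 := hr.sum
  have h3 : (0 : ℝ) ≤ Fintype.card V := Nat.cast_nonneg _
  nlinarith [mul_le_mul_of_nonneg_left h1 (by linarith : (0 : ℝ) ≤ 1 - η),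
    mul_nonneg hη0 h3, mul_nonneg (mul_nonneg hη0 hη0) h3]

lemma sum_bad_cond_le {G : SimpleGraph V} [DecidableRel G.Adj] {c : Sym2 V → ℝ}
    (hG : G.Connected) (hc : ∀ e ∈ G.edgeSet, 0 < c e) (hV : 2 ≤ Fintype.card V) {η : ℝ}
    (hη0 : 0 ≤ η) (hη : η ≤ 1 / 2) (hr : IsReg (kern G c) η) (o : V) (hθ : 0 < θ)
    (hηθ : η ≤ θ) :
    ∑ x, ∑ y, (if GoodE (kern G c) o θ x y then 0 else kern G c x y) ≤
      (6 * η + 6 * η / θ) * Fintype.card V := by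
  have hk := isNet_kern hG hc
  have hE := sum_kern_devE hG hc hV hη hr o
  set k := kern G c with hkdef
  have h : ∀ x y, (if GoodE k o θ x y then 0 else k x y) ≤
      (if |tot k x - 1| ≤ η then 0 else k x y) + (if |tot k y - 1| ≤ η then 0 else k y x) +
        k x y * devE k o x y / θ := by
    intro x y
    have h0 := hk.nonneg x y
    have h0' := hk.nonneg y x
    have h1 : 0 ≤ k x y * devE k o x y / θ := by
      have := hk.devE_nonneg o x y
      positivity
    by_cases hg : GoodE k o θ x y
    · rw [if_pos hg]
      split_ifs <;> positivity
    · rw [if_neg hg]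
      by_cases hx : |tot k x - 1| ≤ η
      · by_cases hy : |tot k y - 1| ≤ η
        · have h2 : θ ≤ devE k o x y := by
            by_contra hlt
            exact hg ⟨hx.trans hηθ, hy.trans hηθ, (not_le.1 hlt).le⟩
          have h3 : k x y ≤ k x y * devE k o x y / θ := by
            rw [le_div_iff₀ hθ]
            gcongr
          rw [if_pos hx, if_pos hy]
          linarith
        · rw [if_pos hx, if_neg hy, hk.symm y x]
          linarith
      · rw [if_neg hx]
        split_ifs <;> linarith
  refine (Finset.sum_le_sum fun x _ => Finset.sum_le_sum fun y _ => h x y).trans ?_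
  simp only [Finset.sum_add_distrib, ← Finset.sum_div]
  rw [Finset.sum_comm (f := fun x y => if |tot k y - 1| ≤ η then 0 else k y x)]
  have h2 : ∀ x, ∑ y, (if |tot k x - 1| ≤ η then 0 else k x y) =
      if |tot k x - 1| ≤ η then 0 else tot k x := by
    intro x
    split_ifs
    · simp
    · rfl
  simp only [h2]
  have h3 := IsReg.sum_atypical_le hη0 hη hr
  have h4 : (∑ x, ∑ y, k x y * devE k o x y) / θ ≤ 6 * η / θ * Fintype.card V := by
    rw [div_mul_eq_mul_div]
    gcongr
  linarith

lemma sum_bad_res_le {G : SimpleGraph V} [DecidableRel G.Adj] {c : Sym2 V → ℝ}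
    (hG : G.Connected) (hc : ∀ e ∈ G.edgeSet, 0 < c e) (hV : 2 ≤ Fintype.card V) {η : ℝ}
    (hη0 : 0 ≤ η) (hη : η ≤ 1 / 2) (hr : IsReg (kern G c) η) (o : V) (hθ : 0 < θ)
    (hηθ : η ≤ θ) :
    ∑ x, ∑ y, (if GoodE (kern G c) o θ x y then 0 else kern G c x y * res (kern G c) o x y) ≤
      (32 * η + 24 * η / θ) * Fintype.card V := by
  have hk := isNet_kern hG hc
  have hE := sum_kern_devE hG hc hV hη hr o
  have hB := sum_bad_cond_le hG hc hV hη0 hη hr o hθ hηθ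
  set k := kern G c with hkdef
  have hp := hk.tot_pos hV
  have hrow : ∀ x, ∑ y, k x y * (tot k x)⁻¹ = 1 := fun x => by
    rw [← Finset.sum_mul]
    exact mul_inv_cancel₀ (hp x).ne'
  let J : V → V → ℝ := fun x y => 2 * (if GoodE k o θ x y then 0 else k x y) +
    if |tot k x - 1| ≤ η then 0 else k x y * (tot k x)⁻¹
  have hJ0 : ∀ x y, 0 ≤ J x y := by
    intro x y
    have h0 := hk.nonneg x y
    have := (inv_pos.2 (hp x)).le
    simp only [J]
    split_ifs <;> positivity
  have hJ : ∀ x y, ¬ GoodE k o θ x y → k x y * (tot k x)⁻¹ ≤ J x y := by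
    intro x y hg
    have h0 := hk.nonneg x y
    simp only [J, if_neg hg]
    split_ifs with hx
    · have h1 : (tot k x)⁻¹ ≤ 2 := by
        rw [inv_le_comm₀ (hp x) (by norm_num)]
        linarith [(abs_le.1 hx).1]
      nlinarith
    · linarith
  have h : ∀ x y, (if GoodE k o θ x y then 0 else k x y * res k o x y) ≤
      k x y * devE k o x y + J x y + J y x := by
    intro x y
    have h0 := hk.nonneg x y
    have h1 : 0 ≤ k x y * devE k o x y := mul_nonneg h0 (hk.devE_nonneg o x y)
    by_cases hg : GoodE k o θ x y
    · rw [if_pos hg]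
      linarith [hJ0 x y, hJ0 y x]
    · rw [if_neg hg]
      by_cases hxy : x = y
      · subst hxy
        rw [res_self, mul_zero]
        linarith [hJ0 x x]
      · have h2 := hJ x y hg
        have h3 := hJ y x fun h => hg h.symm
        have h4 := hk.devE_eq o hxy (hp x).ne' (hp y).ne'
        have h5 : 0 ≤ k x y * (k x y * ((tot k x)⁻¹ * (tot k y)⁻¹)) := by
          have := (inv_pos.2 (hp x)).le
          have := (inv_pos.2 (hp y)).le
          positivity
        rw [h4]
        rw [hk.symm y x] at h3
        linarith
  have hJsum : ∑ x, ∑ y, J x y ≤ (13 * η + 12 * η / θ) * Fintype.card V := by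
    have h2 : ∀ y, ∑ x, (if |tot k y - 1| ≤ η then 0 else k y x * (tot k y)⁻¹) =
        if ¬ |tot k y - 1| ≤ η then 1 else 0 := by
      intro y
      by_cases hy : |tot k y - 1| ≤ η
      · simp [hy]
      · simp only [hy, if_false, not_false_eq_true, if_true, hrow]
    simp only [J, Finset.sum_add_distrib, ← Finset.mul_sum, h2, Finset.sum_boole]
    have := hr.typ
    rw [mul_div_assoc] at hB ⊢
    linarith
  refine (Finset.sum_le_sum fun x _ => Finset.sum_le_sum fun y _ => h x y).trans ?_
  simp only [Finset.sum_add_distrib]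
  rw [Finset.sum_comm (f := fun x y => J y x)]
  rw [mul_div_assoc] at hJsum ⊢
  linarith

lemma card_filter_lt_le {f : V → ℝ} (hf : ∀ x, 0 ≤ f x) (hθ : 0 < θ) {b : ℝ}
    (hb : ∑ x, f x ≤ θ * b) : ((univ.filter fun x => θ < f x).card : ℝ) ≤ b := by
  have h : θ * ((univ.filter fun x => θ < f x).card : ℝ) ≤ ∑ x, f x := by
    rw [mul_comm, ← nsmul_eq_mul]
    refine (Finset.card_nsmul_le_sum _ f θ fun x hx => (Finset.mem_filter.1 hx).2.le).trans ?_
    exact Finset.sum_le_sum_of_subset_of_nonneg (Finset.filter_subset _ _) fun x _ _ => hf x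
  exact le_of_mul_le_mul_left (h.trans hb) hθ

/-- A sufficiently regular network is good. -/
lemma isGoodNet {G : SimpleGraph V} [DecidableRel G.Adj] {c : Sym2 V → ℝ}
    (hG : G.Connected) (hc : ∀ e ∈ G.edgeSet, 0 < c e) (hV : 2 ≤ Fintype.card V) {η : ℝ}
    (hη0 : 0 ≤ η) (hr : IsReg (kern G c) η)
    (hsum : (1 - η) * Fintype.card V ≤ ∑ x, tot (kern G c) x) (o : V)
    (hθ : 0 < θ) (hθ1 : θ ≤ 1 / 2) (hηθ : 100 * η ≤ θ ^ 3) : IsGoodNet (kern G c) o θ := by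
  have hk := isNet_kern hG hc
  have hθ2 : θ ^ 2 ≤ θ := by nlinarith
  have hθ3 : θ ^ 3 ≤ θ ^ 2 := by nlinarith [sq_nonneg θ]
  have hη1 : η ≤ 1 / 2 := by linarith
  have hηle : η ≤ θ := by linarith
  have hηd : 100 * (η / θ) ≤ θ ^ 2 := by
    rw [← mul_div_assoc, div_le_iff₀ hθ]
    calc _ ≤ θ ^ 3 := hηθ
      _ = _ := by ring
  have hn : (0 : ℝ) ≤ Fintype.card V := Nat.cast_nonneg _
  have hd0 : 0 ≤ η / θ := by positivity
  have hB1 : ∑ x, ∑ y, (if GoodE (kern G c) o θ x y then 0 else kern G c x y) ≤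
      θ * (θ / 4 * Fintype.card V) := by
    refine (sum_bad_cond_le hG hc hV hη0 hη1 hr o hθ hηle).trans ?_
    rw [← mul_assoc]
    gcongr
    rw [mul_div_assoc]
    linarith
  have hB2 : ∑ x, ∑ y,
      (if GoodE (kern G c) o θ x y then 0 else kern G c x y * res (kern G c) o x y) ≤
      θ * (θ * (3 / 5) * Fintype.card V) := by
    refine (sum_bad_res_le hG hc hV hη0 hη1 hr o hθ hηle).trans ?_
    rw [← mul_assoc]
    gcongr
    rw [mul_div_assoc]
    linarith
  refine ⟨hk, hk.tot_pos hV, fun x y => (hr.edge x y).trans hηle, ?_, ?_, ?_, ?_, ?_⟩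
  · refine le_trans (Finset.sum_le_sum fun x _ => ?_) ((IsReg.sum_atypical_le hη0 hη1 hr).trans ?_)
    · have := hk.tot_nonneg x
      split_ifs with h1 h2 h2
      · exact le_rfl
      · exact this
      · exact absurd (h2.trans hηle) h1
      · exact le_rfl
    · gcongr
      linarith
  · refine le_trans ?_ hsum
    gcongr
  · refine hB1.trans ?_
    rw [← mul_assoc]
    gcongr
    nlinarith
  · refine hB2.trans ?_
    rw [← mul_assoc]
    gcongr
    nlinarith
  · have h1 := card_filter_lt_le (fun x => Finset.sum_nonneg fun y _ => ?_) hθ hB1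
    have h2 := card_filter_lt_le (fun x => Finset.sum_nonneg fun y _ => ?_) hθ hB2
    rotate_left
    · split_ifs
      · exact le_rfl
      · exact mul_nonneg (hk.nonneg x y) (hk.res_nonneg o x y)
    · split_ifs
      · exact le_rfl
      · exact hk.nonneg x y
    have h3 : (univ.filter fun x => ¬ GoodV (kern G c) o θ x) ⊆
        (univ.filter fun x => ¬ |tot (kern G c) x - 1| ≤ η) ∪
        ((univ.filter fun x => θ < ∑ y, if GoodE (kern G c) o θ x y then 0 else kern G c x y) ∪
        (univ.filter fun x => θ < ∑ y,
          if GoodE (kern G c) o θ x y then 0 else kern G c x y * res (kern G c) o x y)) := by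
      intro x hx
      simp only [Finset.mem_filter, Finset.mem_univ, true_and, Finset.mem_union] at hx ⊢
      by_contra hcon
      push Not at hcon
      exact hx ⟨hcon.1.trans hηle, hcon.2.2, hcon.2.1⟩
    have h4 := (Finset.card_le_card h3).trans (Finset.card_union_le _ _)
    have h5 := h4.trans (Nat.add_le_add_left (Finset.card_union_le _ _) _)
    have h6 := hr.typ
    have h7 : ((univ.filter fun x => ¬ GoodV (kern G c) o θ x).card : ℝ) ≤
        ((univ.filter fun x => ¬ |tot (kern G c) x - 1| ≤ η).card : ℝ) +
        (((univ.filter fun x => θ <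
            ∑ y, if GoodE (kern G c) o θ x y then 0 else kern G c x y).card : ℝ) +
        ((univ.filter fun x => θ < ∑ y, if GoodE (kern G c) o θ x y then 0 else
            kern G c x y * res (kern G c) o x y).card : ℝ)) := by exact_mod_cast h5
    have h8 : η * Fintype.card V ≤ θ / 100 * Fintype.card V := by
      gcongr
      linarith
    have h9 : 0 ≤ θ * Fintype.card V := by positivity
    linarith

end Good

/-! ### Green functions killed on a cluster of typical vertices -/

section Cluster

variable {k : V → V → ℝ} {o : V} {κ : ℝ}

/-- The vertices of `B` are typical and have pairwise effective resistance close to `2`. -/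
structure IsCluster (k : V → V → ℝ) (o : V) (κ : ℝ) (B : Finset V) : Prop where
  typ : ∀ x ∈ B, |tot k x - 1| ≤ κ
  res : ∀ x ∈ B, ∀ y ∈ B, x ≠ y → |res k o x y - 2| ≤ κ
  edge : ∀ x y, k x y ≤ κ

lemma IsCluster.mono {B B' : Finset V} (h : IsCluster k o κ B) (hB : B' ⊆ B) :
    IsCluster k o κ B' :=
  ⟨fun x hx => h.typ x (hB hx), fun x hx y hy => h.res x (hB hx) y (hB hy), h.edge⟩

lemma en_pot_pot (o v a b : V) :
    en k (pot k o v - pot k o a) (pot k o v - pot k o b) =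
      (res k o v a + res k o v b - res k o a b) / 2 := by
  have h : res k o a b = res k o v a + res k o v b -
      2 * en k (pot k o v - pot k o a) (pot k o v - pot k o b) := by
    have h1 : pot k o a - pot k o b =
        (pot k o v - pot k o b) - (pot k o v - pot k o a) := by abel
    have h2 := en_comm k (pot k o v - pot k o a) (pot k o v - pot k o b)
    simp only [WSTPaper.res]
    rw [h1]
    generalize pot k o v - pot k o b = P at *
    generalize pot k o v - pot k o a = Q at *
    simp only [map_sub, LinearMap.sub_apply]
    linarith
  linarith

lemma IsNet.green_self_le_of_cluster (hk : IsNet k) {A : Finset V} (hA : A.Nonempty) {v : V}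
    (hv : v ∉ A) (hκ : 0 ≤ κ) (hc : IsCluster k o κ (insert v A)) :
    green k A v v ≤ 1 + (A.card : ℝ)⁻¹ + 2 * κ := by
  have hN : (0 : ℝ) < A.card := by exact_mod_cast hA.card_pos
  have h := hk.green_self_le hA hv
    (h := (A.card : ℝ)⁻¹ • ∑ a ∈ A, (pot k o v - pot k o a)) fun f hf => ?_
  · refine h.trans ?_
    simp only [map_smul, LinearMap.smul_apply, map_sum, LinearMap.sum_apply, smul_eq_mul,
      en_pot_pot]
    have hb : ∀ a ∈ A, ∀ b ∈ A, (res k o v a + res k o v b - res k o a b) / 2 ≤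
        (1 + 2 * κ) + if a = b then 1 else 0 := by
      intro a ha b hb
      have hva := abs_le.1 (hc.res v (Finset.mem_insert_self _ _) a (Finset.mem_insert_of_mem ha)
        (by rintro rfl; exact hv ha))
      have hvb := abs_le.1 (hc.res v (Finset.mem_insert_self _ _) b (Finset.mem_insert_of_mem hb)
        (by rintro rfl; exact hv hb))
      by_cases hab : a = b
      · subst hab
        rw [if_pos rfl, res_self]
        linarith
      · have hab' := abs_le.1 (hc.res a (Finset.mem_insert_of_mem ha) b
          (Finset.mem_insert_of_mem hb) hab)
        rw [if_neg hab]
        linarith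
    have hs : ∑ x ∈ A, ∑ y ∈ A, (res k o v y + res k o v x - res k o y x) / 2 ≤
        A.card * (A.card * (1 + 2 * κ) + 1) := by
      refine (Finset.sum_le_sum fun x hx => Finset.sum_le_sum fun y hy => hb y hy x hx).trans ?_
      simp only [Finset.sum_add_distrib, Finset.sum_const, nsmul_eq_mul, Finset.sum_ite_eq']
      rw [Finset.sum_ite_mem, Finset.inter_self]
      simp
      linarith
    calc _ ≤ (A.card : ℝ)⁻¹ * ((A.card : ℝ)⁻¹ * (A.card * (A.card * (1 + 2 * κ) + 1))) := by
          rw [← Finset.mul_sum]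
          gcongr
      _ = _ := by
          field_simp
          ring
  · simp only [map_smul, LinearMap.smul_apply, map_sum, LinearMap.sum_apply, smul_eq_mul,
      hk.en_pot_sub]
    rw [Finset.sum_congr rfl fun a ha => by rw [hf a ha, sub_zero], Finset.sum_const,
      nsmul_eq_mul, inv_mul_cancel_left₀ hN.ne']

/-- The ideal shape of the Green function. -/
def idealGreen (A : Finset V) (v u : V) : ℝ :=
  (if u = v then 1 else 0) + if u ∈ A then 0 else (A.card : ℝ)⁻¹

lemma IsNet.en_idealGreen_le (hk : IsNet k) {A : Finset V} (hA : A.Nonempty) {v : V}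
    (hv : v ∉ A) (hκ : 0 ≤ κ) (hc : IsCluster k o κ (insert v A)) :
    en k (idealGreen A v) (idealGreen A v) ≤ 1 + (A.card : ℝ)⁻¹ + 4 * κ := by
  have hN : (1 : ℝ) ≤ A.card := by exact_mod_cast hA.card_pos
  set q := (A.card : ℝ)⁻¹ with hq
  have hq1 : q ≤ 1 := inv_le_one_of_one_le₀ hN
  have hq0 : 0 ≤ q := by positivity
  have hqN : q * A.card = 1 := inv_mul_cancel₀ (by linarith)
  have h1 : (fun u => idealGreen A v u - q) =
      Pi.single v 1 - q • ∑ a ∈ A, Pi.single a (1 : ℝ) := by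
    ext u
    simp only [idealGreen, Pi.sub_apply, Pi.smul_apply, Finset.sum_apply, Pi.single_apply,
      Finset.sum_ite_eq, smul_eq_mul]
    split_ifs <;> ring
  have h2 : en k (idealGreen A v) (idealGreen A v) =
      en k (fun u => idealGreen A v u - q) (fun u => idealGreen A v u - q) := by
    rw [en_sub_const, en_comm k (fun u => idealGreen A v u - q), en_sub_const]
  rw [h2, h1]
  simp only [map_sub, LinearMap.sub_apply, map_smul, LinearMap.smul_apply, map_sum,
    LinearMap.sum_apply, smul_eq_mul]
  have h3 : ∀ a ∈ A, en k (Pi.single v 1) (Pi.single a (1 : ℝ)) = - k v a := fun a ha => by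
    rw [hk.en_single_single (by rintro rfl; exact hv ha)]
    ring
  have h4 : ∀ a ∈ A, en k (Pi.single a 1) (Pi.single v (1 : ℝ)) = - k v a := fun a ha => by
    rw [en_comm, h3 a ha]
  have h5 : ∀ a b, en k (Pi.single b 1) (Pi.single a (1 : ℝ)) ≤ if a = b then tot k a else 0 := by
    intro a b
    by_cases hab : a = b
    · subst hab
      rw [if_pos rfl, hk.en_single_self]
      simp
    · rw [if_neg hab, hk.en_single_single (Ne.symm hab)]
      linarith [hk.nonneg b a]
  rw [Finset.sum_sub_distrib, ← Finset.mul_sum, Finset.sum_congr rfl h3, Finset.sum_congr rfl h4,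
    hk.en_single_self]
  have h6 : ∑ b ∈ A, ∑ a ∈ A, en k (Pi.single a 1) (Pi.single b (1 : ℝ)) ≤ A.card * (1 + κ) := by
    refine (Finset.sum_le_sum fun x hx => Finset.sum_le_sum fun y hy => h5 x y).trans ?_
    simp only [Finset.sum_ite_eq]
    rw [Finset.sum_ite_mem, Finset.inter_self, ← nsmul_eq_mul]
    refine Finset.sum_le_card_nsmul _ _ _ fun x hx => ?_
    linarith [(abs_le.1 (hc.typ x (Finset.mem_insert_of_mem hx))).2]
  have h7 : ∑ a ∈ A, k v a ≤ A.card * κ := by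
    rw [← nsmul_eq_mul]
    exact Finset.sum_le_card_nsmul _ _ _ fun x hx => hc.edge v x
  have h8 := (abs_le.1 (hc.typ v (Finset.mem_insert_self _ _))).2
  have h9 : q * ∑ a ∈ A, k v a ≤ κ := by
    calc _ ≤ q * (A.card * κ) := by gcongr
      _ = κ := by rw [← mul_assoc, hqN, one_mul]
  have h10 : q * (q * ∑ b ∈ A, ∑ a ∈ A, en k (Pi.single a 1) (Pi.single b (1 : ℝ))) ≤
      q * (1 + κ) := by
    refine mul_le_mul_of_nonneg_left ?_ hq0
    calc _ ≤ q * (A.card * (1 + κ)) := by gcongr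
      _ = _ := by rw [← mul_assoc, hqN, one_mul]
  have h11 : q * κ ≤ κ := by nlinarith
  rw [Finset.sum_neg_distrib]
  linarith

/-- Comparison of the Green function with its ideal shape. -/
lemma IsNet.green_sub_ideal_sq_le (hk : IsNet k) {A : Finset V} (hA : A.Nonempty) {u v : V}
    (hv : v ∉ A) (hu : u ∉ A) (hκ : 0 ≤ κ) (hκ1 : κ ≤ 1 / 2)
    (hc : IsCluster k o κ (insert v A)) (hc' : IsCluster k o κ (insert u A)) :
    (green k A v u - ((if u = v then 1 else 0) + (A.card : ℝ)⁻¹)) ^ 2 ≤ 18 * κ := by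
  have hN : (1 : ℝ) ≤ A.card := by exact_mod_cast hA.card_pos
  have hq1 : (A.card : ℝ)⁻¹ ≤ 1 := inv_le_one_of_one_le₀ hN
  have hI : ∀ y ∈ A, idealGreen A v y = 0 := fun y hy => by
    have : y ≠ v := by rintro rfl; exact hv hy
    simp [idealGreen, hy, this]
  have hG : ∀ y ∈ A, green k A v y = 0 := fun y hy => hk.green_eq_zero hy hv
  have hE : en k (green k A v - idealGreen A v) (green k A v - idealGreen A v) ≤ 6 * κ := by
    have h1 := hk.en_green_green hA hv hv
    have h2 := hk.en_green hA hv hI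
    have h3 := en_comm k (green k A v) (idealGreen A v)
    have h4 := hk.en_idealGreen_le hA hv hκ hc
    have h5 := hk.green_self_le_of_cluster hA hv hκ hc
    have h6 : idealGreen A v v = 1 + (A.card : ℝ)⁻¹ := by simp [idealGreen, hv]
    simp only [map_sub, LinearMap.sub_apply]
    linarith
  have h7 := hk.en_sq_le (green k A u) (green k A v - idealGreen A v)
  rw [hk.en_green hA hu (fun y hy => by rw [Pi.sub_apply, hG y hy, hI y hy, sub_zero]),
    hk.en_green_green hA hu hu, Pi.sub_apply, idealGreen, if_neg hu] at h7
  have h8 := hk.green_self_le_of_cluster hA hu hκ hc'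
  calc _ ≤ _ := h7
    _ ≤ 3 * (6 * κ) := by
      refine mul_le_mul (by linarith) hE (hk.en_nonneg _) (by norm_num)
    _ = _ := by ring

/-- Determinant of the Laplacian killed on a cluster. -/
lemma IsNet.abs_det_cluster_le (hk : IsNet k) {ε Z : ℝ} (hZ : ∀ a, (lapOff {a} k).det = Z)
    (hZ0 : 0 < Z) (hκ : 0 ≤ κ) (hκ1 : κ ≤ 1 / 2) (hε : 0 ≤ ε) (hκε : 18 * κ ≤ ε ^ 2)
    (hε1 : ε ≤ 1) {A : Finset V} (hA : A.Nonempty) (hc : IsCluster k o κ A) :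
    A.card * (1 - ε) ^ (A.card - 1) ≤ (lapOff A k).det / Z ∧
      (lapOff A k).det / Z ≤ A.card * (1 + ε) ^ (A.card - 1) := by
  induction hA using Finset.Nonempty.cons_induction with
  | singleton a => simp [hZ, hZ0.ne']
  | cons v A hv hA ih =>
    rw [Finset.cons_eq_insert] at hc ⊢
    obtain ⟨ih1, ih2⟩ := ih (hc.mono (Finset.subset_insert _ _))
    have hN : (1 : ℝ) ≤ A.card := by exact_mod_cast hA.card_pos
    have h1 := abs_le_of_sq_le_sq ((hk.green_sub_ideal_sq_le hA hv hv hκ hκ1 hc hc).trans hκε) hε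
    rw [if_pos rfl] at h1
    set q := (A.card : ℝ)⁻¹ with hq
    have hq0 : 0 ≤ q := by positivity
    have hqN : q * A.card = 1 := inv_mul_cancel₀ (by linarith)
    have hg1 : (1 + q) * (1 - ε) ≤ green k A v v := by nlinarith [(abs_le.1 h1).1]
    have hg2 : green k A v v ≤ (1 + q) * (1 + ε) := by nlinarith [(abs_le.1 h1).2]
    rw [hk.det_lapOff_insert hA hv, Finset.card_insert_of_notMem hv, mul_div_right_comm]
    have hcard : A.card + 1 - 1 = (A.card - 1) + 1 := by
      have := hA.card_pos
      omega
    have hd : 0 ≤ (lapOff A k).det / Z :=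
      le_trans (mul_nonneg (by linarith) (pow_nonneg (by linarith) _)) ih1
    rw [hcard, pow_succ, pow_succ]
    push_cast
    constructor
    · calc ((A.card : ℝ) + 1) * ((1 - ε) ^ (A.card - 1) * (1 - ε))
          = A.card * (1 - ε) ^ (A.card - 1) * ((1 + q) * (1 - ε)) := by
            linear_combination (-(1 - ε) ^ (A.card - 1) * (1 - ε)) * hqN
        _ ≤ _ := mul_le_mul ih1 hg1 (mul_nonneg (by linarith) (by linarith)) hd
    · calc _ ≤ A.card * (1 + ε) ^ (A.card - 1) * ((1 + q) * (1 + ε)) :=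
            mul_le_mul ih2 hg2 (hk.green_self_nonneg hA hv) (by positivity)
        _ = _ := by linear_combination ((1 + ε) ^ (A.card - 1) * (1 + ε)) * hqN

end Cluster

/-! ### Spectral estimates for determinants -/

section Spectral

lemma exists_orthogonal_diag {M : Matrix V V ℝ} (hM : M.IsSymm) :
    ∃ (U : Matrix V V ℝ) (p : V → ℝ), U * U.transpose = 1 ∧
      M = U * Matrix.diagonal p * U.transpose := by
  have hH : M.IsHermitian := by
    rw [Matrix.IsHermitian, Matrix.conjTranspose_eq_transpose_of_trivial]
    exact hM
  refine ⟨hH.eigenvectorUnitary.1, hH.eigenvalues, ?_, ?_⟩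
  · have := Unitary.mul_star_self_of_mem hH.eigenvectorUnitary.2
    rwa [Matrix.star_eq_conjTranspose, Matrix.conjTranspose_eq_transpose_of_trivial] at this
  · have := hH.spectral_theorem
    rw [Unitary.conjStarAlgAut_apply, Matrix.star_eq_conjTranspose,
      Matrix.conjTranspose_eq_transpose_of_trivial] at this
    exact this

/-- Numerical summary of the spectrum of a symmetric matrix. -/
lemma exists_spectrum {M : Matrix V V ℝ} (hM : M.IsSymm) :
    ∃ p : V → ℝ, (1 - M).det = ∏ i, (1 - p i) ∧ M.trace = ∑ i, p i ∧
      (M * M).trace = ∑ i, p i ^ 2 ∧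
      ∀ (q : V → ℝ) (μ : ℝ), 0 < q ⬝ᵥ q → μ * (q ⬝ᵥ q) ≤ q ⬝ᵥ M.mulVec q → ∃ i, μ ≤ p i := by
  obtain ⟨U, p, hU, rfl⟩ := exists_orthogonal_diag hM
  have hU' : U.transpose * U = 1 := mul_eq_one_comm.1 hU
  refine ⟨p, ?_, ?_, ?_, ?_⟩
  · have h : 1 - U * Matrix.diagonal p * U.transpose =
        U * (Matrix.diagonal fun i => 1 - p i) * U.transpose := by
      have h1 : (Matrix.diagonal fun i => 1 - p i) = 1 - Matrix.diagonal p := by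
        rw [← Matrix.diagonal_one, Matrix.diagonal_sub]
      rw [h1, Matrix.mul_sub, Matrix.sub_mul, Matrix.mul_one, hU]
    have hd : U.det * U.transpose.det = 1 := by rw [← Matrix.det_mul, hU, Matrix.det_one]
    rw [h, Matrix.det_mul, Matrix.det_mul, Matrix.det_diagonal, mul_right_comm, hd, one_mul]
  · rw [Matrix.trace_mul_comm, ← Matrix.mul_assoc, hU', Matrix.one_mul, Matrix.trace_diagonal]
  · have h : U * Matrix.diagonal p * U.transpose * (U * Matrix.diagonal p * U.transpose) =
        U * (Matrix.diagonal p * Matrix.diagonal p) * U.transpose := by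
      calc _ = U * Matrix.diagonal p * (U.transpose * U) * Matrix.diagonal p * U.transpose := by
            simp only [Matrix.mul_assoc]
        _ = _ := by rw [hU', Matrix.mul_one]; simp only [Matrix.mul_assoc]
    rw [h, Matrix.trace_mul_comm, ← Matrix.mul_assoc, hU', Matrix.one_mul,
      Matrix.diagonal_mul_diagonal, Matrix.trace_diagonal]
    simp only [sq]
  · intro q μ hq hμ
    by_contra! hlt
    set z := U.transpose.mulVec q with hz
    have h1 : q ⬝ᵥ (U * Matrix.diagonal p * U.transpose).mulVec q = ∑ i, p i * z i ^ 2 := by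
      rw [← Matrix.mulVec_mulVec, ← Matrix.mulVec_mulVec, Matrix.dotProduct_mulVec,
        ← Matrix.mulVec_transpose, ← hz]
      simp only [dotProduct, Matrix.mulVec_diagonal]
      exact Finset.sum_congr rfl fun i _ => by ring
    have h2 : q ⬝ᵥ q = ∑ i, z i ^ 2 := by
      have : z ⬝ᵥ z = q ⬝ᵥ q := by
        rw [hz, Matrix.dotProduct_mulVec, Matrix.vecMul_transpose, Matrix.mulVec_mulVec, hU,
          Matrix.one_mulVec]
      rw [← this]
      simp only [dotProduct, sq]
    rw [h1, h2, Finset.mul_sum] at hμ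
    rw [h2] at hq
    obtain ⟨i, hi, hzi⟩ := Finset.exists_lt_of_sum_lt
      (s := univ) (f := fun _ => (0 : ℝ)) (g := fun i => z i ^ 2) (by simpa using hq)
    exact absurd hμ (not_le.2 (Finset.sum_lt_sum
      (fun j _ => mul_le_mul_of_nonneg_right (hlt j).le (sq_nonneg _))
      ⟨i, hi, mul_lt_mul_of_pos_right (hlt i) hzi⟩))

lemma exists_prod_one_sub {ι : Type*} (s : Finset ι) (p : ι → ℝ)
    (h : ∑ i ∈ s, p i ^ 2 ≤ 1 / 4) :
    ∃ a : ℝ, |a| ≤ ∑ i ∈ s, 2 * p i ^ 2 ∧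
      ∏ i ∈ s, (1 - p i) = Real.exp (-(∑ i ∈ s, p i) + a) := by
  have hp : ∀ i ∈ s, |p i| ≤ 1 / 2 := fun i hi => by
    have := (Finset.single_le_sum (fun j _ => sq_nonneg (p j)) hi).trans h
    exact abs_le_of_sq_le_sq (by linarith) (by norm_num)
  refine ⟨∑ i ∈ s, (Real.log (1 - p i) + p i), ?_, ?_⟩
  · refine (Finset.abs_sum_le_sum_abs _ _).trans (Finset.sum_le_sum fun i hi => ?_)
    obtain ⟨h1, h2⟩ := abs_le.1 (hp i hi)
    have hpos : 0 < 1 - p i := by linarith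
    rw [abs_le]
    constructor
    · have h3 := Real.one_sub_inv_le_log_of_pos hpos
      have h4 : (1 - p i)⁻¹ ≤ 1 + p i + p i ^ 2 + p i ^ 2 := by
        rw [inv_le_iff_one_le_mul₀ hpos]
        nlinarith [sq_nonneg (p i), mul_nonneg (sq_nonneg (p i)) (by linarith : 0 ≤ 1 - 2 * p i)]
      linarith
    · have h5 := Real.log_le_sub_one_of_pos hpos
      nlinarith [sq_nonneg (p i)]
  · rw [← Finset.sum_neg_distrib, ← Finset.sum_add_distrib, Real.exp_sum]
    refine Finset.prod_congr rfl fun i hi => ?_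
    have hpos : 0 < 1 - p i := by linarith [(abs_le.1 (hp i hi)).2]
    rw [neg_add_cancel_comm_assoc, Real.exp_log hpos]

end Spectral

/-! ### The determinant with escape -/

section Escape

lemma exists_spectral_tolerance {N t : ℕ} (ht : 1 ≤ t) (htN : t ≤ N) {δ : ℝ} (hδ : 0 < δ) :
    ∃ e₀ > 0, ∀ e : ℝ, 0 ≤ e → e ≤ e₀ → ∀ (V : Type) [Fintype V] (p : V → ℝ) (d : ℝ) (i : V),
      |∑ j, p j - (1 + (N : ℝ)⁻¹) * t| ≤ e → ∑ j, p j ^ 2 ≤ ((N : ℝ)⁻¹ * t) ^ 2 + e →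
      (N : ℝ)⁻¹ * t - e ≤ p i → |d - N| ≤ e →
      |d * ∏ j, (1 - p j) - ((N : ℝ) - t) * Real.exp (-(t : ℝ))| ≤ δ := by
  have hN : (1 : ℝ) ≤ N := by exact_mod_cast ht.trans htN
  have ht' : (1 : ℝ) ≤ t := by exact_mod_cast ht
  have htN' : (t : ℝ) ≤ N := by exact_mod_cast htN
  set τ := (N : ℝ)⁻¹ * t with hτ
  have hNτ : N * τ = t := by rw [hτ, mul_inv_cancel_left₀ (by linarith)]
  have hτ1 : τ ≤ 1 := by
    rw [hτ, inv_mul_le_iff₀ (by linarith)]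
    linarith
  have hτ0 : 0 < τ := by positivity
  let F : ℝ × ℝ × ℝ × ℝ → ℝ := fun z => z.2.2.2 * ((1 - z.1) * Real.exp (-z.2.1 + z.2.2.1))
  have hF : Continuous F := by fun_prop
  obtain ⟨ρ, hρ, hFρ⟩ := Metric.continuousAt_iff.1 (hF.continuousAt (x := (τ, (t : ℝ), 0, (N : ℝ))))
    δ hδ
  have hF0 : F (τ, (t : ℝ), 0, (N : ℝ)) = ((N : ℝ) - t) * Real.exp (-(t : ℝ)) := by
    simp only [F, add_zero]
    rw [← mul_assoc, mul_sub, mul_one, hNτ]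
  refine ⟨min (min (1 / 12) τ) (ρ / (2 * (N + 8))), ?_, ?_⟩
  · have : 0 < ρ / (2 * (N + 8)) := by positivity
    positivity
  intro e he0 he V _ p d i hT hQ hi hd
  classical
  obtain ⟨⟨he1, heτ⟩, heρ⟩ := (le_min_iff.trans (and_congr_left' le_min_iff)).1 he
  rw [← Finset.add_sum_erase _ _ (Finset.mem_univ i)] at hT hQ
  rw [← Finset.mul_prod_erase _ _ (Finset.mem_univ i)]
  set x := p i with hx
  have hx1 : x ≤ τ + N * e := by
    by_contra! hlt
    have h1 : 0 ≤ ∑ j ∈ univ.erase i, p j ^ 2 := Finset.sum_nonneg fun j _ => sq_nonneg _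
    have h2 : (τ + N * e) ^ 2 < x ^ 2 := by
      have : 0 ≤ τ + N * e := by positivity
      nlinarith
    have h3 : e ≤ τ * (N * e) := by
      have : τ * (N * e) = t * e := by rw [← hNτ]; ring
      nlinarith
    nlinarith [sq_nonneg (N * e)]
  have hx2 : τ ^ 2 - 2 * e ≤ x ^ 2 := by nlinarith
  have hS : ∑ j ∈ univ.erase i, 2 * p j ^ 2 ≤ 6 * e := by
    rw [← Finset.mul_sum]
    linarith
  obtain ⟨a, ha, hprod⟩ := exists_prod_one_sub (univ.erase i) p (by linarith)
  rw [hprod]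
  set y := ∑ j ∈ univ.erase i, p j with hy
  have hbig : (N + 8) * e ≤ ρ / 2 := by
    rw [le_div_iff₀ (by positivity)] at heρ
    linarith
  have hNe : e ≤ N * e := by nlinarith
  have hT' := abs_le.1 hT
  have hlt : dist (x, y, a, d) (τ, (t : ℝ), 0, (N : ℝ)) < ρ := by
    have key : ∀ b : ℝ, |b| ≤ (N + 8) * e → |b| < ρ := fun b hb => by linarith
    simp only [Prod.dist_eq, Real.dist_eq, max_lt_iff]
    have hτN : (1 + (N : ℝ)⁻¹) * t = t + τ := by rw [hτ]; ring
    rw [hτN] at hT'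
    refine ⟨key _ ?_, key _ ?_, key _ ?_, key _ ?_⟩
    · rw [abs_le]
      constructor <;> linarith
    · rw [abs_le]
      constructor <;> linarith
    · rw [sub_zero]
      linarith
    · linarith
  have := hFρ hlt
  rw [hF0, Real.dist_eq] at this
  exact this.le

variable {k : V → V → ℝ}

/-- Conductance from a vertex off `A` to `B`. -/
def esc (k : V → V → ℝ) (A B : Finset V) (x : V) : ℝ := if x ∈ A then 0 else ∑ u ∈ B, k x u

lemma IsNet.esc_nonneg (hk : IsNet k) (A B : Finset V) (x : V) : 0 ≤ esc k A B x := by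
  rw [esc]
  split_ifs
  · exact le_rfl
  · exact Finset.sum_nonneg fun u _ => hk.nonneg x u

/-- The symmetrized escape matrix. -/
def escMat (k : V → V → ℝ) (A B : Finset V) : Matrix V V ℝ :=
  Matrix.of fun x y => √(esc k A B x) * green k A y x * √(esc k A B y)

lemma IsNet.escMat_isSymm (hk : IsNet k) {A : Finset V} (hA : A.Nonempty) (B : Finset V) :
    (escMat k A B).IsSymm := by
  ext x y
  simp only [Matrix.transpose_apply, escMat, Matrix.of_apply]
  by_cases hx : x ∈ A
  · simp [esc, hx]
  · by_cases hy : y ∈ A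
    · simp [esc, hy]
    · rw [hk.green_comm hA hx hy]
      ring

lemma IsNet.det_escLap (hk : IsNet k) {A : Finset V} (hA : A.Nonempty) (B : Finset V) :
    (escLap A B k).det = (lapOff A k).det * (1 - escMat k A B).det := by
  set S : Matrix V V ℝ := Matrix.diagonal fun x => √(esc k A B x) with hS
  have hSS : S * S = Matrix.diagonal (esc k A B) := by
    rw [hS, Matrix.diagonal_mul_diagonal]
    congr 1
    ext x
    exact Real.mul_self_sqrt (hk.esc_nonneg A B x)
  have hL : lapOff A k * (lapOff A k)⁻¹ = 1 :=
    Matrix.mul_nonsing_inv _ (isUnit_iff_ne_zero.2 (hk.det_lapOff_ne_zero hA))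
  have hM : escMat k A B = S * ((lapOff A k)⁻¹ * S) := by
    ext x y
    rw [hS, Matrix.diagonal_mul, Matrix.mul_diagonal, escMat, Matrix.of_apply, green, mul_assoc]
  have h1 : escLap A B k = lapOff A k * (1 - (lapOff A k)⁻¹ * S * S) := by
    rw [Matrix.mul_sub, Matrix.mul_one, Matrix.mul_assoc, ← Matrix.mul_assoc (lapOff A k), hL,
      Matrix.one_mul, hSS]
    rfl
  rw [h1, Matrix.det_mul, Matrix.det_one_sub_mul_comm, hM]

end Escape

/-! ### Determinants at good clusters -/

section GoodCluster

variable {k : V → V → ℝ} {o : V} {θ : ℝ}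

lemma IsGoodNet.isCluster (hk : IsGoodNet k o θ) (hθ : 0 ≤ θ) (hθ1 : θ ≤ 1 / 2) {L : ℝ}
    (hL : 1 ≤ L) {B : Finset V} (ht : ∀ x ∈ B, |tot k x - 1| ≤ θ)
    (hd : ∀ x ∈ B, ∀ y ∈ B, devE k o x y ≤ L * θ) : IsCluster k o (12 * L * θ) B := by
  have hLθ : θ ≤ L * θ := by nlinarith
  refine ⟨fun x hx => (ht x hx).trans (by linarith), fun x hx y hy hxy => ?_,
    fun x y => (hk.edge x y).trans (by linarith)⟩
  have h := hk.devE_eq o hxy (hk.pos x).ne' (hk.pos y).ne'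
  have hinv : ∀ z ∈ B, 1 - 2 * θ ≤ (tot k z)⁻¹ ∧ (tot k z)⁻¹ ≤ 1 + 2 * θ := by
    intro z hz
    have h1 := abs_le.1 (ht z hz)
    constructor
    · rw [← one_div, le_div_iff₀ (hk.pos z)]
      nlinarith
    · rw [inv_le_iff_one_le_mul₀ (hk.pos z)]
      nlinarith
  obtain ⟨hx1, hx2⟩ := hinv x hx
  obtain ⟨hy1, hy2⟩ := hinv y hy
  have hk0 : 0 ≤ k x y * ((tot k x)⁻¹ * (tot k y)⁻¹) :=
    mul_nonneg (hk.nonneg x y) (mul_nonneg (inv_pos.2 (hk.pos x)).le (inv_pos.2 (hk.pos y)).le)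
  have hk1 : k x y * ((tot k x)⁻¹ * (tot k y)⁻¹) ≤ θ * (2 * 2) := by
    refine mul_le_mul (hk.edge x y) (mul_le_mul (by linarith) (by linarith)
      (inv_pos.2 (hk.pos y)).le (by norm_num)) ?_ hθ
    exact mul_nonneg (inv_pos.2 (hk.pos x)).le (inv_pos.2 (hk.pos y)).le
  have h0 := hk.devE_nonneg o x y
  have hd' := hd x hx y hy
  rw [abs_le]
  constructor <;> linarith

lemma trace_escMat (hk : IsNet k) (A B : Finset V) :
    (escMat k A B).trace = ∑ x, esc k A B x * green k A x x := by
  refine Finset.sum_congr rfl fun x _ => ?_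
  rw [Matrix.diag_apply, escMat, Matrix.of_apply, mul_right_comm,
    Real.mul_self_sqrt (hk.esc_nonneg A B x)]

lemma trace_escMat_sq (hk : IsNet k) {A : Finset V} (hA : A.Nonempty) (B : Finset V) :
    (escMat k A B * escMat k A B).trace =
      ∑ x, ∑ y, esc k A B x * esc k A B y * green k A y x ^ 2 := by
  refine Finset.sum_congr rfl fun x _ => ?_
  rw [Matrix.diag_apply, Matrix.mul_apply]
  refine Finset.sum_congr rfl fun y _ => ?_
  have h : escMat k A B y x = escMat k A B x y := (hk.escMat_isSymm hA B).apply x y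
  have h1 := Real.mul_self_sqrt (hk.esc_nonneg A B x)
  have h2 := Real.mul_self_sqrt (hk.esc_nonneg A B y)
  rw [h, escMat, Matrix.of_apply]
  calc _ = (√(esc k A B x) * √(esc k A B x)) * (√(esc k A B y) * √(esc k A B y)) *
        green k A y x ^ 2 := by ring
    _ = _ := by rw [h1, h2]

lemma dotProduct_escMat (hk : IsNet k) (A B W : Finset V) :
    (fun x => if x ∈ W then √(esc k A B x) else 0) ⬝ᵥ
        (escMat k A B).mulVec (fun x => if x ∈ W then √(esc k A B x) else 0) =
      ∑ x ∈ W, ∑ y ∈ W, esc k A B x * esc k A B y * green k A y x := by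
  simp only [dotProduct, Matrix.mulVec, ite_mul, zero_mul, mul_ite, mul_zero, Finset.sum_ite_mem,
    Finset.univ_inter]
  refine Finset.sum_congr rfl fun x _ => ?_
  rw [Finset.mul_sum]
  refine Finset.sum_congr rfl fun y _ => ?_
  have h1 := Real.mul_self_sqrt (hk.esc_nonneg A B x)
  have h2 := Real.mul_self_sqrt (hk.esc_nonneg A B y)
  rw [escMat, Matrix.of_apply]
  calc _ = (√(esc k A B x) * √(esc k A B x)) * (√(esc k A B y) * √(esc k A B y)) *
        green k A y x := by ring
    _ = _ := by rw [h1, h2]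

/-- The vertices off `A` seen from `B` through a good pair. -/
def goodNbr (k : V → V → ℝ) (o : V) (θ : ℝ) (A B : Finset V) : Finset V :=
  univ.filter fun v => v ∉ A ∧ ∃ s ∈ B, GoodE k o θ s v

/-- The part of the network near a good cluster. -/
structure IsGoodCluster (k : V → V → ℝ) (o : V) (θ L : ℝ) (A B : Finset V) : Prop where
  sub : B ⊆ A
  good : ∀ s ∈ B, GoodV k o θ s
  typ : ∀ x ∈ A, |tot k x - 1| ≤ θ
  dev : ∀ x ∈ A, ∀ y ∈ A, devE k o x y ≤ L * θ

variable {A B : Finset V} {L : ℝ}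

lemma IsGoodCluster.isCluster (h : IsGoodCluster k o θ L A B) (hk : IsGoodNet k o θ)
    (hθ : 0 ≤ θ) (hθ1 : θ ≤ 1 / 2) (hL : 1 ≤ L) {v : V} (hv : v ∈ goodNbr k o θ A B) :
    IsCluster k o (48 * L * θ) (insert v A) := by
  have hLθ : θ ≤ L * θ := by nlinarith
  obtain ⟨-, hvA, s, hs, hsv⟩ := Finset.mem_filter.1 hv
  have hvx : ∀ x ∈ A, devE k o v x ≤ 4 * L * θ := by
    intro x hx
    have h1 := hk.devE_triangle o v s x
    have h2 := hsv.symm.2.2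
    have h3 := h.dev s (h.sub hs) x hx
    linarith
  have := hk.isCluster hθ hθ1 (L := 4 * L) (by linarith) (B := insert v A) ?_ ?_
  · rwa [show 12 * (4 * L) * θ = 48 * L * θ by ring] at this
  · intro x hx
    rcases Finset.mem_insert.1 hx with rfl | hx
    · exact hsv.2.1
    · exact h.typ x hx
  · intro x hx y hy
    rcases Finset.mem_insert.1 hx with hx' | hx' <;>
      rcases Finset.mem_insert.1 hy with hy' | hy'
    · rw [hx', hy', devE_self]
      nlinarith
    · rw [hx']
      exact hvx y hy'
    · rw [hy', devE_comm]
      exact hvx x hx'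
    · have := h.dev x hx' y hy'
      linarith

lemma IsGoodCluster.green_sub_le (h : IsGoodCluster k o θ L A B) (hk : IsGoodNet k o θ)
    (hA : A.Nonempty) (hθ : 0 ≤ θ) (hθ1 : θ ≤ 1 / 2) (hL : 1 ≤ L) {ε : ℝ} (hε : 0 ≤ ε)
    (hε1 : ε ≤ 1) (hθε : 864 * L * θ ≤ ε ^ 2) {u v : V} (hu : u ∈ goodNbr k o θ A B)
    (hv : v ∈ goodNbr k o θ A B) :
    |green k A v u - ((if u = v then 1 else 0) + (A.card : ℝ)⁻¹)| ≤ ε := by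
  have hLθ : 0 ≤ L * θ := mul_nonneg (by linarith) hθ
  refine abs_le_of_sq_le_sq (le_trans (hk.green_sub_ideal_sq_le hA (Finset.mem_filter.1 hv).2.1
    (Finset.mem_filter.1 hu).2.1 (κ := 48 * L * θ) (by linarith) (by nlinarith)
    (h.isCluster hk hθ hθ1 hL hv) (h.isCluster hk hθ hθ1 hL hu)) (by linarith)) hε

lemma IsGoodCluster.sum_esc_bad (h : IsGoodCluster k o θ L A B) (hk : IsGoodNet k o θ) :
    ∑ v, (if v ∈ goodNbr k o θ A B then 0 else esc k A B v) ≤ B.card * θ := by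
  have h1 : ∀ v, (if v ∈ goodNbr k o θ A B then 0 else esc k A B v) ≤
      ∑ s ∈ B, if GoodE k o θ s v then 0 else k s v := by
    intro v
    have h0 : 0 ≤ ∑ s ∈ B, if GoodE k o θ s v then 0 else k s v :=
      Finset.sum_nonneg fun s _ => by
        split_ifs
        · exact le_rfl
        · exact hk.nonneg s v
    split_ifs with hv
    · exact h0
    · by_cases hvA : v ∈ A
      · rwa [esc, if_pos hvA]
      · rw [esc, if_neg hvA]
        refine Finset.sum_le_sum fun s hs => ?_
        rw [if_neg fun hg => hv (Finset.mem_filter.2 ⟨Finset.mem_univ _, hvA, s, hs, hg⟩),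
          hk.symm]
  refine (Finset.sum_le_sum fun v _ => h1 v).trans ?_
  rw [Finset.sum_comm, ← nsmul_eq_mul]
  exact Finset.sum_le_card_nsmul _ _ _ fun s hs => (h.good s hs).2.2

lemma IsGoodCluster.sum_esc_green_bad (h : IsGoodCluster k o θ L A B) (hk : IsGoodNet k o θ) :
    ∑ v, (if v ∈ goodNbr k o θ A B then 0 else esc k A B v * green k A v v) ≤ B.card * θ := by
  have h1 : ∀ v, (if v ∈ goodNbr k o θ A B then 0 else esc k A B v * green k A v v) ≤
      ∑ s ∈ B, if GoodE k o θ s v then 0 else k s v * res k o s v := by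
    intro v
    have h0 : 0 ≤ ∑ s ∈ B, if GoodE k o θ s v then 0 else k s v * res k o s v :=
      Finset.sum_nonneg fun s _ => by
        split_ifs
        · exact le_rfl
        · exact mul_nonneg (hk.nonneg s v) (hk.res_nonneg o s v)
    split_ifs with hv
    · exact h0
    · by_cases hvA : v ∈ A
      · rwa [esc, if_pos hvA, zero_mul]
      · rw [esc, if_neg hvA, Finset.sum_mul]
        refine Finset.sum_le_sum fun s hs => ?_
        rw [if_neg fun hg => hv (Finset.mem_filter.2 ⟨Finset.mem_univ _, hvA, s, hs, hg⟩),
          hk.symm, res_comm]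
        exact mul_le_mul_of_nonneg_left (hk.green_le_res o hvA (h.sub hs)) (hk.nonneg s v)
  refine (Finset.sum_le_sum fun v _ => h1 v).trans ?_
  rw [Finset.sum_comm, ← nsmul_eq_mul]
  exact Finset.sum_le_card_nsmul _ _ _ fun s hs => (h.good s hs).2.1

lemma IsGoodCluster.sum_esc (h : IsGoodCluster k o θ L A B) (hk : IsGoodNet k o θ) :
    B.card * (1 - θ) - A.card * (B.card * θ) ≤ ∑ v, esc k A B v ∧
      ∑ v, esc k A B v ≤ B.card * (1 + θ) := by
  have h1 : ∑ v, ∑ s ∈ B, k v s = ∑ s ∈ B, tot k s := by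
    rw [Finset.sum_comm]
    exact Finset.sum_congr rfl fun s _ => Finset.sum_congr rfl fun v _ => hk.symm v s
  have h2 : ∑ v, esc k A B v + ∑ v ∈ A, ∑ s ∈ B, k v s = ∑ s ∈ B, tot k s := by
    rw [← h1, ← Finset.univ_inter A, ← Finset.sum_ite_mem, ← Finset.sum_add_distrib,
      Finset.univ_inter]
    refine Finset.sum_congr rfl fun v _ => ?_
    rw [esc]
    split_ifs <;> simp
  have h3 : ∑ s ∈ B, tot k s ≤ B.card * (1 + θ) := by
    rw [← nsmul_eq_mul]
    exact Finset.sum_le_card_nsmul _ _ _ fun s hs => by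
      linarith [(abs_le.1 (h.typ s (h.sub hs))).2]
  have h4 : B.card * (1 - θ) ≤ ∑ s ∈ B, tot k s := by
    rw [← nsmul_eq_mul]
    exact Finset.card_nsmul_le_sum _ _ _ fun s hs => by
      linarith [(abs_le.1 (h.typ s (h.sub hs))).1]
  have h5 : ∑ v ∈ A, ∑ s ∈ B, k v s ≤ A.card * (B.card * θ) := by
    rw [← nsmul_eq_mul, ← nsmul_eq_mul]
    exact Finset.sum_le_card_nsmul _ _ _ fun v _ =>
      Finset.sum_le_card_nsmul _ _ _ fun s _ => hk.edge v s
  have h6 : 0 ≤ ∑ v ∈ A, ∑ s ∈ B, k v s :=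
    Finset.sum_nonneg fun v _ => Finset.sum_nonneg fun s _ => hk.nonneg v s
  constructor <;> linarith

end GoodCluster

section GoodDet

variable {k : V → V → ℝ} {o : V} {θ : ℝ} {A B : Finset V} {L : ℝ}

lemma IsGoodCluster.trace_sq_le (h : IsGoodCluster k o θ L A B) (hk : IsGoodNet k o θ)
    (hA : A.Nonempty) (hθ : 0 ≤ θ) (hθ1 : θ ≤ 1 / 2) (hL : 1 ≤ L) {ε : ℝ} (hε : 0 ≤ ε)
    (hε1 : ε ≤ 1) (hθε : 864 * L * θ ≤ ε ^ 2) :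
    ∑ x, ∑ y, esc k A B x * esc k A B y * green k A y x ^ 2 ≤
      (((A.card : ℝ)⁻¹ + ε) * ∑ v ∈ goodNbr k o θ A B, esc k A B v) ^ 2 +
      9 * (B.card * θ) * (∑ v ∈ goodNbr k o θ A B, esc k A B v) +
      2 * ((∑ v, if v ∈ goodNbr k o θ A B then 0 else esc k A B v * green k A v v) *
        ∑ v, esc k A B v * green k A v v) := by
  set W := goodNbr k o θ A B with hW
  set q := (A.card : ℝ)⁻¹ with hq
  have hN : (1 : ℝ) ≤ A.card := by exact_mod_cast hA.card_pos
  have hq1 : q ≤ 1 := inv_le_one_of_one_le₀ hN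
  have hq0 : 0 ≤ q := by positivity
  set f : V → ℝ := fun v => if v ∈ W then esc k A B v else 0 with hf
  set g : V → ℝ := fun v => esc k A B v * green k A v v with hg
  set h' : V → ℝ := fun v => if v ∈ W then 0 else esc k A B v * green k A v v with hh
  have hesc := hk.esc_nonneg A B
  have hg0 : ∀ v, 0 ≤ g v := by
    intro v
    by_cases hv : v ∈ A
    · simp [hg, esc, hv]
    · exact mul_nonneg (hesc v) (hk.green_self_nonneg hA hv)
  have hh0 : ∀ v, 0 ≤ h' v := by
    intro v
    simp only [hh]
    split_ifs
    · exact le_rfl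
    · exact hg0 v
  have hf0 : ∀ v, 0 ≤ f v := by
    intro v
    simp only [hf]
    split_ifs
    · exact hesc v
    · exact le_rfl
  have hCS : ∀ x y, esc k A B x * esc k A B y * green k A y x ^ 2 ≤ g x * g y := by
    intro x y
    by_cases hx : x ∈ A
    · simp [hg, esc, hx]
    by_cases hy : y ∈ A
    · simp [hg, esc, hy]
    have h1 := hk.en_sq_le (green k A y) (green k A x)
    rw [hk.en_green_green hA hx hy, hk.en_green_green hA hy hy, hk.en_green_green hA hx hx,
      hk.green_comm hA hx hy] at h1
    calc _ ≤ esc k A B x * esc k A B y * (green k A y y * green k A x x) :=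
          mul_le_mul_of_nonneg_left h1 (mul_nonneg (hesc x) (hesc y))
      _ = _ := by simp only [hg]; ring
  have hpt : ∀ x y, esc k A B x * esc k A B y * green k A y x ^ 2 ≤
      (q + ε) ^ 2 * (f x * f y) + (if x = y then 9 * (B.card * θ) * f x else 0) +
        h' x * g y + g x * h' y := by
    intro x y
    have hd : 0 ≤ (if x = y then 9 * (B.card * θ) * f x else 0) := by
      have := hf0 x
      split_ifs
      · positivity
      · exact le_rfl
    have hff : 0 ≤ (q + ε) ^ 2 * (f x * f y) :=
      mul_nonneg (sq_nonneg _) (mul_nonneg (hf0 x) (hf0 y))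
    have h1 := mul_nonneg (hh0 x) (hg0 y)
    have h2 := mul_nonneg (hg0 x) (hh0 y)
    by_cases hx : x ∈ W
    · by_cases hy : y ∈ W
      · have hG := abs_le.1 (h.green_sub_le hk hA hθ hθ1 hL hε hε1 hθε hx hy)
        have hfx : f x = esc k A B x := by simp [hf, hx]
        have hfy : f y = esc k A B y := by simp [hf, hy]
        rw [hfx, hfy]
        by_cases hxy : x = y
        · subst hxy
          rw [if_pos rfl] at hG ⊢
          have hG2 : green k A x x ^ 2 ≤ 9 := by nlinarith
          have he : esc k A B x ≤ B.card * θ := by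
            rw [esc, if_neg (Finset.mem_filter.1 hx).2.1, ← nsmul_eq_mul]
            exact Finset.sum_le_card_nsmul _ _ _ fun s _ => hk.edge x s
          rw [hfx] at hff
          calc _ ≤ esc k A B x * (B.card * θ) * 9 := by
                have := hesc x
                gcongr
            _ ≤ _ := by linarith
        · rw [if_neg hxy, zero_add] at hG
          rw [if_neg hxy]
          have hG2 : green k A y x ^ 2 ≤ (q + ε) ^ 2 := by
            refine sq_le_sq' ?_ ?_ <;> linarith
          calc _ ≤ esc k A B x * esc k A B y * (q + ε) ^ 2 := by
                have := hesc x
                have := hesc y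
                gcongr
            _ ≤ _ := by linarith
      · have h3 : h' y = g y := by simp [hh, hg, hy]
        have := hCS x y
        rw [h3]
        linarith
    · have h3 : h' x = g x := by simp [hh, hg, hx]
      have := hCS x y
      rw [h3]
      linarith
  refine (Finset.sum_le_sum fun x _ => Finset.sum_le_sum fun y _ => hpt x y).trans ?_
  have hX : ∑ v, f v = ∑ v ∈ W, esc k A B v := by
    simp only [hf, Finset.sum_ite_mem, Finset.univ_inter]
  simp only [Finset.sum_add_distrib, Finset.sum_ite_eq, Finset.mem_univ, if_true,
    ← Finset.mul_sum, ← Finset.sum_mul, hX]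
  refine le_of_eq ?_
  ring

lemma spectral_bounds {q t ε X T Y b : ℝ} (hq0 : 0 ≤ q) (hq1 : q ≤ 1) (ht : 1 ≤ t)
    (hqt : q * t ≤ 1) (hε : 0 ≤ ε) (hε1 : ε < 1) (hεq : ε ≤ q) (hX1 : t - ε ≤ X)
    (hX2 : X ≤ t + ε) (hY0 : 0 ≤ Y) (hYε : Y ≤ ε) (hT1 : (1 + q - ε) * X ≤ T)
    (hT2 : T ≤ (1 + q + ε) * X + Y) (hb : b ≤ ε) :
    |T - (1 + q) * t| ≤ (t + 25) ^ 2 * ε ∧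
      ((q + ε) * X) ^ 2 + b * X + 2 * (Y * T) ≤ (q * t) ^ 2 + (t + 25) ^ 2 * ε ∧
      q * t - (t + 25) ^ 2 * ε ≤ (q - ε) * X := by
  have hX0 : 0 < X := by linarith
  have hqt0 : 0 ≤ q * t := mul_nonneg hq0 (by linarith)
  have htε : 0 ≤ t * ε := mul_nonneg (by linarith) hε
  have htε2 : 0 ≤ t * (t * ε) := mul_nonneg (by linarith) htε
  have htε1 : t * ε ≤ t * 1 := mul_le_mul_of_nonneg_left hε1.le (by linarith)
  have hεε : ε * ε ≤ 1 * ε := mul_le_mul_of_nonneg_right hε1.le hε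
  have hεε0 : 0 ≤ ε * ε := mul_nonneg hε hε
  have hqε : q * ε ≤ 1 * ε := mul_le_mul_of_nonneg_right hq1 hε
  have hqε0 : 0 ≤ q * ε := mul_nonneg hq0 hε
  have hsq : (t + 25) ^ 2 * ε = t * (t * ε) + 50 * (t * ε) + 625 * ε := by ring
  have h1 : (1 + q - ε) * (t - ε) ≤ (1 + q - ε) * X :=
    mul_le_mul_of_nonneg_left hX1 (by linarith)
  have h2 : (1 + q + ε) * X ≤ (1 + q + ε) * (t + ε) :=
    mul_le_mul_of_nonneg_left hX2 (by linarith)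
  have h3 : (1 + q - ε) * (t - ε) = (1 + q) * t - ε - q * ε - t * ε + ε * ε := by ring
  have h4 : (1 + q + ε) * (t + ε) = (1 + q) * t + ε + q * ε + t * ε + ε * ε := by ring
  have h5 : (1 + q) * t = t + q * t := by ring
  refine ⟨?_, ?_, ?_⟩
  · rw [hsq, abs_le]
    constructor <;> linarith
  · have e1 : (q + ε) * X ≤ q * t + (t + 2) * ε := by
      have e2 : (q + ε) * X ≤ (q + ε) * (t + ε) := mul_le_mul_of_nonneg_left hX2 (by linarith)
      have e3 : (q + ε) * (t + ε) = q * t + q * ε + t * ε + ε * ε := by ring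
      linarith
    have e4 : ((q + ε) * X) ^ 2 ≤ (q * t + (t + 2) * ε) ^ 2 :=
      pow_le_pow_left₀ (mul_nonneg (by linarith) hX0.le) e1 2
    have e5 : (q * t) * ((t + 2) * ε) ≤ 1 * ((t + 2) * ε) :=
      mul_le_mul_of_nonneg_right hqt (mul_nonneg (by linarith) hε)
    have e6 : (t + 2) ^ 2 * (ε * ε) ≤ (t + 2) ^ 2 * (1 * ε) :=
      mul_le_mul_of_nonneg_left hεε (sq_nonneg _)
    have e7 : (q * t + (t + 2) * ε) ^ 2 =
        (q * t) ^ 2 + 2 * ((q * t) * ((t + 2) * ε)) + (t + 2) ^ 2 * (ε * ε) := by ring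
    have e8 : (t + 2) ^ 2 * (1 * ε) = t * (t * ε) + 4 * (t * ε) + 4 * ε := by ring
    have e9 : b * X ≤ ε * (t + ε) := by
      refine (mul_le_mul_of_nonneg_right hb hX0.le).trans (mul_le_mul_of_nonneg_left hX2 hε)
    have e10 : Y * T ≤ ε * (2 * t + 5) := by
      have : Y * T ≤ Y * (2 * t + 5) := mul_le_mul_of_nonneg_left (by linarith) hY0
      exact this.trans (mul_le_mul_of_nonneg_right hYε (by linarith))
    rw [hsq]
    linarith
  · have e2 : (q - ε) * (t - ε) ≤ (q - ε) * X := mul_le_mul_of_nonneg_left hX1 (by linarith)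
    have e3 : (q - ε) * (t - ε) = q * t - q * ε - t * ε + ε * ε := by ring
    rw [hsq]
    linarith

lemma IsGoodCluster.spectral (h : IsGoodCluster k o θ L A B) (hk : IsGoodNet k o θ)
    (hA : A.Nonempty) (hB : B.Nonempty) (hθ : 0 ≤ θ) (hθ1 : θ ≤ 1 / 2) (hL : 1 ≤ L) {ε : ℝ}
    (hε : 0 ≤ ε) (hε1 : ε < 1) (hεA : ε ≤ (A.card : ℝ)⁻¹) (hθε : 864 * L * θ ≤ ε ^ 2)
    (hθε' : 9 * ((A.card + 2) * (B.card * θ)) ≤ ε) :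
    ∃ (p : V → ℝ) (i : V), (1 - escMat k A B).det = ∏ j, (1 - p j) ∧
      |∑ j, p j - (1 + (A.card : ℝ)⁻¹) * B.card| ≤ (B.card + 25) ^ 2 * ε ∧
      ∑ j, p j ^ 2 ≤ ((A.card : ℝ)⁻¹ * B.card) ^ 2 + (B.card + 25) ^ 2 * ε ∧
      (A.card : ℝ)⁻¹ * B.card - (B.card + 25) ^ 2 * ε ≤ p i := by
  have hQ := h.trace_sq_le hk hA hθ hθ1 hL hε hε1.le hθε
  have hN : (1 : ℝ) ≤ A.card := by exact_mod_cast hA.card_pos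
  have ht : (1 : ℝ) ≤ B.card := by exact_mod_cast hB.card_pos
  have htN : (B.card : ℝ) ≤ A.card := by exact_mod_cast Finset.card_le_card h.sub
  have hY := h.sum_esc_green_bad hk
  have hbad := h.sum_esc_bad hk
  obtain ⟨hs1, hs2⟩ := h.sum_esc hk
  obtain ⟨p, hdet, htr, htr2, hray⟩ := exists_spectrum (hk.escMat_isSymm hA B)
  set W := goodNbr k o θ A B with hW
  set q := (A.card : ℝ)⁻¹ with hq
  set t := (B.card : ℝ) with htdef
  have hq1 : q ≤ 1 := inv_le_one_of_one_le₀ hN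
  have hq0 : 0 ≤ q := by positivity
  have hqt : q * t ≤ 1 := by
    rw [hq, inv_mul_le_iff₀ (by linarith)]
    linarith
  set X := ∑ v ∈ W, esc k A B v with hX
  set T := ∑ v, esc k A B v * green k A v v with hT
  set Y := ∑ v, (if v ∈ W then 0 else esc k A B v * green k A v v) with hYdef
  have hesc := hk.esc_nonneg A B
  have htθ : 9 * (t * θ) ≤ ε := by
    have h1 : 0 ≤ t * θ := mul_nonneg (by linarith) hθ
    have h2 : 1 * (t * θ) ≤ (A.card + 2) * (t * θ) :=
      mul_le_mul_of_nonneg_right (by linarith) h1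
    linarith
  have htθ' : 0 ≤ t * θ := mul_nonneg (by linarith) hθ
  have hsplit : ∀ f : V → ℝ, ∑ v, f v = ∑ v ∈ W, f v + ∑ v, if v ∈ W then 0 else f v := by
    intro f
    rw [← Finset.univ_inter W, ← Finset.sum_ite_mem, ← Finset.sum_add_distrib, Finset.univ_inter]
    refine Finset.sum_congr rfl fun v _ => ?_
    split_ifs <;> simp
  have hXs := hsplit (esc k A B)
  have hTs := hsplit fun v => esc k A B v * green k A v v
  rw [← hX] at hXs
  rw [← hT, ← hYdef] at hTs
  have hbad0 : 0 ≤ ∑ v, if v ∈ W then 0 else esc k A B v := Finset.sum_nonneg fun v _ => by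
    split_ifs
    · exact le_rfl
    · exact hesc v
  have hX1 : t - ε ≤ X := by nlinarith
  have hX2 : X ≤ t + ε := by nlinarith
  have hX0 : 0 < X := by linarith
  have hY0 : 0 ≤ Y := Finset.sum_nonneg fun v _ => by
    split_ifs
    · exact le_rfl
    · by_cases hv : v ∈ A
      · simp [esc, hv]
      · exact mul_nonneg (hesc v) (hk.green_self_nonneg hA hv)
  have hYε : Y ≤ ε := by linarith
  have hG := fun u (hu : u ∈ W) v (hv : v ∈ W) =>
    abs_le.1 (h.green_sub_le hk hA hθ hθ1 hL hε hε1.le hθε hu hv)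
  have hTW1 : (1 + q - ε) * X ≤ ∑ v ∈ W, esc k A B v * green k A v v := by
    rw [hX, Finset.mul_sum]
    refine Finset.sum_le_sum fun v hv => ?_
    have h1 := (hG v hv v hv).1
    rw [if_pos rfl] at h1
    rw [mul_comm]
    exact mul_le_mul_of_nonneg_left (by linarith) (hesc v)
  have hTW2 : ∑ v ∈ W, esc k A B v * green k A v v ≤ (1 + q + ε) * X := by
    rw [hX, Finset.mul_sum]
    refine Finset.sum_le_sum fun v hv => ?_
    have h1 := (hG v hv v hv).2
    rw [if_pos rfl] at h1
    rw [mul_comm (1 + q + ε)]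
    exact mul_le_mul_of_nonneg_left (by linarith) (hesc v)
  obtain ⟨hb1, hb2, hb3⟩ := spectral_bounds hq0 hq1 ht hqt hε hε1 hεA hX1 hX2 hY0 hYε
    (T := T) (Y := Y) (by linarith) (by linarith) htθ
  have hmain : ∃ i, (q - ε) * X ≤ p i := by
    refine hray (fun x => if x ∈ W then √(esc k A B x) else 0) _ ?_ ?_
    all_goals
      have hqq : (fun x => if x ∈ W then √(esc k A B x) else 0) ⬝ᵥ
          (fun x => if x ∈ W then √(esc k A B x) else 0) = X := by
        simp only [dotProduct, ite_mul, zero_mul, mul_ite, mul_zero, Finset.sum_ite_mem,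
          Finset.univ_inter, Finset.inter_self, hX]
        refine Finset.sum_congr rfl fun v hv => ?_
        rw [Real.mul_self_sqrt (hesc v)]
      rw [hqq]
    · exact hX0
    · rw [dotProduct_escMat hk.toIsNet, mul_assoc]
      have h1 : X * X = ∑ x ∈ W, ∑ y ∈ W, esc k A B x * esc k A B y := by
        rw [hX, Finset.sum_mul_sum]
      rw [h1, Finset.mul_sum]
      refine Finset.sum_le_sum fun x hx => ?_
      rw [Finset.mul_sum]
      refine Finset.sum_le_sum fun y hy => ?_
      have h2 := (hG x hx y hy).1
      have h3 : q - ε ≤ green k A y x := by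
        split_ifs at h2 <;> linarith
      rw [mul_comm]
      exact mul_le_mul_of_nonneg_left h3 (mul_nonneg (hesc x) (hesc y))
  obtain ⟨i, hi⟩ := hmain
  refine ⟨p, i, hdet, ?_, ?_, hb3.trans hi⟩
  · rwa [← htr, trace_escMat hk.toIsNet]
  · rw [← htr2, trace_escMat_sq hk.toIsNet hA]
    exact hQ.trans hb2

lemma exists_pow_tolerance (N : ℕ) {e : ℝ} (he : 0 < e) :
    ∃ ε₀ > 0, ∀ ε : ℝ, 0 ≤ ε → ε ≤ ε₀ → (N : ℝ) * (1 + ε) ^ (N - 1) ≤ N + e ∧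
      (N : ℝ) - e ≤ N * (1 - ε) ^ (N - 1) := by
  have hF : Continuous fun x : ℝ => (N : ℝ) * (1 + x) ^ (N - 1) := by fun_prop
  obtain ⟨ρ, hρ, h⟩ := Metric.continuousAt_iff.1 (hF.continuousAt (x := 0)) e he
  refine ⟨ρ / 2, by positivity, fun ε h0 h1 => ?_⟩
  have h2 := @h ε (by rw [Real.dist_eq, sub_zero, abs_of_nonneg h0]; linarith)
  have h3 := @h (-ε) (by rw [Real.dist_eq, sub_zero, abs_neg, abs_of_nonneg h0]; linarith)
  simp only [Real.dist_eq, add_zero, one_pow, mul_one, ← sub_eq_add_neg] at h2 h3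
  constructor
  · linarith [(abs_lt.1 h2).2]
  · linarith [(abs_lt.1 h3).1]

/-- Asymptotics of the normalized escape determinant at good clusters. -/
theorem exists_good_det (N t : ℕ) {L : ℝ} (hL : 1 ≤ L) {δ : ℝ} (hδ : 0 < δ) :
    ∃ θ₀ > 0, ∀ θ : ℝ, 0 < θ → θ ≤ θ₀ → ∀ (V : Type) [Fintype V] [DecidableEq V]
      (k : V → V → ℝ) (o : V) (A B : Finset V) (Z : ℝ), A.Nonempty → A.card = N → B.card = t →
      IsGoodNet k o θ → IsGoodCluster k o θ L A B → (∀ a, (lapOff {a} k).det = Z) → 0 < Z →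
      |(escLap A B k).det / Z - ((N : ℝ) - t) * Real.exp (-(t : ℝ))| ≤ δ := by
  by_cases hNt : ¬ (t ≤ N ∧ 1 ≤ N)
  · refine ⟨1, one_pos, fun θ _ _ V _ _ k o A B Z hA hN ht _ h _ _ => absurd ⟨?_, ?_⟩ hNt⟩
    · rw [← hN, ← ht]
      exact Finset.card_le_card h.sub
    · rw [← hN]
      exact hA.card_pos
  obtain ⟨htN, hN1⟩ := not_not.1 hNt
  have hN1' : (1 : ℝ) ≤ N := by exact_mod_cast hN1
  obtain ⟨e₀, he₀, hspec⟩ : ∃ e₀ > 0, 1 ≤ t → ∀ e : ℝ, 0 ≤ e → e ≤ e₀ →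
      ∀ (V : Type) [Fintype V] (p : V → ℝ) (d : ℝ) (i : V),
      |∑ j, p j - (1 + (N : ℝ)⁻¹) * t| ≤ e → ∑ j, p j ^ 2 ≤ ((N : ℝ)⁻¹ * t) ^ 2 + e →
      (N : ℝ)⁻¹ * t - e ≤ p i → |d - N| ≤ e →
      |d * ∏ j, (1 - p j) - ((N : ℝ) - t) * Real.exp (-(t : ℝ))| ≤ δ := by
    by_cases ht : 1 ≤ t
    · obtain ⟨e₀, he₀, h⟩ := exists_spectral_tolerance ht htN hδ
      exact ⟨e₀, he₀, fun _ => h⟩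
    · exact ⟨1, one_pos, fun h => absurd h ht⟩
  obtain ⟨ε₁, hε₁, hpow⟩ := exists_pow_tolerance N (lt_min he₀ hδ)
  set ε := min (min (1 / 2) (N : ℝ)⁻¹) (min ε₁ (e₀ / (t + 25) ^ 2)) with hεdef
  have hε : 0 < ε := by positivity
  have hε2 : ε ≤ 1 / 2 := (min_le_left _ _).trans (min_le_left _ _)
  have hεN : ε ≤ (N : ℝ)⁻¹ := (min_le_left _ _).trans (min_le_right _ _)
  have hεε₁ : ε ≤ ε₁ := (min_le_right _ _).trans (min_le_left _ _)
  have hεe : (t + 25) ^ 2 * ε ≤ e₀ := by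
    have : ε ≤ e₀ / (t + 25) ^ 2 := (min_le_right _ _).trans (min_le_right _ _)
    rw [le_div_iff₀ (by positivity)] at this
    linarith
  have hL0 : 0 < L := by linarith
  have ht0 : (0 : ℝ) ≤ t := Nat.cast_nonneg t
  refine ⟨ε ^ 2 / (1000 * L * (9 * (N + 2) * (t + 1))), by positivity, ?_⟩
  intro θ hθ hθ₀ V _ _ k o A B Z hA hNA htB hk h hZ hZ0
  rw [le_div_iff₀ (by positivity)] at hθ₀
  have hP : 1 ≤ (9 * ((N : ℝ) + 2) * (t + 1)) := by nlinarith
  have hLθ : 0 < L * θ := by positivity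
  have hθε : 864 * L * θ ≤ ε ^ 2 := by
    have : L * θ * 1 ≤ L * θ * (9 * ((N : ℝ) + 2) * (t + 1)) := by gcongr
    nlinarith
  have hθε' : 9 * (((N : ℝ) + 2) * (t * θ)) ≤ ε := by
    have h1 : 1 * (θ * (9 * ((N : ℝ) + 2) * (t + 1))) ≤
        (1000 * L) * (θ * (9 * ((N : ℝ) + 2) * (t + 1))) := by
      gcongr
      linarith
    have h2 : 0 ≤ ((N : ℝ) + 2) * θ := by positivity
    nlinarith
  have hθ1 : θ ≤ 1 / 2 := by nlinarith
  have hclus : IsCluster k o (48 * L * θ) A := by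
    have := hk.isCluster hθ.le hθ1 (L := 4 * L) (by linarith) h.typ
      (fun x hx y hy => (h.dev x hx y hy).trans (by linarith))
    rwa [show 12 * (4 * L) * θ = 48 * L * θ by ring] at this
  obtain ⟨hd1, hd2⟩ := hk.abs_det_cluster_le hZ hZ0 (ε := ε) (by linarith) (by nlinarith) hε.le
    (by linarith) (by linarith) hA hclus
  obtain ⟨hp1, hp2⟩ := hpow ε hε.le hεε₁
  rw [hNA] at hd1 hd2
  have hmin1 := min_le_left e₀ δ
  have hmin2 := min_le_right e₀ δ
  rw [hk.det_escLap hA, mul_div_right_comm]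
  rcases Nat.eq_zero_or_pos t with rfl | ht
  · have hB : B = ∅ := Finset.card_eq_zero.1 htB
    have hM : escMat k A B = 0 := by
      ext x y
      simp [escMat, esc, hB]
    rw [hM, sub_zero, Matrix.det_one, mul_one]
    simp only [Nat.cast_zero, sub_zero, neg_zero, Real.exp_zero, mul_one]
    rw [abs_le]
    constructor <;> linarith
  · obtain ⟨p, i, hdet, h1, h2, h3⟩ := h.spectral hk hA (Finset.card_pos.1 (by omega)) hθ.le hθ1 hL
      hε.le (by linarith) (by rwa [hNA]) hθε (by rwa [hNA, htB])
    rw [hNA, htB] at h1 h2 h3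
    rw [hdet]
    refine hspec ht e₀ he₀.le le_rfl V p _ i (h1.trans hεe) (by linarith) (by linarith) ?_
    rw [abs_le]
    constructor <;> linarith

end GoodDet

/-! ### Good embeddings -/

section GoodMap

lemma parEdges_eq_of_adj {a b : V} {f g : V → V} (hf : IsPar a f) (hg : IsPar b g)
    (h : ∀ x y, ((x ≠ a ∧ f x = y) ∨ (y ≠ a ∧ f y = x)) ↔
      ((x ≠ b ∧ g x = y) ∨ (y ≠ b ∧ g y = x))) : parEdges a f = parEdges b g := by
  have h1 : SimpleGraph.fromEdgeSet (↑(parEdges a f) : Set (Sym2 V)) =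
      SimpleGraph.fromEdgeSet (↑(parEdges b g) : Set (Sym2 V)) := by
    ext x y
    rw [parEdges_adj hf, parEdges_adj hg, h]
  have h2 := congrArg SimpleGraph.edgeSet h1
  rw [parEdges_edgeSet hf, parEdges_edgeSet hg] at h2
  exact_mod_cast h2

/-- Products of symmetric weights along the edges of a tree do not depend on the root. -/
lemma prod_parent_reroot {ι : Type} [Fintype ι] [DecidableEq ι] {a b : ι} {f g : ι → ι}
    (hf : IsPar a f) (hg : IsPar b g)
    (h : ∀ x y, ((x ≠ a ∧ f x = y) ∨ (y ≠ a ∧ f y = x)) ↔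
      ((x ≠ b ∧ g x = y) ∨ (y ≠ b ∧ g y = x))) {K : ι → ι → ℝ} (hK : ∀ x y, K x y = K y x) :
    ∏ j ∈ univ.erase a, K (f j) j = ∏ j ∈ univ.erase b, K (g j) j := by
  have key : ∀ {a : ι} {f : ι → ι}, IsPar a f → ∏ j ∈ univ.erase a, K (f j) j =
      ∏ e ∈ parEdges a f, Sym2.lift ⟨K, hK⟩ e := by
    intro a f hf
    rw [parEdges, Finset.prod_image (parEdges_injOn hf)]
    exact Finset.prod_congr rfl fun j _ => by rw [Sym2.lift_mk, hK]
  rw [key hf, key hg, parEdges_eq_of_adj hf hg h]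

lemma sum_eq_sum_fiber {ι : Type} [Fintype ι] [DecidableEq ι] (i : ι) (F : (ι → V) → ℝ) :
    ∑ φ, F φ = ∑ z, ∑ φ ∈ univ.filter (fun φ : ι → V => φ i = z), F φ :=
  (Finset.sum_fiberwise univ (fun φ : ι → V => φ i) F).symm

/-- One-point marginals of a rooted tree sum with a symmetric kernel of constant row sums. -/
lemma treeSum_marginal {ι : Type} [Fintype ι] [DecidableEq ι] {H : SimpleGraph ι} (hH : H.IsTree)
    {w : ι} {q : ι → ι} (hq : IsPar w q)
    (hadj : ∀ x y, H.Adj x y ↔ (x ≠ w ∧ q x = y) ∨ (y ≠ w ∧ q y = x))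
    {K : V → V → ℝ} (hK : ∀ u v, K u v = K v u) {ρ : ℝ} (hρ : ∀ u, ∑ v, K u v = ρ) (f : V → ℝ)
    (i : ι) :
    ∑ φ : ι → V, f (φ i) * ∏ j ∈ univ.erase w, K (φ (q j)) (φ j) =
      (∑ v, f v) * ρ ^ (Fintype.card ι - 1) := by
  obtain ⟨p, hp, -, hadj'⟩ := exists_isPar_of_isTree hH i
  have h1 : ∀ φ : ι → V, ∏ j ∈ univ.erase w, K (φ (q j)) (φ j) =
      ∏ j ∈ univ.erase i, K (φ (p j)) (φ j) := fun φ =>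
    prod_parent_reroot hq hp (fun x y => (hadj x y).symm.trans (hadj' x y))
      (K := fun x y => K (φ x) (φ y)) fun x y => hK _ _
  rw [sum_eq_sum_fiber i, Finset.sum_mul]
  refine Finset.sum_congr rfl fun z _ => ?_
  have h2 := treeSum_eq hp (fun _ => K) (fun _ => ρ) (fun _ => hρ) z
  rw [Finset.prod_const, Finset.card_erase_of_mem (mem_univ i), Finset.card_univ] at h2
  rw [← h2, Finset.mul_sum]
  refine Finset.sum_congr rfl fun φ hφ => ?_
  rw [h1, (Finset.mem_filter.1 hφ).2]

/-- Collisions are rare in a rooted tree sum with a spread out kernel. -/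
lemma treeSum_collision_le {ι : Type} [Fintype ι] [DecidableEq ι] {H : SimpleGraph ι}
    (hH : H.IsTree) {w : ι} {q : ι → ι} (hq : IsPar w q)
    (hadj : ∀ x y, H.Adj x y ↔ (x ≠ w ∧ q x = y) ∨ (y ≠ w ∧ q y = x))
    {K : V → V → ℝ} (hK0 : ∀ u v, 0 ≤ K u v) (hK : ∀ u v, K u v = K v u) {ρ : ℝ} (hρ1 : 1 ≤ ρ)
    (hρ : ∀ u, ∑ v, K u v = ρ) {D : V → ℝ} (hD : ∀ u v, K u v ≤ D v) {i i' : ι} (hi : i ≠ i') :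
    ∑ φ : ι → V, (if φ i = φ i' then ∏ j ∈ univ.erase w, K (φ (q j)) (φ j) else 0) ≤
      (∑ v, D v) * ρ ^ (Fintype.card ι - 1) := by
  obtain ⟨p, hp, -, hadj'⟩ := exists_isPar_of_isTree hH i
  have h1 : ∀ φ : ι → V, ∏ j ∈ univ.erase w, K (φ (q j)) (φ j) =
      ∏ j ∈ univ.erase i, K (φ (p j)) (φ j) := fun φ =>
    prod_parent_reroot hq hp (fun x y => (hadj x y).symm.trans (hadj' x y))
      (K := fun x y => K (φ x) (φ y)) fun x y => hK _ _
  rw [sum_eq_sum_fiber i, Finset.sum_mul]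
  refine Finset.sum_le_sum fun z _ => ?_
  have hDz : 0 ≤ D z := (hK0 z z).trans (hD z z)
  have h2 := treeSum_le hp (fun j u v => if j = i' then (if v = z then K u v else 0) else K u v)
    (fun j u v => by
      split_ifs
      · exact hK0 u v
      · exact le_rfl
      · exact hK0 u v)
    (fun j => if j = i' then D z else ρ)
    (fun j u => by
      by_cases hj : j = i'
      · simpa [hj] using hD u z
      · simpa [hj] using (hρ u).le) z
  have hmem : i' ∈ univ.erase i := Finset.mem_erase.2 ⟨hi.symm, mem_univ _⟩
  refine (le_trans (Finset.sum_le_sum fun φ hφ => ?_) h2).trans ?_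
  · rw [h1]
    have hz := (Finset.mem_filter.1 hφ).2
    by_cases h : φ i = φ i'
    · rw [if_pos h]
      refine (Finset.prod_congr rfl fun j _ => ?_).le
      by_cases hj : j = i'
      · subst hj
        rw [if_pos rfl, if_pos (by rw [← h, hz])]
      · rw [if_neg hj]
    · rw [if_neg h]
      refine Finset.prod_nonneg fun j _ => ?_
      split_ifs
      · exact hK0 _ _
      · exact le_rfl
      · exact hK0 _ _
  · rw [← Finset.mul_prod_erase _ _ hmem, if_pos rfl]
    have h3 : ∏ j ∈ (univ.erase i).erase i', (if j = i' then D z else ρ) =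
        ρ ^ (Fintype.card ι - 1 - 1) := by
      rw [Finset.prod_congr rfl fun j hj => if_neg (Finset.mem_erase.1 hj).1, Finset.prod_const,
        Finset.card_erase_of_mem hmem, Finset.card_erase_of_mem (mem_univ i), Finset.card_univ]
    rw [h3]
    exact mul_le_mul_of_nonneg_left (pow_le_pow_right₀ hρ1 (Nat.sub_le _ _)) hDz

/-- An injective map along which all pairs are good, and good at the vertices of `S`. -/
structure GoodMap {ι : Type} (k : V → V → ℝ) (o : V) (θ : ℝ) (w : ι) (q : ι → ι) (S : Finset ι)
    (φ : ι → V) : Prop where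
  inj : Function.Injective φ
  good : ∀ s ∈ S, GoodV k o θ (φ s)
  edge : ∀ j, j ≠ w → GoodE k o θ (φ (q j)) (φ j)

lemma exists_isGoodCluster {m : ℕ} {w : Fin m} {q : Fin m → Fin m} (hq : IsPar w q)
    {S : Finset (Fin m)} (hw : w ∈ S) : ∃ L : ℝ, 1 ≤ L ∧ ∀ (V : Type) [Fintype V] [DecidableEq V]
      (k : V → V → ℝ) (o : V) (θ : ℝ) (φ : Fin m → V), IsNet k → 0 ≤ θ →
      GoodMap k o θ w q S φ → IsGoodCluster k o θ L (univ.image φ) (S.image φ) := by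
  obtain ⟨d, hd⟩ := hq.exists_depth
  set M := ∑ j, d j
  have hM : ∀ j, d j ≤ M := fun j => Finset.single_le_sum (fun _ _ => Nat.zero_le _) (mem_univ j)
  refine ⟨4 ^ (M + 1), one_le_pow₀ (by norm_num), fun V _ _ k o θ φ hk hθ h => ?_⟩
  have hchain : ∀ n j, d j = n → devE k o (φ w) (φ j) ≤ 4 ^ n * θ := by
    intro n
    induction n using Nat.strong_induction_on with
    | _ n ih =>
      intro j hj
      by_cases hjw : j = w
      · subst hjw
        rw [devE_self]
        positivity
      · have h1 := hd j hjw
        have h2 := ih (d (q j)) (hj ▸ h1) (q j) rfl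
        have h3 := hk.devE_triangle o (φ w) (φ (q j)) (φ j)
        have h4 := (h.edge j hjw).2.2
        have h5 : (4 : ℝ) ^ (d (q j)) * 4 ≤ 4 ^ n := by
          rw [← pow_succ]
          exact pow_le_pow_right₀ (by norm_num) (by omega)
        have h6 : (1 : ℝ) ≤ 4 ^ (d (q j)) := one_le_pow₀ (by norm_num)
        nlinarith
  refine ⟨Finset.image_subset_image (Finset.subset_univ S), ?_, ?_, ?_⟩
  · intro s hs
    obtain ⟨i, hi, rfl⟩ := Finset.mem_image.1 hs
    exact h.good i hi
  · intro x hx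
    obtain ⟨i, -, rfl⟩ := Finset.mem_image.1 hx
    by_cases hiw : i = w
    · subst hiw
      exact (h.good _ hw).1
    · exact (h.edge i hiw).2.1
  · intro x hx y hy
    obtain ⟨i, -, rfl⟩ := Finset.mem_image.1 hx
    obtain ⟨j, -, rfl⟩ := Finset.mem_image.1 hy
    have hb : ∀ i, devE k o (φ w) (φ i) ≤ 4 ^ M * θ := fun i =>
      (hchain _ i rfl).trans (mul_le_mul_of_nonneg_right
        (pow_le_pow_right₀ (by norm_num) (hM i)) hθ)
    have h1 := hk.devE_triangle o (φ i) (φ w) (φ j)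
    rw [devE_comm o (φ i) (φ w)] at h1
    have h2 := hb i
    have h3 := hb j
    rw [pow_succ]
    linarith

end GoodMap

/-! ### The number of good maps -/

section GoodMapSum

variable {k : V → V → ℝ} {o : V} {θ : ℝ}

instance {ι : Type} (k : V → V → ℝ) (o : V) (θ : ℝ) (w : ι) (q : ι → ι) (S : Finset ι)
    (φ : ι → V) : Decidable (GoodMap k o θ w q S φ) := Classical.dec _

lemma GoodE.tot_left_le {x y : V} (h : GoodE k o θ x y) : tot k x ≤ 1 + θ := by
  linarith [(abs_le.1 h.1).2]

lemma IsGoodNet.sum_goodMap_le (hk : IsGoodNet k o θ) (hθ : 0 ≤ θ) {m : ℕ} {w : Fin m}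
    {q : Fin m → Fin m} (hq : IsPar w q) (S : Finset (Fin m)) :
    ∑ φ : Fin m → V, (if GoodMap k o θ w q S φ then
      ∏ j ∈ univ.erase w, k (φ j) (φ (q j)) else 0) ≤ (1 + θ) ^ (m - 1) * Fintype.card V := by
  set K : V → V → ℝ := fun u v => if tot k u ≤ 1 + θ then k u v else 0 with hKdef
  have hK0 : ∀ u v, 0 ≤ K u v := by
    intro u v
    simp only [hKdef]
    split_ifs
    · exact hk.nonneg u v
    · exact le_rfl
  have hK : ∀ u, ∑ v, K u v ≤ 1 + θ := by
    intro u
    by_cases h : tot k u ≤ 1 + θ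
    · simp only [hKdef, h, if_true]
      exact h
    · simp only [hKdef, h, if_false, Finset.sum_const_zero]
      linarith
  rw [sum_eq_sum_fiber w, mul_comm, ← nsmul_eq_mul]
  refine Finset.sum_le_card_nsmul _ _ _ fun z _ => ?_
  have h := treeSum_le hq (fun _ => K) (fun _ => hK0) (fun _ => 1 + θ) (fun _ => hK) z
  rw [Finset.prod_const, Finset.card_erase_of_mem (mem_univ w), Finset.card_univ,
    Fintype.card_fin] at h
  refine (Finset.sum_le_sum fun φ _ => ?_).trans h
  split_ifs with hφ
  · refine (Finset.prod_congr rfl fun j hj => ?_).le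
    have hj' := hφ.edge j (Finset.mem_erase.1 hj).1
    simp only [hKdef]
    rw [if_pos hj'.tot_left_le, hk.symm]
  · exact Finset.prod_nonneg fun j _ => hK0 _ _

/-- The weight restricted to good pairs of good vertices. -/
def goodKer (k : V → V → ℝ) (o : V) (θ : ℝ) (u v : V) : ℝ :=
  if GoodE k o θ u v ∧ GoodV k o θ u ∧ GoodV k o θ v then k u v else 0

lemma IsNet.goodKer_nonneg (hk : IsNet k) (u v : V) : 0 ≤ goodKer k o θ u v := by
  rw [goodKer]
  split_ifs
  · exact hk.nonneg u v
  · exact le_rfl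

lemma IsNet.goodKer_comm (hk : IsNet k) (u v : V) : goodKer k o θ u v = goodKer k o θ v u := by
  have h : (GoodE k o θ u v ∧ GoodV k o θ u ∧ GoodV k o θ v) ↔
      (GoodE k o θ v u ∧ GoodV k o θ v ∧ GoodV k o θ u) :=
    ⟨fun h => ⟨h.1.symm, h.2.2, h.2.1⟩, fun h => ⟨h.1.symm, h.2.2, h.2.1⟩⟩
  rw [goodKer, goodKer, hk.symm u v]
  simp only [h]

lemma IsNet.goodKer_le (hk : IsNet k) (u v : V) : goodKer k o θ u v ≤ k u v := by
  rw [goodKer]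
  split_ifs
  · exact le_rfl
  · exact hk.nonneg u v

lemma IsNet.tot_goodKer_le (hk : IsNet k) (hθ : 0 ≤ θ) (u : V) :
    ∑ v, goodKer k o θ u v ≤ 1 + θ := by
  by_cases h : GoodV k o θ u
  · have h1 := (abs_le.1 h.1).2
    have h2 : ∑ v, goodKer k o θ u v ≤ tot k u := Finset.sum_le_sum fun v _ => hk.goodKer_le u v
    linarith
  · rw [Finset.sum_eq_zero fun v _ => by simp [goodKer, h]]
    linarith

lemma IsGoodNet.sum_bad_tot_le (hk : IsGoodNet k o θ) (hθ1 : θ ≤ 1 / 2) :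
    ∑ x, (if GoodV k o θ x then 0 else tot k x) ≤ 5 / 2 * θ * Fintype.card V := by
  have h : ∀ x, (if GoodV k o θ x then 0 else tot k x) ≤
      (if |tot k x - 1| ≤ θ then 0 else tot k x) +
        3 / 2 * (if ¬ GoodV k o θ x then 1 else 0) := by
    intro x
    have h0 := hk.tot_nonneg x
    by_cases h1 : GoodV k o θ x
    · simp [h1, h1.1]
    · by_cases h2 : |tot k x - 1| ≤ θ
      · have := (abs_le.1 h2).2
        simp only [h1, h2, if_true, if_false, not_false_eq_true]
        linarith
      · simp only [h1, h2, if_false, not_false_eq_true, if_true]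
        linarith
  refine (Finset.sum_le_sum fun x _ => h x).trans ?_
  rw [Finset.sum_add_distrib, ← Finset.mul_sum, Finset.sum_boole]
  linarith [hk.sum_le, hk.bad_card]

lemma IsGoodNet.le_sum_goodKer (hk : IsGoodNet k o θ) (hθ1 : θ ≤ 1 / 2) :
    (1 - 7 * θ) * Fintype.card V ≤ ∑ u, ∑ v, goodKer k o θ u v := by
  have h : ∀ x y, k x y ≤ goodKer k o θ x y + (if GoodE k o θ x y then 0 else k x y) +
      (if GoodV k o θ x then 0 else k x y) + (if GoodV k o θ y then 0 else k y x) := by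
    intro x y
    have h0 := hk.nonneg x y
    rw [hk.symm y x, goodKer]
    by_cases h1 : GoodE k o θ x y <;> by_cases h2 : GoodV k o θ x <;>
      by_cases h3 : GoodV k o θ y <;> simp [h1, h2, h3] <;> linarith
  have h1 := Finset.sum_le_sum fun x (_ : x ∈ univ) =>
    Finset.sum_le_sum fun y (_ : y ∈ univ) => h x y
  simp only [Finset.sum_add_distrib] at h1
  rw [Finset.sum_comm (f := fun x y => if GoodV k o θ y then 0 else k y x)] at h1
  have h2 : ∀ x, (∑ y, if GoodV k o θ x then 0 else k x y) =
      if GoodV k o θ x then 0 else tot k x := by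
    intro x
    split_ifs
    · simp
    · rfl
  simp only [h2] at h1
  have h3 := hk.sum_bad_tot_le hθ1
  have h4 := hk.sum_ge
  have h5 := hk.bad_cond
  simp only [tot] at h4 h3 h1
  linarith

lemma IsGoodNet.le_sum_goodMap (hk : IsGoodNet k o θ) (hθ : 0 ≤ θ) (hθ1 : θ ≤ 1 / 2) {m : ℕ}
    (hmθ : 10 * (m : ℝ) ^ 2 * θ ≤ 1)
    {H : SimpleGraph (Fin m)} (hH : H.IsTree) {w : Fin m} {q : Fin m → Fin m} (hq : IsPar w q)
    (hadj : ∀ x y, H.Adj x y ↔ (x ≠ w ∧ q x = y) ∨ (y ≠ w ∧ q y = x)) (S : Finset (Fin m)) :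
    (1 - 10 * (m : ℝ) ^ 2 * θ) * Fintype.card V ≤
      ∑ φ : Fin m → V, (if GoodMap k o θ w q S φ then
        ∏ j ∈ univ.erase w, k (φ j) (φ (q j)) else 0) := by
  set R : V → ℝ := fun u => 1 + θ - ∑ v, goodKer k o θ u v with hR
  have hR0 : ∀ u, 0 ≤ R u := fun u => sub_nonneg.2 (hk.tot_goodKer_le hθ u)
  set K : V → V → ℝ := fun u v => goodKer k o θ u v + if v = u then R u else 0 with hKdef
  have hK0 : ∀ u v, 0 ≤ K u v := by
    intro u v
    have h1 := hk.goodKer_nonneg (o := o) (θ := θ) u v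
    have h2 := hR0 u
    simp only [hKdef]
    split_ifs <;> linarith
  have hKs : ∀ u v, K u v = K v u := by
    intro u v
    simp only [hKdef]
    rw [hk.goodKer_comm]
    by_cases h : u = v
    · rw [h]
    · rw [if_neg h, if_neg (Ne.symm h)]
  have hKρ : ∀ u, ∑ v, K u v = 1 + θ := by
    intro u
    simp only [hKdef, Finset.sum_add_distrib, Finset.sum_ite_eq', mem_univ, if_true, hR]
    ring
  have hKD : ∀ u v, K u v ≤ θ + R v := by
    intro u v
    have h1 := (hk.goodKer_le (o := o) (θ := θ) u v).trans (hk.edge u v)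
    simp only [hKdef]
    by_cases h : v = u
    · rw [if_pos h, h]
      rw [h] at h1
      linarith
    · rw [if_neg h]
      linarith [hR0 v]
  have hDsum : ∑ v, (θ + R v) ≤ 9 * θ * Fintype.card V := by
    simp only [hR, Finset.sum_add_distrib, Finset.sum_sub_distrib, Finset.sum_const,
      Finset.card_univ, nsmul_eq_mul]
    have := hk.le_sum_goodKer hθ1
    linarith
  set P : (Fin m → V) → ℝ := fun φ => ∏ j ∈ univ.erase w, K (φ (q j)) (φ j) with hP
  have hP0 : ∀ φ, 0 ≤ P φ := fun φ => Finset.prod_nonneg fun j _ => hK0 _ _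
  set F : (Fin m → V) → ℝ := fun φ => if GoodMap k o θ w q S φ then
    ∏ j ∈ univ.erase w, k (φ j) (φ (q j)) else 0 with hF
  have hF0 : ∀ φ, 0 ≤ F φ := by
    intro φ
    simp only [hF]
    split_ifs
    · exact Finset.prod_nonneg fun j _ => hk.nonneg _ _
    · exact le_rfl
  have hpt : ∀ φ, P φ ≤ F φ + ∑ i, (if ¬ GoodV k o θ (φ i) then 1 else 0) * P φ +
      ∑ x ∈ (univ : Finset (Fin m)).offDiag, if φ x.1 = φ x.2 then P φ else 0 := by
    intro φ
    have ha : ∀ i, 0 ≤ (if ¬ GoodV k o θ (φ i) then (1 : ℝ) else 0) * P φ := by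
      intro i
      have := hP0 φ
      split_ifs <;> simp [this]
    have hb : ∀ x : Fin m × Fin m, 0 ≤ if φ x.1 = φ x.2 then P φ else 0 := by
      intro x
      have := hP0 φ
      split_ifs
      · exact this
      · exact le_rfl
    have ha' := Finset.sum_nonneg fun i (_ : i ∈ univ) => ha i
    have hb' := Finset.sum_nonneg fun x (_ : x ∈ (univ : Finset (Fin m)).offDiag) => hb x
    have hf' := hF0 φ
    by_cases h1 : ∀ i, GoodV k o θ (φ i)
    · by_cases h2 : Function.Injective φ
      · by_cases h3 : ∀ j, j ≠ w → GoodE k o θ (φ (q j)) (φ j)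
        · have : P φ = F φ := by
            simp only [hF]
            rw [if_pos ⟨h2, fun s _ => h1 s, h3⟩]
            refine Finset.prod_congr rfl fun j hj => ?_
            have hj' := (Finset.mem_erase.1 hj).1
            have hne : φ j ≠ φ (q j) := fun h => hq.apply_ne hj' (h2 h).symm
            simp only [hKdef]
            rw [if_neg hne, add_zero, goodKer, if_pos ⟨h3 j hj', h1 _, h1 _⟩, hk.symm]
          linarith
        · push Not at h3
          obtain ⟨j, hj, hj3⟩ := h3
          have : P φ = 0 := by
            refine Finset.prod_eq_zero (Finset.mem_erase.2 ⟨hj, mem_univ j⟩) ?_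
            have hne : φ j ≠ φ (q j) := fun h => hq.apply_ne hj (h2 h).symm
            simp only [hKdef]
            rw [if_neg hne, add_zero, goodKer, if_neg fun h => hj3 h.1]
          linarith
      · rw [Function.Injective] at h2
        push Not at h2
        obtain ⟨i, j, hij, hne⟩ := h2
        have := Finset.single_le_sum (fun x (_ : x ∈ (univ : Finset (Fin m)).offDiag) => hb x)
          (show (i, j) ∈ (univ : Finset (Fin m)).offDiag by simpa using hne)
        simp only [hij, if_true] at this
        linarith
    · push Not at h1
      obtain ⟨i, hi⟩ := h1
      have := Finset.single_le_sum (fun i (_ : i ∈ univ) => ha i) (mem_univ i)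
      simp only [hi, not_false_eq_true, if_true, one_mul] at this
      linarith
  have hsum := Finset.sum_le_sum fun φ (_ : φ ∈ univ) => hpt φ
  simp only [Finset.sum_add_distrib] at hsum
  rw [Finset.sum_comm, Finset.sum_comm (t := (univ : Finset (Fin m)).offDiag)] at hsum
  have hn : (0 : ℝ) ≤ Fintype.card V := Nat.cast_nonneg _
  have hρ1 : (1 : ℝ) ≤ 1 + θ := by linarith
  have hρ : (1 : ℝ) ≤ (1 + θ) ^ (m - 1) := one_le_pow₀ hρ1
  have hm : (1 : ℝ) ≤ m := by exact_mod_cast Nat.one_le_of_lt w.2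
  have hA : ∑ φ, P φ = Fintype.card V * (1 + θ) ^ (m - 1) := by
    have := treeSum_marginal hH hq hadj hKs hKρ (fun _ => 1) w
    simpa [hP] using this
  have hB : ∑ i : Fin m, ∑ φ : Fin m → V, (if ¬ GoodV k o θ (φ i) then 1 else 0) * P φ ≤
      m * (θ * Fintype.card V * (1 + θ) ^ (m - 1)) := by
    have h1 := Finset.sum_le_card_nsmul univ
      (fun i : Fin m => ∑ φ : Fin m → V, (if ¬ GoodV k o θ (φ i) then 1 else 0) * P φ)
      (θ * Fintype.card V * (1 + θ) ^ (m - 1)) fun i _ => by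
        have := treeSum_marginal hH hq hadj hKs hKρ (fun v => if ¬ GoodV k o θ v then 1 else 0) i
        simp only [Fintype.card_fin] at this
        simp only [hP]
        rw [this, Finset.sum_boole]
        exact mul_le_mul_of_nonneg_right hk.bad_card (by linarith)
    simpa using h1
  have hC : ∑ x ∈ (univ : Finset (Fin m)).offDiag, ∑ φ : Fin m → V,
      (if φ x.1 = φ x.2 then P φ else 0) ≤
      (m ^ 2 - m) * (9 * θ * Fintype.card V * (1 + θ) ^ (m - 1)) := by
    have h1 := Finset.sum_le_card_nsmul (univ : Finset (Fin m)).offDiag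
      (fun x => ∑ φ : Fin m → V, if φ x.1 = φ x.2 then P φ else 0)
      (9 * θ * Fintype.card V * (1 + θ) ^ (m - 1)) fun x hx => by
        have := treeSum_collision_le hH hq hadj hK0 hKs hρ1 hKρ hKD (Finset.mem_offDiag.1 hx).2.2
        rw [Fintype.card_fin] at this
        exact this.trans (mul_le_mul_of_nonneg_right hDsum (by linarith))
    rw [Finset.offDiag_card, nsmul_eq_mul, Nat.cast_sub (Nat.le_mul_self _)] at h1
    simpa [sq] using h1
  rw [hA] at hsum
  have hθn : 0 ≤ θ * (Fintype.card V * (1 + θ) ^ (m - 1)) := by positivity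
  have hmm : (m : ℝ) ≤ m ^ 2 := by nlinarith
  have hfin : (1 - 10 * (m : ℝ) ^ 2 * θ) * (Fintype.card V * (1 + θ) ^ (m - 1)) ≤ ∑ φ, F φ := by
    have h1 : (m : ℝ) * (θ * (Fintype.card V * (1 + θ) ^ (m - 1))) ≤
        m ^ 2 * (θ * (Fintype.card V * (1 + θ) ^ (m - 1))) :=
      mul_le_mul_of_nonneg_right hmm hθn
    have h2 : 0 ≤ (m : ℝ) * (θ * (Fintype.card V * (1 + θ) ^ (m - 1))) := by positivity
    linarith
  refine le_trans (mul_le_mul_of_nonneg_left ?_ (by linarith)) hfin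
  exact le_mul_of_one_le_right hn hρ

lemma exists_sum_goodMap {m : ℕ} {H : SimpleGraph (Fin m)} (hH : H.IsTree) {w : Fin m}
    {q : Fin m → Fin m} (hq : IsPar w q)
    (hadj : ∀ x y, H.Adj x y ↔ (x ≠ w ∧ q x = y) ∨ (y ≠ w ∧ q y = x)) (S : Finset (Fin m))
    {δ : ℝ} (hδ : 0 < δ) : ∃ θ₀ > 0, ∀ θ : ℝ, 0 ≤ θ → θ ≤ θ₀ → ∀ (V : Type) [Fintype V]
      [DecidableEq V] (k : V → V → ℝ) (o : V), IsGoodNet k o θ →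
      |∑ φ : Fin m → V, (if GoodMap k o θ w q S φ then
        ∏ j ∈ univ.erase w, k (φ j) (φ (q j)) else 0) - Fintype.card V| ≤ δ * Fintype.card V := by
  have hm : (1 : ℝ) ≤ m := by exact_mod_cast Nat.one_le_of_lt w.2
  obtain ⟨ε₀, hε₀, hpow⟩ := exists_pow_tolerance m hδ
  refine ⟨min (min ε₀ (1 / 2)) (min δ 1 / (10 * m ^ 2)), by positivity, ?_⟩
  intro θ hθ hθ₀ V _ _ k o hk
  have h1 : θ ≤ ε₀ := hθ₀.trans ((min_le_left _ _).trans (min_le_left _ _))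
  have h2 : θ ≤ 1 / 2 := hθ₀.trans ((min_le_left _ _).trans (min_le_right _ _))
  have h3 : θ ≤ min δ 1 / (10 * m ^ 2) := hθ₀.trans (min_le_right _ _)
  rw [le_div_iff₀ (by positivity)] at h3
  have h4 := h3.trans (min_le_left _ _)
  have h5 := h3.trans (min_le_right _ _)
  have hn : (0 : ℝ) ≤ Fintype.card V := Nat.cast_nonneg _
  have hup := hk.sum_goodMap_le hθ hq S
  have hlo := hk.le_sum_goodMap hθ h2 (by linarith) hH hq hadj S
  have h6 : (1 + θ) ^ (m - 1) ≤ 1 + δ := by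
    have h7 := (hpow θ hθ h1).1
    have h8 : (1 : ℝ) ≤ (1 + θ) ^ (m - 1) := one_le_pow₀ (by linarith)
    nlinarith
  have h7 := mul_le_mul_of_nonneg_right h6 hn
  have h8 : (1 - δ) * Fintype.card V ≤ (1 - 10 * (m : ℝ) ^ 2 * θ) * Fintype.card V :=
    mul_le_mul_of_nonneg_right (by linarith) hn
  rw [abs_le]
  constructor <;> linarith

end GoodMapSum

/-! ### Ball probabilities in good networks -/

section BallProb

variable {θ : ℝ} {o : V} {G : SimpleGraph V} [DecidableRel G.Adj] {c : Sym2 V → ℝ}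

lemma treeWeight_nonneg (hc : ∀ e ∈ G.edgeSet, 0 < c e) {T : Finset (Sym2 V)}
    (hT : T ∈ spanningTrees G) : 0 ≤ treeWeight c T := by
  refine Finset.prod_nonneg fun e he => (hc e ?_).le
  simp only [spanningTrees, Finset.mem_filter] at hT
  exact hT.2.1 he

lemma embWeight_nonneg (hc : ∀ e ∈ G.edgeSet, 0 < c e) {m : ℕ} (H : SimpleGraph (Fin m))
    (S : Finset (Fin m)) (φ : Fin m → V) : 0 ≤ embWeight G c H S φ := by
  refine Finset.sum_nonneg fun T hT => mul_nonneg (treeWeight_nonneg hc hT) ?_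
  split_ifs
  · exact zero_le_one
  · exact le_rfl

open scoped Classical in
lemma sum_trees_adj_pairs_le (hG : G.Connected) (hc : ∀ e ∈ G.edgeSet, 0 < c e) (o : V)
    (E : V → V → Prop) :
    ∑ T ∈ spanningTrees G, treeWeight c T * ((univ.filter fun x : V × V =>
        (SimpleGraph.fromEdgeSet (↑T : Set (Sym2 V))).Adj x.1 x.2 ∧ E x.1 x.2).card : ℝ) =
      (∑ x, ∑ y, if E x y then kern G c x y * res (kern G c) o x y else 0) * partZ G c := by
  have hk := isNet_kern hG hc
  have h1 : ∀ T : Finset (Sym2 V), treeWeight c T * ((univ.filter fun x : V × V =>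
        (SimpleGraph.fromEdgeSet (↑T : Set (Sym2 V))).Adj x.1 x.2 ∧ E x.1 x.2).card : ℝ) =
      ∑ x : V × V, treeWeight c T * if (s(x.1, x.2) ∈ T ∧ x.1 ≠ x.2) ∧ E x.1 x.2 then 1 else 0 := by
    intro T
    rw [← Finset.mul_sum, Finset.sum_boole]
    simp only [SimpleGraph.fromEdgeSet_adj, Finset.mem_coe]
  simp only [h1]
  rw [Finset.sum_comm, ← Finset.univ_product_univ, Finset.sum_product, Finset.sum_mul]
  refine Finset.sum_congr rfl fun x _ => ?_
  rw [Finset.sum_mul]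
  refine Finset.sum_congr rfl fun y _ => ?_
  by_cases hE : E x y
  · by_cases hxy : x = y
    · subst hxy
      simp [res_self]
    · rw [if_pos hE, partZ_eq_det G c y, mul_assoc, mul_comm (res _ _ _ _),
        ← hk.res_mul_det o hxy, ← sum_trees_edge G c hxy]
      simp only [hE, hxy, ne_eq, not_false_eq_true, and_true]
  · simp [hE]

open scoped Classical in
lemma sum_embWeight_bad_le (hG : G.Connected) (hc : ∀ e ∈ G.edgeSet, 0 < c e)
    (hk : IsGoodNet (kern G c) o θ) {r m : ℕ} {H : SimpleGraph (Fin m)} {w : Fin m}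
    (hH : H.IsTree) (hr : ∀ i, H.dist w i ≤ r) {q : Fin m → Fin m} (hq : IsPar w q)
    (hadj : ∀ x y, H.Adj x y ↔ (x ≠ w ∧ q x = y) ∨ (y ≠ w ∧ q y = x)) :
    ∑ φ : Fin m → V, (if GoodMap (kern G c) o θ w q (innerSet H w r) φ then 0 else
        embWeight G c H (innerSet H w r) φ) ≤
      m ^ (m + 1) * (2 * θ * Fintype.card V) * partZ G c := by
  set S := innerSet H w r with hS
  set B := univ.filter fun x => ¬ GoodV (kern G c) o θ x with hB
  obtain ⟨E, hE⟩ : ∃ E : V → V → Prop, ∀ x y, E x y ↔ ¬ GoodE (kern G c) o θ x y :=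
    ⟨_, fun _ _ => Iff.rfl⟩
  have h1 : ∀ φ : Fin m → V, (if GoodMap (kern G c) o θ w q S φ then 0 else
      embWeight G c H S φ) ≤ ∑ T ∈ spanningTrees G, treeWeight c T *
        (if IsEmb H S φ (SimpleGraph.fromEdgeSet (↑T : Set (Sym2 V))) ∧
          ((∃ s ∈ S, φ s ∈ B) ∨ ∃ j, j ≠ w ∧ E (φ (q j)) (φ j)) then 1 else 0) := by
    intro φ
    have h0 : ∀ T ∈ spanningTrees G, 0 ≤ treeWeight c T *
        (if IsEmb H S φ (SimpleGraph.fromEdgeSet (↑T : Set (Sym2 V))) ∧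
          ((∃ s ∈ S, φ s ∈ B) ∨ ∃ j, j ≠ w ∧ E (φ (q j)) (φ j)) then (1 : ℝ) else 0) :=
      fun T hT => mul_nonneg (treeWeight_nonneg hc hT) (by split_ifs <;> norm_num)
    by_cases hφ : GoodMap (kern G c) o θ w q S φ
    · rw [if_pos hφ]
      exact Finset.sum_nonneg h0
    · rw [if_neg hφ]
      refine Finset.sum_le_sum fun T hT => ?_
      by_cases he : IsEmb H S φ (SimpleGraph.fromEdgeSet (↑T : Set (Sym2 V)))
      · rw [if_pos he, if_pos]
        refine ⟨he, ?_⟩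
        by_contra hcon
        push Not at hcon
        refine hφ ⟨he.1, fun s hs => ?_, fun j hj => ?_⟩
        · by_contra hs'
          exact hcon.1 s hs (Finset.mem_filter.2 ⟨mem_univ _, hs'⟩)
        · exact not_not.1 fun h => hcon.2 j hj ((hE _ _).2 h)
      · rw [if_neg he, mul_zero]
        exact h0 T hT
  refine (Finset.sum_le_sum fun φ _ => h1 φ).trans ?_
  rw [Finset.sum_comm]
  have h2 : ∀ T ∈ spanningTrees G, ∑ φ : Fin m → V, treeWeight c T *
        (if IsEmb H S φ (SimpleGraph.fromEdgeSet (↑T : Set (Sym2 V))) ∧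
          ((∃ s ∈ S, φ s ∈ B) ∨ ∃ j, j ≠ w ∧ E (φ (q j)) (φ j)) then (1 : ℝ) else 0) ≤
      m ^ (m + 1) * (B.card * treeWeight c T + treeWeight c T * ((univ.filter fun x : V × V =>
        (SimpleGraph.fromEdgeSet (↑T : Set (Sym2 V))).Adj x.1 x.2 ∧ E x.1 x.2).card : ℝ)) := by
    intro T hT
    have h3 := card_isEmb_bad_le hH hr hq hadj (SimpleGraph.fromEdgeSet (↑T : Set (Sym2 V))) B E
    rw [← Finset.mul_sum, Finset.sum_boole]
    have h3' := mul_le_mul_of_nonneg_left (Nat.cast_le (α := ℝ).2 h3) (treeWeight_nonneg hc hT)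
    push_cast at h3'
    refine le_trans (le_of_eq ?_) (h3'.trans (le_of_eq ?_))
    · congr
    · rw [mul_left_comm, mul_add, mul_comm (B.card : ℝ)]
      congr
  refine (Finset.sum_le_sum h2).trans ?_
  rw [← Finset.mul_sum, Finset.sum_add_distrib, ← Finset.mul_sum,
    sum_trees_adj_pairs_le hG hc o E, mul_assoc]
  refine mul_le_mul_of_nonneg_left ?_ (by positivity)
  have hZ := (partZ_pos hG hc).le
  have h3 := hk.bad_card
  have h4 := hk.bad_res
  have h5 : ∑ x, ∑ y, (if E x y then kern G c x y * res (kern G c) o x y else 0) =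
      ∑ x, ∑ y, (if GoodE (kern G c) o θ x y then 0 else
        kern G c x y * res (kern G c) o x y) := by
    refine Finset.sum_congr rfl fun x _ => Finset.sum_congr rfl fun y _ => ?_
    simp only [hE, ite_not]
  rw [h5, ← partZ, ← add_mul]
  exact mul_le_mul_of_nonneg_right (by linarith) hZ

/-- Ball probabilities in good networks are close to the limiting ones, at positive radius. -/
theorem exists_ballProb_close {r m : ℕ} (hr0 : 0 < r) {H : SimpleGraph (Fin m)} {w : Fin m}
    (hH : H.IsTree) (hr : ∀ i, H.dist w i ≤ r) {δ : ℝ} (hδ : 0 < δ) :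
    ∃ θ : ℝ, 0 < θ ∧ θ ≤ 1 / 2 ∧ ∀ (V : Type) [Fintype V] [DecidableEq V] (G : SimpleGraph V)
      [DecidableRel G.Adj] (c : Sym2 V → ℝ) (o : V), G.Connected → (∀ e ∈ G.edgeSet, 0 < c e) →
      IsGoodNet (kern G c) o θ → |wstBallProb G c r H w - pgwBallProb r H w| ≤ δ := by
  obtain ⟨q, hq, -, hadj⟩ := exists_isPar_of_isTree hH w
  set S := innerSet H w r with hS
  have hwS : w ∈ S := by simpa [hS, innerSet] using hr0
  obtain ⟨L, hL, hcl⟩ := exists_isGoodCluster hq hwS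
  set ℓ : ℝ := ((m : ℝ) - S.card) * Real.exp (-(S.card : ℝ)) with hℓ
  have hSm : (S.card : ℝ) ≤ m := by
    have := S.card_le_univ
    rw [Fintype.card_fin] at this
    exact_mod_cast this
  have hℓ0 : 0 ≤ ℓ := mul_nonneg (by linarith) (Real.exp_pos _).le
  obtain ⟨θ₁, hθ₁, h1⟩ := exists_good_det m S.card hL (show 0 < δ / 8 by positivity)
  obtain ⟨θ₂, hθ₂, h2⟩ := exists_sum_goodMap hH hq hadj S
    (show 0 < min 1 (δ / (4 * (ℓ + 1))) by positivity)
  have hm : 0 < (m : ℝ) := by exact_mod_cast Fin.pos w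
  refine ⟨min (min θ₁ θ₂) (min (1 / 2) (δ / (8 * m ^ (m + 1)))), by positivity,
    (min_le_right _ _).trans (min_le_left _ _), ?_⟩
  intro V _ _ G _ c o hG hc hk
  set θ := min (min θ₁ θ₂) (min (1 / 2) (δ / (8 * m ^ (m + 1)))) with hθdef
  have hθ0 : 0 < θ := by positivity
  have hθa : θ ≤ θ₁ := (min_le_left _ _).trans (min_le_left _ _)
  have hθb : θ ≤ θ₂ := (min_le_left _ _).trans (min_le_right _ _)
  have hθc : θ ≤ δ / (8 * m ^ (m + 1)) := (min_le_right _ _).trans (min_le_right _ _)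
  rw [le_div_iff₀ (by positivity)] at hθc
  have hZ := partZ_pos hG hc
  have hn : (0 : ℝ) < Fintype.card V := by exact_mod_cast Fintype.card_pos_iff.2 ⟨o⟩
  set n : ℝ := ((Fintype.card V : ℕ) : ℝ) with hndef
  set Z := partZ G c with hZdef
  set P : (Fin m → V) → ℝ := fun φ => if GoodMap (kern G c) o θ w q S φ then
    ∏ j ∈ univ.erase w, kern G c (φ j) (φ (q j)) else 0 with hP
  have hP0 : ∀ φ, 0 ≤ P φ := by
    intro φ
    simp only [hP]
    split_ifs
    · exact Finset.prod_nonneg fun j _ => hk.nonneg _ _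
    · exact le_rfl
  have hPs := h2 θ hθ0.le hθb V (kern G c) o hk
  have hPa : |∑ φ, P φ - n| ≤ n := hPs.trans (by
    have := mul_le_mul_of_nonneg_right (min_le_left 1 (δ / (4 * (ℓ + 1)))) hn.le
    linarith)
  have hPb : ℓ * |∑ φ, P φ - n| ≤ δ / 4 * n := by
    have h3 : ℓ * (δ / (4 * (ℓ + 1))) ≤ δ / 4 := by
      rw [← mul_div_assoc, div_le_div_iff₀ (by positivity) (by positivity)]
      nlinarith
    calc ℓ * |∑ φ, P φ - n| ≤ ℓ * (δ / (4 * (ℓ + 1)) * n) := by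
          refine mul_le_mul_of_nonneg_left (hPs.trans ?_) hℓ0
          exact mul_le_mul_of_nonneg_right (min_le_right _ _) hn.le
      _ = ℓ * (δ / (4 * (ℓ + 1))) * n := by ring
      _ ≤ δ / 4 * n := mul_le_mul_of_nonneg_right h3 hn.le
  set Q : (Fin m → V) → ℝ := fun φ => if GoodMap (kern G c) o θ w q S φ then 0 else
    embWeight G c H S φ with hQ
  have hQ0 : 0 ≤ ∑ φ, Q φ := Finset.sum_nonneg fun φ _ => by
    simp only [hQ]
    split_ifs
    · exact le_rfl
    · exact embWeight_nonneg hc H S φ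
  have hQ1 : (∑ φ, Q φ) / Z ≤ δ / 4 * n := by
    rw [div_le_iff₀ hZ]
    refine (sum_embWeight_bad_le hG hc hk hH hr hq hadj).trans ?_
    refine mul_le_mul_of_nonneg_right ?_ hZ.le
    calc (m : ℝ) ^ (m + 1) * (2 * θ * n) = 1 / 4 * (θ * (8 * m ^ (m + 1))) * n := by ring
      _ ≤ 1 / 4 * δ * n := by gcongr
      _ = δ / 4 * n := by ring
  have hQ2 : 0 ≤ (∑ φ, Q φ) / Z := div_nonneg hQ0 hZ.le
  have hpt : ∀ φ, |(embWeight G c H S φ - Q φ) / Z - P φ * ℓ| ≤ P φ * (δ / 8) := by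
    intro φ
    by_cases hφ : GoodMap (kern G c) o θ w q S φ
    · have hcard : (univ.image φ).card = m := by
        rw [Finset.card_image_of_injective _ hφ.inj, Finset.card_univ, Fintype.card_fin]
      have h3 := h1 θ hθ0 hθa V (kern G c) o (univ.image φ) (S.image φ) Z
        ⟨φ w, Finset.mem_image_of_mem _ (mem_univ w)⟩ hcard
        (Finset.card_image_of_injective _ hφ.inj) hk
        (hcl V (kern G c) o θ φ hk.toIsNet hθ0.le hφ) (fun a => (partZ_eq_det G c a).symm) hZ
      have h4 : embWeight G c H S φ = P φ *
          (escLap (univ.image φ) (S.image φ) (kern G c)).det := by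
        have h5 := sum_trees_emb G c hq hadj S hφ.inj
        simp only [hP, if_pos hφ]
        rw [← h5]
        rfl
      have h6 : Q φ = 0 := by simp only [hQ, if_pos hφ]
      rw [h6, sub_zero, h4, mul_div_assoc, ← mul_sub, abs_mul, abs_of_nonneg (hP0 φ)]
      exact mul_le_mul_of_nonneg_left h3 (hP0 φ)
    · have h6 : Q φ = embWeight G c H S φ := by simp only [hQ, if_neg hφ]
      have h7 : P φ = 0 := by simp only [hP, if_neg hφ]
      rw [h6, h7]
      simp
  have hsum : |(∑ φ, (embWeight G c H S φ - Q φ)) / Z - (∑ φ, P φ) * ℓ| ≤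
      (∑ φ, P φ) * (δ / 8) := by
    rw [Finset.sum_div, Finset.sum_mul, Finset.sum_mul, ← Finset.sum_sub_distrib]
    exact (Finset.abs_sum_le_sum_abs _ _).trans (Finset.sum_le_sum fun φ _ => hpt φ)
  rw [Finset.sum_sub_distrib, sub_div] at hsum
  set W := (∑ φ, embWeight G c H S φ) / Z with hW
  have hmain : |W - n * ℓ| ≤ δ * n := by
    have e1 : |(∑ φ, P φ - n) * ℓ| ≤ δ / 4 * n := by
      rw [abs_mul, abs_of_nonneg hℓ0, mul_comm]
      exact hPb
    have e2 : (∑ φ, P φ) * (δ / 8) ≤ 2 * n * (δ / 8) := by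
      have := (abs_le.1 hPa).2
      exact mul_le_mul_of_nonneg_right (by linarith) (by positivity)
    have e3 := abs_le.1 e1
    have e4 := abs_le.1 (hsum.trans e2)
    have e5 : 0 ≤ δ * n := by positivity
    have e6 : (∑ φ, P φ - n) * ℓ = (∑ φ, P φ) * ℓ - n * ℓ := by ring
    rw [e6] at e3
    rw [abs_le]
    constructor <;> linarith [e3.1, e3.2, e4.1, e4.2]
  have ha : (1 : ℝ) ≤ (Nat.card {σ : H ≃g H // σ w = w} : ℝ) := by
    have : Finite (H ≃g H) :=
      Finite.of_injective (fun e => (e : Fin m → Fin m)) DFunLike.coe_injective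
    have : Nonempty {σ : H ≃g H // σ w = w} := ⟨⟨RelIso.refl _, rfl⟩⟩
    exact_mod_cast Nat.card_pos
  rw [wstBallProb_eq G c hH hr, pgwBallProb, if_pos ⟨hH, hr⟩]
  have hpgw : ((m : ℝ) - ((univ.filter fun x : Fin m => H.dist w x < r).card : ℝ)) *
      Real.exp (-(((univ.filter fun x : Fin m => H.dist w x < r).card : ℝ))) = ℓ := rfl
  rw [hpgw]
  set a : ℝ := (Nat.card {σ : H ≃g H // σ w = w} : ℝ) with hadef
  have e7 : n⁻¹ * a⁻¹ * W - ℓ / a = (W - n * ℓ) / (n * a) := by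
    have : a ≠ 0 := by linarith
    field_simp
  change |n⁻¹ * a⁻¹ * W - ℓ / a| ≤ δ
  rw [e7, abs_div, abs_of_pos (show 0 < n * a by positivity), div_le_iff₀ (by positivity)]
  have e8 : n * 1 ≤ n * a := mul_le_mul_of_nonneg_left ha hn.le
  nlinarith

end BallProb

/-! ### Radius zero and normalisation -/

section Normalise

lemma ballProb_radius_zero {G : SimpleGraph V} [DecidableRel G.Adj] {c : Sym2 V → ℝ}
    (hG : G.Connected) (hc : ∀ e ∈ G.edgeSet, 0 < c e) {m : ℕ} {H : SimpleGraph (Fin m)}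
    {w : Fin m} (hH : H.IsTree) (hr : ∀ i, H.dist w i ≤ 0) :
    wstBallProb G c 0 H w = pgwBallProb 0 H w := by
  have hw : ∀ i, i = w := fun i =>
    (((hH.connected w i).dist_eq_zero_iff).1 (Nat.le_zero.1 (hr i))).symm
  have : Subsingleton (Fin m) := ⟨fun i j => (hw i).trans (hw j).symm⟩
  have hm : m = 1 := by
    have h1 := Fintype.card_le_one_iff_subsingleton.2 ‹Subsingleton (Fin m)›
    rw [Fintype.card_fin] at h1
    have := Fin.pos w
    omega
  have hS : innerSet H w 0 = ∅ := by simp [innerSet]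
  have hφ : ∀ φ : Fin m → V, embWeight G c H ∅ φ = partZ G c := by
    intro φ
    refine Finset.sum_congr rfl fun T _ => ?_
    rw [if_pos, mul_one]
    refine ⟨Function.injective_of_subsingleton φ, fun i j hij => ?_, by simp⟩
    exact absurd (Subsingleton.elim i j) hij.ne
  have := hG.nonempty
  have hn : (Fintype.card V : ℝ) ≠ 0 := by exact_mod_cast Fintype.card_ne_zero
  rw [wstBallProb_eq G c hH hr, pgwBallProb, if_pos ⟨hH, hr⟩, hS]
  simp only [hφ, Finset.sum_const, Finset.card_univ, nsmul_eq_mul, Fintype.card_fun,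
    Fintype.card_fin]
  subst hm
  rw [mul_div_assoc, div_self (partZ_pos hG hc).ne']
  simp only [pow_one, mul_one, not_lt_zero, Finset.filter_false, Finset.card_empty,
    Nat.cast_zero, Nat.cast_one, sub_zero, neg_zero, Real.exp_zero, one_div]
  field_simp

lemma card_of_mem_spanningTrees {G : SimpleGraph V} {T : Finset (Sym2 V)}
    (hT : T ∈ spanningTrees G) : T.card = Fintype.card V - 1 := by
  classical
  simp only [spanningTrees, Finset.mem_filter] at hT
  have h := hT.2.2.card_edgeFinset
  have h2 : (SimpleGraph.fromEdgeSet (↑T : Set (Sym2 V))).edgeFinset = T := by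
    ext e
    simp only [SimpleGraph.mem_edgeFinset, SimpleGraph.edgeSet_fromEdgeSet, Set.mem_sdiff,
      Finset.mem_coe, and_iff_left_iff_imp]
    exact fun he => G.not_isDiag_of_mem_edgeSet (hT.2.1 he)
  rw [h2] at h
  omega

lemma wstBallProb_smul (G : SimpleGraph V) (c : Sym2 V → ℝ) {a : ℝ} (ha : a ≠ 0) (r : ℕ)
    {W : Type} (H : SimpleGraph W) (w : W) :
    wstBallProb G (fun e => a * c e) r H w = wstBallProb G c r H w := by
  have h1 : ∀ T ∈ spanningTrees G,
      treeWeight (fun e => a * c e) T = a ^ (Fintype.card V - 1) * treeWeight c T := by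
    intro T hT
    rw [treeWeight, Finset.prod_mul_distrib, Finset.prod_const, card_of_mem_spanningTrees hT,
      treeWeight]
  have h2 : partZ G (fun e => a * c e) = a ^ (Fintype.card V - 1) * partZ G c := by
    rw [partZ, partZ, Finset.mul_sum]
    exact Finset.sum_congr rfl h1
  rw [wstBallProb, wstBallProb, h2]
  congr 1
  refine Finset.sum_congr rfl fun x _ => ?_
  rw [← mul_div_mul_left _ (partZ G c) (pow_ne_zero (Fintype.card V - 1) ha), Finset.mul_sum]
  congr 1
  refine Finset.sum_congr rfl fun T hT => ?_
  rw [h1 T hT, mul_ite, mul_zero]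

lemma tot_kern_smul (G : SimpleGraph V) [DecidableRel G.Adj] (c : Sym2 V → ℝ) (a : ℝ) (x : V) :
    tot (kern G fun e => a * c e) x = a * vertCond G c x := by
  simp only [tot, kern, vertCond, Finset.mul_sum, SimpleGraph.neighborFinset_eq_filter,
    Finset.sum_filter, mul_ite, mul_zero, Sym2.eq_swap (a := x)]

/-- An almost regular network is good after rescaling by its parameter. -/
lemma isGoodNet_of_almost_regular {G : SimpleGraph V} [DecidableRel G.Adj] {c : Sym2 V → ℝ}
    {γ ε θ : ℝ} (hG : G.Connected) (hc : ∀ e ∈ G.edgeSet, 0 < c e) (hγ : 0 < γ) (hε : 0 ≤ ε)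
    (htyp : (1 - ε) * (Fintype.card V : ℝ) ≤
      ((univ.filter fun v : V => |vertCond G c v - γ| ≤ ε * γ).card : ℝ))
    (hsum : |(∑ v : V, vertCond G c v) - (Fintype.card V : ℝ) * γ| ≤
      ε * (Fintype.card V : ℝ) * γ)
    (hedge : ∀ e ∈ G.edgeSet, c e ≤ ε * γ) (o : V) (hθ : 0 < θ) (hθ1 : θ ≤ 1 / 2)
    (hεθ : 100 * ε ≤ θ ^ 3) : IsGoodNet (kern G fun e => γ⁻¹ * c e) o θ := by
  have hc' : ∀ e ∈ G.edgeSet, 0 < γ⁻¹ * c e := fun e he => mul_pos (inv_pos.2 hγ) (hc e he)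
  have hn : (0 : ℝ) < Fintype.card V := by exact_mod_cast Fintype.card_pos_iff.2 ⟨o⟩
  have hε1 : ε < 1 := by
    have : θ ^ 3 ≤ 1 := pow_le_one₀ hθ.le (by linarith)
    linarith
  have hV : 2 ≤ Fintype.card V := by
    by_contra hlt
    have : Subsingleton V := Fintype.card_le_one_iff_subsingleton.1 (by omega)
    have h0 : ∀ v, vertCond G c v = 0 := fun v => by
      refine Finset.sum_eq_zero fun u hu => ?_
      rw [SimpleGraph.mem_neighborFinset] at hu
      exact absurd (Subsingleton.elim v u) hu.ne
    simp only [h0, Finset.sum_const_zero, zero_sub, abs_neg] at hsum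
    rw [abs_of_pos (by positivity), mul_assoc] at hsum
    nlinarith [mul_pos hn hγ]
  have habs : ∀ x, |tot (kern G fun e => γ⁻¹ * c e) x - 1| ≤ ε ↔
      |vertCond G c x - γ| ≤ ε * γ := by
    intro x
    have h1 : tot (kern G fun e => γ⁻¹ * c e) x - 1 = (vertCond G c x - γ) / γ := by
      rw [tot_kern_smul]
      field_simp
    rw [h1, abs_div, abs_of_pos hγ, div_le_iff₀ hγ]
  have htot : ∑ x, tot (kern G fun e => γ⁻¹ * c e) x = (∑ x, vertCond G c x) / γ := by
    simp only [tot_kern_smul, ← Finset.mul_sum]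
    field_simp
  obtain ⟨hs1, hs2⟩ := abs_le.1 hsum
  refine isGoodNet hG hc' hV hε ⟨fun x y => ?_, ?_, ?_⟩ ?_ o hθ hθ1 hεθ
  · rw [kern]
    split_ifs with h
    · rw [inv_mul_le_iff₀ hγ, mul_comm γ]
      exact hedge _ h
    · exact hε
  · simp only [habs]
    have h1 := Finset.card_filter_add_card_filter_not (s := (univ : Finset V))
      (fun v : V => |vertCond G c v - γ| ≤ ε * γ)
    have h2 : ((univ.filter fun v : V => |vertCond G c v - γ| ≤ ε * γ).card : ℝ) +
        ((univ.filter fun v : V => ¬ |vertCond G c v - γ| ≤ ε * γ).card : ℝ) =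
        Fintype.card V := by
      rw [← Finset.card_univ, ← h1]
      push_cast
      rfl
    linarith
  · rw [htot, div_le_iff₀ hγ]
    linarith
  · rw [htot, le_div_iff₀ hγ]
    linarith

end Normalise

/-- For any high degree almost regular sequence of connected electric networks
`(Gₙ, cₙ)` on simple graphs, the local (Benjamini–Schramm) limit of the weighted spanning trees
`WST(cₙ)` is the Poisson(1) Galton–Watson tree conditioned to survive forever: for every radius
`r` and every finite rooted graph `(H, w)`, the probability that the `r`-ball of `WST(cₙ)`
around a uniform vertex is rooted-isomorphic to `(H, w)` converges to the corresponding ball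
probability of the conditioned Poisson(1) Galton–Watson tree. -/
theorem local_limit_wst_almost_regular
    (V : ℕ → Type) [∀ n, Fintype (V n)] [∀ n, DecidableEq (V n)]
    (G : ∀ n, SimpleGraph (V n)) [∀ n, DecidableRel (G n).Adj]
    (c : ∀ n, Sym2 (V n) → ℝ) (γ : ℕ → ℝ)
    -- the networks are connected, with positive conductances and positive parameter γₙ
    (hconn : ∀ n, (G n).Connected)
    (hpos : ∀ n, ∀ e ∈ (G n).edgeSet, 0 < c n e)
    (hγ : ∀ n, 0 < γ n)
    -- (1 - o(1))|V(Gₙ)| of the vertices have conductance C_v = (1 ± o(1))γₙ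
    (htyp : ∃ ε : ℕ → ℝ, Tendsto ε atTop (nhds 0) ∧ ∀ n,
      (((Finset.univ.filter fun v : V n =>
          |vertCond (G n) (c n) v - γ n| ≤ ε n * γ n).card : ℝ))
        ≥ (1 - ε n) * (Fintype.card (V n) : ℝ))
    -- the total conductance is (1 ± o(1))|V(Gₙ)|γₙ
    (hsum : ∃ ε : ℕ → ℝ, Tendsto ε atTop (nhds 0) ∧ ∀ n,
      |(∑ v : V n, vertCond (G n) (c n) v) - (Fintype.card (V n) : ℝ) * γ n|
        ≤ ε n * (Fintype.card (V n) : ℝ) * γ n)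
    -- sup_e c(e)/γₙ → 0
    (hedge : ∃ ε : ℕ → ℝ, Tendsto ε atTop (nhds 0) ∧ ∀ n, ∀ e ∈ (G n).edgeSet,
      c n e ≤ ε n * γ n) :
    ∀ (m : ℕ) (H : SimpleGraph (Fin m)) (w : Fin m) (r : ℕ),
      Tendsto (fun n => wstBallProb (G n) (c n) r H w) atTop (nhds (pgwBallProb r H w)) := by
  intro m H w r
  by_cases hH : H.IsTree ∧ ∀ i, H.dist w i ≤ r
  swap
  · simp only [wstBallProb_eq_zero _ _ hH, pgwBallProb, if_neg hH]
    exact tendsto_const_nhds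
  obtain ⟨hH, hr⟩ := hH
  rcases Nat.eq_zero_or_pos r with rfl | hr0
  · simp only [fun n => ballProb_radius_zero (hconn n) (hpos n) hH hr]
    exact tendsto_const_nhds
  obtain ⟨ε₁, hε₁, htyp⟩ := htyp
  obtain ⟨ε₂, hε₂, hsum⟩ := hsum
  obtain ⟨ε₃, hε₃, hedge⟩ := hedge
  rw [Metric.tendsto_nhds]
  intro δ hδ
  obtain ⟨θ, hθ, hθ1, hclose⟩ := exists_ballProb_close hr0 hH hr (half_pos hδ)
  have hη : 0 < θ ^ 3 / 100 := by positivity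
  filter_upwards [hε₁.eventually_le_const hη, hε₂.eventually_le_const hη,
    hε₃.eventually_le_const hη] with n h1 h2 h3
  have hγn := hγ n
  obtain ⟨o⟩ := (hconn n).nonempty
  have hgood : IsGoodNet (kern (G n) fun e => (γ n)⁻¹ * c n e) o θ := by
    refine isGoodNet_of_almost_regular (hconn n) (hpos n) hγn hη.le ?_ ?_ ?_ o hθ hθ1 (by linarith)
    · refine le_trans ?_ ((htyp n).le.trans ?_)
      · gcongr
      · refine Nat.cast_le.2 (Finset.card_le_card (Finset.monotone_filter_right _ fun v _ hv => ?_))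
        exact le_trans hv (mul_le_mul_of_nonneg_right h1 hγn.le)
    · exact (hsum n).trans (by gcongr)
    · exact fun e he => (hedge n e he).trans (by gcongr)
  have := hclose (V n) (G n) (fun e => (γ n)⁻¹ * c n e) o (hconn n)
    (fun e he => mul_pos (inv_pos.2 hγn) (hpos n e he)) hgood
  rw [wstBallProb_smul (G n) (c n) (inv_ne_zero hγn.ne')] at this
  rw [Real.dist_eq]
  linarith

end WSTPaper
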